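/- Let α, β > −1 and j ≥ 0. There is a constant C such that for all 0 < t ≤ 1 and θ, φ ∈ (0,π): |∂_θ^j H_t(θ,φ)| ≤ C (t² + θ² + φ²)^{−α−1/2} (t² + (π−θ)² + (π−φ)²)^{−β−1/2} · t / [t² + (θ−φ)²]^{1+j/2}. Moreover, provided it is not the case that both j = 0 and τ = 0, there exist constants C and c > 0 (depending on α, β, j) such that |∂_θ^j H_t(θ,φ)| ≤ C e^{−ct} for all t ≥ 1 and θ, φ ∈ (0,π). -/

import Mathlib

open MeasureTheory Real Set Filter
open scoped Classical

noncomputable section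

/-- The Jacobi measure dμ_{α,β} on (0,π). -/
def jacobiMeasure (α β : ℝ) : Measure ℝ :=
  (volume.restrict (Set.Ioo 0 π)).withDensity
    (fun θ => ENNReal.ofReal ((Real.sin (θ/2)) ^ (2*α+1) * (Real.cos (θ/2)) ^ (2*β+1)))

/-- The classical Jacobi polynomial `P_n^{(α,β)}`. -/
def jacobiPoly (α β : ℝ) (n : ℕ) (x : ℝ) : ℝ :=
  ∑ k ∈ Finset.range (n+1),
    (Real.Gamma ((n:ℝ)+α+1) / (Real.Gamma (α+(k:ℝ)+1) * (Nat.factorial (n-k)))) *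
    (Real.Gamma ((n:ℝ)+β+1) / (Real.Gamma ((n:ℝ)+β-(k:ℝ)+1) * (Nat.factorial k))) *
    ((x-1)/2)^k * ((x+1)/2)^(n-k)

/-- Normalized trigonometric Jacobi polynomial `𝒫_n(θ) = c_n P_n^{(α,β)}(cos θ)`. -/
def nJacobi (α β : ℝ) (c : ℕ → ℝ) (n : ℕ) (θ : ℝ) : ℝ :=
  c n * jacobiPoly α β n (Real.cos θ)

def jacobiTau (α β : ℝ) : ℝ := (α + β + 1) / 2

/-- `c` is an admissible sequence of (positive) normalizing constants. -/
def JacobiNormalized (α β : ℝ) (c : ℕ → ℝ) : Prop :=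
  (∀ n, 0 < c n) ∧
  ∀ n, ∫ θ, (nJacobi α β c n θ)^2 ∂(jacobiMeasure α β) = 1

/-- The Jacobi-Poisson kernel. -/
def poissonKer (α β : ℝ) (c : ℕ → ℝ) (t θ φ : ℝ) : ℝ :=
  ∑' n : ℕ, Real.exp (-t * |(n:ℝ) + jacobiTau α β|) * nJacobi α β c n θ * nJacobi α β c n φ

/-- The Riesz-Jacobi kernel of order `N`. -/
def rieszKer (α β : ℝ) (c : ℕ → ℝ) (N : ℕ) (θ φ : ℝ) : ℝ :=
  (1 / Real.Gamma (N:ℝ)) *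
    ∫ t in Set.Ioi (0:ℝ), iteratedDeriv N (fun θ' => poissonKer α β c t θ' φ) θ * t ^ (N-1)

/-- Inner product in `L²(dμ_{α,β})`. -/
def jacobiInner (α β : ℝ) (f g : ℝ → ℝ) : ℝ := ∫ θ, f θ * g θ ∂(jacobiMeasure α β)

/-- The Riesz-Jacobi transform of order `N` on test functions. -/
def rieszTransform (α β : ℝ) (c : ℕ → ℝ) (N : ℕ) (f : ℝ → ℝ) (θ : ℝ) : ℝ :=
  ∑' n : ℕ, |((n:ℝ)+1) + jacobiTau α β| ^ (-(N:ℝ)) *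
    jacobiInner α β f (nJacobi α β c (n+1)) *
    iteratedDeriv N (nJacobi α β c (n+1)) θ

/-- `f ∈ C_c^∞(0,π)`. -/
def IsCcSmooth (f : ℝ → ℝ) : Prop :=
  ContDiff ℝ (⊤ : ℕ∞) f ∧ HasCompactSupport f ∧ tsupport f ⊆ Set.Ioo 0 π

/-! ## Part 1 : algebra of Jacobi polynomials -/
section Algebra
open Polynomial

/-- rising factorial -/
def ris (x : ℝ) (l : ℕ) : ℝ := ∏ i ∈ Finset.range l, (x + i)

lemma ris_zero (x : ℝ) : ris x 0 = 1 := by simp [ris]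

lemma ris_succ (x : ℝ) (l : ℕ) : ris x (l+1) = ris x l * (x + l) := by
  simp [ris, Finset.prod_range_succ]

lemma ris_succ' (x : ℝ) (l : ℕ) : ris x (l+1) = x * ris (x+1) l := by
  simp only [ris, Finset.prod_range_succ']
  rw [mul_comm]; congr 1
  · simp
  · apply Finset.prod_congr rfl; intro i _; push_cast; ring

lemma ris_pos {x : ℝ} (hx : 0 < x) (l : ℕ) : 0 < ris x l :=
  Finset.prod_pos (fun i _ => by positivity)

lemma gamma_add_nat {x : ℝ} (hx : 0 < x) (l : ℕ) :
    Real.Gamma (x + l) = ris x l * Real.Gamma x := by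
  induction l with
  | zero => simp [ris_zero]
  | succ l ih =>
    have : x + ((l+1 : ℕ):ℝ) = (x + l) + 1 := by push_cast; ring
    rw [this, Real.Gamma_add_one (by positivity), ih, ris_succ]; ring

/-- The Jacobi operator on polynomials in `u = sin²(θ/2)`. -/
def Lop (α β : ℝ) (f : ℝ[X]) : ℝ[X] :=
  X * (1 - X) * derivative (derivative f) + (C (α+1) - C (α+β+2) * X) * derivative f

lemma Lop_coeff (α β : ℝ) (f : ℝ[X]) (j : ℕ) :
    (Lop α β f).coeff j = (j+1) * (j+1+α) * f.coeff (j+1) - j * (j+α+β+1) * f.coeff j := by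
  have h : Lop α β f = X * derivative (derivative f) - X * (X * derivative (derivative f))
      + C (α+1) * derivative f - C (α+β+2) * (X * derivative f) := by
    unfold Lop; ring
  rw [h]
  rcases j with _ | _ | j
  · simp only [coeff_add, coeff_sub, coeff_C_mul, coeff_X_mul_zero, coeff_derivative]
    push_cast; ring
  · simp only [coeff_add, coeff_sub, coeff_C_mul, coeff_X_mul_zero, coeff_X_mul, coeff_derivative]
    push_cast; ring
  · simp only [coeff_add, coeff_sub, coeff_C_mul, coeff_X_mul_zero, coeff_X_mul, coeff_derivative]
    push_cast; ring

lemma Lop_add (α β : ℝ) (f g : ℝ[X]) : Lop α β (f + g) = Lop α β f + Lop α β g := by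
  simp [Lop]; ring

lemma Lop_C_mul (α β a : ℝ) (f : ℝ[X]) : Lop α β (C a * f) = C a * Lop α β f := by
  simp [Lop]; ring

lemma Lop_sum {ι : Type*} (α β : ℝ) (s : Finset ι) (f : ι → ℝ[X]) :
    Lop α β (∑ i ∈ s, f i) = ∑ i ∈ s, Lop α β (f i) := by
  classical
  induction s using Finset.induction_on with
  | empty => simp [Lop]
  | insert a s ha ih => rw [Finset.sum_insert ha, Finset.sum_insert ha, Lop_add, ih]

lemma Lop_basis (α β : ℝ) (m k : ℕ) :
    Lop α β (X^m * (1-X)^k) = C (m * (m+α)) * (X^(m-1) * (1-X)^k)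
      + C (k * (k+β)) * (X^m * (1-X)^(k-1))
      - C (((m:ℝ)+k) * (m+k+α+β+1)) * (X^m * (1-X)^k) := by
  rcases m with _ | _ | m <;> rcases k with _ | _ | k <;>
  · simp [Lop, derivative_pow, map_ofNat]
    try ring

/-- uniqueness of eigenfunctions -/
lemma eig_unique {α β lam : ℝ} (hα : -1 < α) {f g : ℝ[X]} (hf : Lop α β f = - C lam * f)
    (hg : Lop α β g = - C lam * g) : C (g.coeff 0) * f = C (f.coeff 0) * g := by
  have key : ∀ j, g.coeff 0 * f.coeff j = f.coeff 0 * g.coeff j := by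
    intro j
    induction j with
    | zero => ring
    | succ j ih =>
      have h1 := Lop_coeff α β f j
      have h2 := Lop_coeff α β g j
      rw [hf] at h1; rw [hg] at h2
      simp only [← C_neg, coeff_C_mul] at h1 h2
      have h3 : ((j:ℝ)+1) * (j+1+α) ≠ 0 := by
        have : (0:ℝ) ≤ j := Nat.cast_nonneg j
        apply mul_ne_zero <;> nlinarith
      apply mul_left_cancel₀ h3
      linear_combination (-g.coeff 0) * h1 + f.coeff 0 * h2 + (-lam + j * (j+α+β+1)) * ih
  ext j
  simp only [coeff_C_mul]
  exact key j

/-- Coefficients of the Jacobi polynomial -/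
def jA (α β : ℝ) (n k : ℕ) : ℝ :=
    (Real.Gamma ((n:ℝ)+α+1) / (Real.Gamma (α+(k:ℝ)+1) * (Nat.factorial (n-k)))) *
    (Real.Gamma ((n:ℝ)+β+1) / (Real.Gamma ((n:ℝ)+β-(k:ℝ)+1) * (Nat.factorial k)))

def jP (α β : ℝ) (n : ℕ) : ℝ[X] :=
  ∑ k ∈ Finset.range (n+1), C (jA α β n k * (-1)^k) * (X^k * (1-X)^(n-k))

lemma jacobiPoly_eq (α β : ℝ) (n : ℕ) (x : ℝ) :
    jacobiPoly α β n x = (jP α β n).eval ((1-x)/2) := by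
  unfold jacobiPoly jP
  rw [eval_finsetSum]
  apply Finset.sum_congr rfl
  intro k _
  simp only [eval_mul, eval_C, eval_pow, eval_X, eval_sub, eval_one, jA]
  have h1 : (x-1)/2 = (-1) * ((1-x)/2) := by ring
  have h2 : (x+1)/2 = 1 - (1-x)/2 := by ring
  rw [h1, h2, mul_pow]; ring

lemma jA_rec {α β : ℝ} (hα : -1 < α) (hβ : -1 < β) {n k : ℕ} (hk : k < n) :
    jA α β n (k+1) * (k+1) * (k+1+α) = jA α β n k * ((n:ℝ)-k) * (n-k+β) := by
  obtain ⟨d, rfl⟩ : ∃ d, n = k + 1 + d := ⟨n - (k+1), by omega⟩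
  unfold jA
  have e1 : k + 1 + d - k = d + 1 := by omega
  have e2 : k + 1 + d - (k+1) = d := by omega
  rw [e1, e2]
  have hk0 : (0:ℝ) ≤ k := Nat.cast_nonneg k
  have hd0 : (0:ℝ) ≤ d := Nat.cast_nonneg d
  have g1 : α + ((k+1:ℕ):ℝ) + 1 = (α + k + 1) + 1 := by push_cast; ring
  have g2 : ((k+1+d:ℕ):ℝ) + β - (k:ℝ) + 1 = (d + β + 1) + 1 := by push_cast; ring
  have g3 : ((k+1+d:ℕ):ℝ) + β - ((k+1:ℕ):ℝ) + 1 = d + β + 1 := by push_cast; ring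
  generalize Real.Gamma (((k+1+d:ℕ):ℝ) + α + 1) = G1
  generalize Real.Gamma (((k+1+d:ℕ):ℝ) + β + 1) = G2
  rw [g1, g2, g3, Real.Gamma_add_one (s := α + k + 1) (by linarith),
    Real.Gamma_add_one (s := d + β + 1) (by linarith)]
  have p1 : Real.Gamma (α+k+1) ≠ 0 := (Real.Gamma_pos_of_pos (by linarith)).ne'
  have p2 : Real.Gamma (d+β+1) ≠ 0 := (Real.Gamma_pos_of_pos (by linarith)).ne'
  have p3 : α + k + 1 ≠ 0 := by linarith
  have p4 : d + β + 1 ≠ 0 := by linarith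
  rw [Nat.factorial_succ, Nat.factorial_succ]
  push_cast
  field_simp
  ring

lemma jP_eig {α β : ℝ} (hα : -1 < α) (hβ : -1 < β) (n : ℕ) :
    Lop α β (jP α β n) = - C ((n:ℝ) * (n+α+β+1)) * jP α β n := by
  unfold jP
  rw [Lop_sum, Finset.mul_sum]
  simp_rw [Lop_C_mul, Lop_basis]
  rw [← sub_eq_zero, ← Finset.sum_sub_distrib]
  have : ∀ k ∈ Finset.range (n+1),
      C (jA α β n k * (-1)^k) * (C (k * (k+α)) * (X^(k-1) * (1-X)^(n-k))
      + C (((n-k:ℕ):ℝ) * ((n-k:ℕ)+β)) * (X^k * (1-X)^(n-k-1))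
      - C (((k:ℝ)+(n-k:ℕ)) * (k+(n-k:ℕ)+α+β+1)) * (X^k * (1-X)^(n-k)))
      - (- C ((n:ℝ) * (n+α+β+1))) * (C (jA α β n k * (-1)^k) * (X^k * (1-X)^(n-k)))
     = C (jA α β n k * (-1)^k * (k * (k+α))) * (X^(k-1) * (1-X)^(n-k))
      + C (jA α β n k * (-1)^k * (((n:ℝ)-k) * (n-k+β))) * (X^k * (1-X)^(n-k-1)) := by
    intro k hk
    have hk' : k ≤ n := by simpa [Nat.lt_succ_iff] using hk
    rw [Nat.cast_sub hk']
    have : (k:ℝ) + (n - k) = n := by ring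
    rw [this]
    simp only [C_mul]
    ring
  rw [Finset.sum_congr rfl this, Finset.sum_add_distrib, Finset.sum_range_succ',
    Finset.sum_range_succ (f := fun k => C (jA α β n k * (-1)^k * (((n:ℝ)-k) * (n-k+β))) * (X^k * (1-X)^(n-k-1)))]
  simp only [Nat.cast_zero, zero_mul, mul_zero, sub_self, C_0, add_zero]
  rw [← Finset.sum_add_distrib]
  apply Finset.sum_eq_zero
  intro k hk
  have hk' : k < n := by simpa using hk
  have e : n - (k+1) = n - k - 1 := by omega
  rw [e, Nat.add_sub_cancel, ← add_mul, ← C_add]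
  have := jA_rec hα hβ hk'
  have h0 : jA α β n (k+1) * (-1)^(k+1) * (((k+1:ℕ):ℝ) * ((k+1:ℕ)+α)) +
      jA α β n k * (-1)^k * (((n:ℝ)-k) * (n-k+β)) = 0 := by
    push_cast
    rw [pow_succ]
    linear_combination (-(-1)^k) * this
  rw [h0]; simp

lemma jP_eval_zero {α β : ℝ} (hβ : -1 < β) (n : ℕ) :
    (jP α β n).eval 0 = Real.Gamma (n+α+1) / (Real.Gamma (α+1) * n.factorial) := by
  unfold jP
  rw [eval_finsetSum, Finset.sum_range_succ']
  have : Real.Gamma (n+β+1) ≠ 0 :=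
    (Real.Gamma_pos_of_pos (by have : (0:ℝ) ≤ n := Nat.cast_nonneg n; linarith)).ne'
  simp [jA]
  field_simp

lemma jP_eval_one {α β : ℝ} (hα : -1 < α) (n : ℕ) :
    (jP α β n).eval 1 = (-1)^n * (Real.Gamma (n+β+1) / (Real.Gamma (β+1) * n.factorial)) := by
  unfold jP
  rw [eval_finsetSum, Finset.sum_range_succ, Finset.sum_eq_zero]
  · have : Real.Gamma (n+α+1) ≠ 0 :=
      (Real.Gamma_pos_of_pos (by have : (0:ℝ) ≤ n := Nat.cast_nonneg n; linarith)).ne'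
    have e : α + n + 1 = n + α + 1 := by ring
    simp [jA, e]
    field_simp
  · intro k hk
    have hk' : k < n := by simpa using hk
    have : n - k ≠ 0 := by omega
    simp [this]

/-- coefficients of Appell's F4 -/
def jB (α β : ℝ) (n m k : ℕ) : ℝ :=
  ris (-n) (m+k) * ris (n+α+β+1) (m+k) / (ris (α+1) m * ris (β+1) k * m.factorial * k.factorial)

def jQ (α β : ℝ) (n : ℕ) (v : ℝ) : ℝ[X] :=
  ∑ m ∈ Finset.range (n+1), ∑ k ∈ Finset.range (n+1),
    C (jB α β n m k * v^m * (1-v)^k) * (X^m * (1-X)^k)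

lemma ris_neg_eq_zero {n l : ℕ} (h : n < l) : ris (-n) l = 0 := by
  unfold ris
  apply Finset.prod_eq_zero (i := n) (by simpa using h)
  simp

lemma jB_swap (α β : ℝ) (n m k : ℕ) : jB α β n m k = jB β α n k m := by
  unfold jB
  rw [add_comm m k]
  have : (n:ℝ)+α+β+1 = n+β+α+1 := by ring
  rw [this]; congr 1; ring

lemma jB_rec {α : ℝ} (β : ℝ) (hα : -1 < α) (n m k : ℕ) :
    jB α β n (m+1) k * ((m+1) * (m+1+α)) =
      jB α β n m k * ((-n + (m+k)) * (n+α+β+1+(m+k))) := by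
  unfold jB
  have e : m + 1 + k = (m+k)+1 := by ring
  rw [e, ris_succ, ris_succ, ris_succ, Nat.factorial_succ]
  have h1 : ris (α+1) m ≠ 0 := (ris_pos (by linarith) m).ne'
  have h2 : α + 1 + m ≠ 0 := by have : (0:ℝ) ≤ m := Nat.cast_nonneg m; linarith
  push_cast
  have h3 : (m:ℝ)+1 ≠ 0 := by positivity
  by_cases h4 : ris (β+1) k = 0
  · simp [h4]
  have h5 : (m:ℝ)+1+α ≠ 0 := by intro h; apply h2; linarith
  field_simp
  ring

lemma jQ_eig {α β : ℝ} (hα : -1 < α) (hβ : -1 < β) (n : ℕ) (v : ℝ) :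
    Lop α β (jQ α β n v) = - C ((n:ℝ) * (n+α+β+1)) * jQ α β n v := by
  have hz1 : ∀ m k, n < m + k → jB α β n m k = 0 := by
    intro m k h; unfold jB; rw [ris_neg_eq_zero h]; simp
  have s1 : ∑ m ∈ Finset.range (n+1), ∑ k ∈ Finset.range (n+1),
      C (jB α β n m k * v^m * (1-v)^k * (m * (m+α))) * (X^(m-1) * (1-X)^k) =
      ∑ m ∈ Finset.range (n+1), ∑ k ∈ Finset.range (n+1),
      C (jB α β n m k * ((-n + (m+k)) * (n+α+β+1+(m+k))) * v^m * (1-v)^k * v)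
        * (X^m * (1-X)^k : ℝ[X]) := by
    rw [Finset.sum_range_succ']
    conv_rhs => rw [Finset.sum_range_succ]
    have t1 : ∑ k ∈ Finset.range (n+1),
      C (jB α β n 0 k * v^0 * (1-v)^k * ((0:ℕ) * ((0:ℕ)+α))) * (X^(0-1) * (1-X)^k : ℝ[X]) = 0 := by
      simp
    have t2 : ∑ k ∈ Finset.range (n+1),
      C (jB α β n n k * ((-n + (n+k)) * (n+α+β+1+(n+k))) * v^n * (1-v)^k * v)
        * (X^n * (1-X)^k : ℝ[X]) = 0 := by
      apply Finset.sum_eq_zero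
      intro k _
      rcases k with _ | k
      · simp
      · rw [hz1 _ _ (by omega)]; simp
    rw [t1, t2, add_zero, add_zero]
    apply Finset.sum_congr rfl; intro m _
    apply Finset.sum_congr rfl; intro k _
    rw [← jB_rec β hα]
    push_cast
    congr 2
    ring
  have s2 : ∑ m ∈ Finset.range (n+1), ∑ k ∈ Finset.range (n+1),
      C (jB α β n m k * v^m * (1-v)^k * (k * (k+β))) * (X^m * (1-X)^(k-1)) =
      ∑ m ∈ Finset.range (n+1), ∑ k ∈ Finset.range (n+1),
      C (jB α β n m k * ((-n + (m+k)) * (n+α+β+1+(m+k))) * v^m * (1-v)^k * (1-v))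
        * (X^m * (1-X)^k : ℝ[X]) := by
    apply Finset.sum_congr rfl; intro m _
    rw [Finset.sum_range_succ', Finset.sum_range_succ]
    have t2 : jB α β n m n * ((-n + (m+n)) * (n+α+β+1+(m+n))) = 0 := by
      rcases m with _ | m
      · simp
      · rw [hz1 _ _ (by omega)]; simp
    rw [t2]
    simp only [Nat.cast_zero, zero_mul, mul_zero, C_0, add_zero]
    apply Finset.sum_congr rfl; intro k _
    have := jB_rec α hβ n k m
    have e : jB α β n m k * ((-n + (m+k)) * (n+α+β+1+(m+k))) =
      jB α β n m (k+1) * ((k+1) * (k+1+β)) := by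
      rw [jB_swap α β n m k, jB_swap α β n m (k+1), this]; ring
    rw [e]
    push_cast
    congr 2
    ring
  have : Lop α β (jQ α β n v) = ∑ m ∈ Finset.range (n+1), ∑ k ∈ Finset.range (n+1),
      C (jB α β n m k * v^m * (1-v)^k * (m * (m+α))) * (X^(m-1) * (1-X)^k) +
      ∑ m ∈ Finset.range (n+1), ∑ k ∈ Finset.range (n+1),
      C (jB α β n m k * v^m * (1-v)^k * (k * (k+β))) * (X^m * (1-X)^(k-1)) -
      ∑ m ∈ Finset.range (n+1), ∑ k ∈ Finset.range (n+1),
      C (jB α β n m k * v^m * (1-v)^k * (((m:ℝ)+k) * (m+k+α+β+1))) * (X^m * (1-X)^k) := by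
    unfold jQ
    simp_rw [Lop_sum, Lop_C_mul, Lop_basis]
    simp_rw [← Finset.sum_add_distrib, ← Finset.sum_sub_distrib]
    apply Finset.sum_congr rfl; intro m _
    apply Finset.sum_congr rfl; intro k _
    simp only [C_mul]; ring
  rw [this, s1, s2]
  unfold jQ
  simp_rw [Finset.mul_sum, ← Finset.sum_add_distrib, ← Finset.sum_sub_distrib]
  apply Finset.sum_congr rfl; intro m _
  apply Finset.sum_congr rfl; intro k _
  rw [← add_mul, ← sub_mul, ← C_add, ← C_sub, ← C_neg, ← mul_assoc (C _) (C _) _, ← C_mul]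
  congr 2
  ring

def jQv (α β : ℝ) (n : ℕ) (u v : ℝ) : ℝ :=
  ∑ m ∈ Finset.range (n+1), ∑ k ∈ Finset.range (n+1), jB α β n m k * (u*v)^m * ((1-u)*(1-v))^k

lemma jQ_eval (α β : ℝ) (n : ℕ) (u v : ℝ) : (jQ α β n v).eval u = jQv α β n u v := by
  unfold jQ jQv
  simp only [eval_finsetSum]
  apply Finset.sum_congr rfl; intro m _
  apply Finset.sum_congr rfl; intro k _
  simp only [eval_mul, eval_C, eval_pow, eval_X, eval_sub, eval_one]
  rw [mul_pow, mul_pow]; ring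

lemma jQv_symm (α β : ℝ) (n : ℕ) (u v : ℝ) : jQv α β n u v = jQv α β n v u := by
  unfold jQv; simp only [mul_comm]

lemma jQv_swap (α β : ℝ) (n : ℕ) (u v : ℝ) : jQv α β n u v = jQv β α n (1-u) (1-v) := by
  unfold jQv
  rw [Finset.sum_comm]
  apply Finset.sum_congr rfl; intro m _
  apply Finset.sum_congr rfl; intro k _
  rw [jB_swap]; simp only [sub_sub_cancel]; ring

lemma jQv_zero_one {α β : ℝ} (n : ℕ) : jQv α β n 0 1 = 1 := by
  unfold jQv
  rw [Finset.sum_eq_single 0, Finset.sum_eq_single 0]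
  · simp [jB, ris_zero]
  · intro k _ hk; simp [hk]
  · simp
  · intro m _ hm; apply Finset.sum_eq_zero; intro k _; simp [hm]
  · simp

lemma eig_eval {α β : ℝ} (hα : -1 < α) (hβ : -1 < β) (n : ℕ) (u v : ℝ) :
    (jP α β n).eval 0 * jQv α β n u v = jQv α β n 0 v * (jP α β n).eval u := by
  have := congrArg (eval u) (eig_unique hα (jQ_eig hα hβ n v) (jP_eig hα hβ n))
  simpa only [eval_mul, eval_C, coeff_zero_eq_eval_zero, jQ_eval] using this

lemma cast_add_pos {x : ℝ} (hx : -1 < x) (n : ℕ) : 0 < (n:ℝ) + x + 1 := by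
  have : (0:ℝ) ≤ n := Nat.cast_nonneg n
  linarith

lemma jP_mul_jP {α β : ℝ} (hα : -1 < α) (hβ : -1 < β) (n : ℕ) (u v : ℝ) :
    (jP α β n).eval u * (jP α β n).eval v =
      (-1)^n * (Real.Gamma (n+α+1) * Real.Gamma (n+β+1) /
        (Real.Gamma (α+1) * Real.Gamma (β+1) * (n.factorial)^2)) * jQv α β n u v := by
  have h1 := eig_eval hα hβ n u v
  have h2 := eig_eval hα hβ n v 0
  rw [jQv_symm α β n v 0] at h2
  have h3 := eig_eval hβ hα n 1 1
  rw [jQv_zero_one, one_mul, jP_eval_one hβ, jP_eval_zero hα] at h3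
  have h4 : jQv β α n 1 1 = jQv α β n 0 0 := by rw [jQv_swap]; simp
  rw [h4] at h3
  rw [jP_eval_zero hβ] at h1 h2
  have p1 := (Real.Gamma_pos_of_pos (cast_add_pos hα n)).ne'
  have p2 := (Real.Gamma_pos_of_pos (cast_add_pos hβ n)).ne'
  have p3 := (Real.Gamma_pos_of_pos (show 0 < α + 1 by linarith)).ne'
  have p4 := (Real.Gamma_pos_of_pos (show 0 < β + 1 by linarith)).ne'
  have p5 : (n.factorial:ℝ) ≠ 0 := by positivity
  generalize hA : Real.Gamma (n+α+1) = A at *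
  generalize hB : Real.Gamma (n+β+1) = B at *
  generalize hA' : Real.Gamma (α+1) = A' at *
  generalize hB' : Real.Gamma (β+1) = B' at *
  have hs : ((-1:ℝ)^n) * (-1)^n = 1 := by rw [← mul_pow]; simp
  field_simp at h1 h2 h3 ⊢
  set U := (jP α β n).eval u
  set V := (jP α β n).eval v
  set Q := jQv α β n u v
  set Q0 := jQv α β n 0 v
  set q := jQv α β n 0 0
  apply mul_left_cancel₀ p1
  linear_combination (-(A * B * (-1)^n)) * h1 - (B * (-1)^n * A' * n.factorial * U) * h2 -
    ((-1)^n * A' * n.factorial^2 * U * V) * h3 - (A' * n.factorial^2 * U * V * A * B') * hs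

end Algebra

/-! ## Part 2 : norms -/
section Norms
open Polynomial

lemma jP_natDegree_le (α β : ℝ) (n : ℕ) : (jP α β n).natDegree ≤ n := by
  unfold jP
  apply natDegree_sum_le_of_forall_le
  intro k hk
  have hk' : k ≤ n := by simpa [Nat.lt_succ_iff] using hk
  refine (natDegree_C_mul_le _ _).trans (natDegree_mul_le.trans ?_)
  have h1 : ((X:ℝ[X])^k).natDegree ≤ k := by simp
  have h2 : ((1-X:ℝ[X])^(n-k)).natDegree ≤ n-k := by
    refine natDegree_pow_le.trans ?_
    have : (1 - X : ℝ[X]).natDegree ≤ 1 := by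
      refine (natDegree_sub_le _ _).trans ?_
      simp
    nlinarith
  omega

lemma jP_coeff {α β : ℝ} (hα : -1 < α) (hβ : -1 < β) (n j : ℕ) (hj : j ≤ n) :
    (jP α β n).coeff j * (j.factorial * ris (α+1) j * (n-j).factorial) =
      (-1)^j * n.factorial * ris (n+α+β+1) j * (jP α β n).coeff 0 := by
  induction j with
  | zero => simp [ris_zero]; ring
  | succ j ih =>
    have ih := ih (by omega)
    have h := Lop_coeff α β (jP α β n) j
    rw [jP_eig hα hβ, ← C_neg, coeff_C_mul] at h
    obtain ⟨d, rfl⟩ : ∃ d, n = j + 1 + d := ⟨n - (j+1), by omega⟩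
    have e1 : j + 1 + d - j = d + 1 := by omega
    have e2 : j + 1 + d - (j+1) = d := by omega
    rw [e1, Nat.factorial_succ d] at ih
    rw [e2, ris_succ, ris_succ, Nat.factorial_succ, pow_succ]
    have h3 : ((d:ℝ)+1) ≠ 0 := by positivity
    apply mul_left_cancel₀ h3
    push_cast at *
    generalize (((j+1+d).factorial:ℕ):ℝ) = F at *
    generalize ris ((j:ℝ)+1+d+α+β+1) j = R at *
    generalize ris (α+1) j = S at *
    generalize (j.factorial:ℝ) = J at *
    generalize (d.factorial:ℝ) = D at *
    linear_combination ( - J * S * D * (d+1)) * h - (j+1+d+α+β+1+j) *(d+1) * ih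

lemma jP_coeff_top {α β : ℝ} (hα : -1 < α) (hβ : -1 < β) (n : ℕ) :
    (jP α β n).coeff n = (-1)^n * ris (n+α+β+1) n / n.factorial := by
  have h := jP_coeff hα hβ n n le_rfl
  rw [coeff_zero_eq_eval_zero, jP_eval_zero hβ] at h
  have e : (n:ℝ) + α + 1 = (α + 1) + n := by ring
  rw [e, gamma_add_nat (by linarith)] at h
  have p1 := (ris_pos (show 0 < α + 1 by linarith) n).ne'
  have p3 := (Real.Gamma_pos_of_pos (show 0 < α + 1 by linarith)).ne'
  have p5 : (n.factorial:ℝ) ≠ 0 := by positivity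
  simp only [Nat.sub_self, Nat.factorial_zero, Nat.cast_one, mul_one] at h
  rw [eq_div_iff p5]
  apply mul_right_cancel₀ p1
  rw [mul_assoc, h]
  field_simp

lemma fwd_ris (n m : ℕ) (h : m ≤ n) (y x : ℝ) :
    (fwdDiff (1:ℝ))^[n] (fun x => ris (x+y) m) x = if m = n then (n.factorial:ℝ) else 0 := by
  induction n generalizing m y with
  | zero =>
    obtain rfl : m = 0 := by omega
    simp [ris_zero]
  | succ n ih =>
    rw [Function.iterate_succ_apply]
    rcases m with _ | m
    · have : fwdDiff (1:ℝ) (fun x => ris (x+y) 0) = fun _ => (0:ℝ) := by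
        ext x; simp [fwdDiff, ris_zero]
      rw [this]
      have : ∀ k, (fwdDiff (1:ℝ))^[k] (fun _ : ℝ => (0:ℝ)) = fun _ => 0 := by
        intro k
        induction k with
        | zero => rfl
        | succ k ihk => rw [Function.iterate_succ_apply, fwdDiff_const, ihk]
      rw [this]; simp
    · have : fwdDiff (1:ℝ) (fun x => ris (x+y) (m+1)) = ((m:ℝ)+1) • fun x => ris (x+(y+1)) m := by
        ext x
        simp only [fwdDiff, Pi.smul_apply, smul_eq_mul]
        rw [ris_succ, ris_succ']
        have : x + 1 + y = x + y + 1 := by ring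
        rw [this, show x + (y+1) = x + y + 1 by ring]
        ring
      rw [this, fwdDiff_iter_const_smul, Pi.smul_apply, ih m (by omega)]
      by_cases hm : m = n
      · simp [hm, Nat.factorial_succ]
      · simp [hm]

lemma alt_sum_ris (n m : ℕ) (h : m ≤ n) (y : ℝ) :
    ∑ k ∈ Finset.range (n+1), (-1:ℝ)^k * (n.choose k) * ris (y+k) m =
      if m = n then (-1)^n * (n.factorial:ℝ) else 0 := by
  have h1 := fwd_ris n m h 0 y
  rw [fwdDiff_iter_eq_sum_shift] at h1
  have : ∑ k ∈ Finset.range (n+1), (-1:ℝ)^k * (n.choose k) * ris (y+k) m =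
      (-1)^n * ∑ k ∈ Finset.range (n+1), ((-1 : ℤ) ^ (n - k) * n.choose k) • ris (y + k • (1:ℝ) + 0) m := by
    rw [Finset.mul_sum]
    apply Finset.sum_congr rfl
    intro k hk
    have hk' : k ≤ n := by simpa [Nat.lt_succ_iff] using hk
    obtain ⟨d, rfl⟩ : ∃ d, n = k + d := ⟨n - k, by omega⟩
    have e : k + d - k = d := by omega
    rw [e, zsmul_eq_mul]
    push_cast
    simp only [nsmul_eq_mul, mul_one, add_zero]
    have hs : ((-1:ℝ)^d) * (-1)^d = 1 := by rw [← mul_pow]; simp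
    rw [pow_add]
    linear_combination -((-1:ℝ)^k * ((k+d).choose k) * ris (y+k) m) * hs
  rw [this, h1]
  split_ifs <;> simp

lemma beta_int {a b : ℝ} (ha : 0 < a) (hb : 0 < b) :
    IntegrableOn (fun x : ℝ => x^(a-1) * (1-x)^(b-1)) (Ioo 0 1) ∧
    ∫ x in Ioo (0:ℝ) 1, x^(a-1) * (1-x)^(b-1) = Real.Gamma a * Real.Gamma b / Real.Gamma (a+b) := by
  have hc := Complex.betaIntegral_convergent (u := a) (v := b) (by simpa) (by simpa)
  rw [intervalIntegrable_iff_integrableOn_Ioc_of_le (by simp), IntegrableOn] at hc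
  have heq : ∀ x ∈ Ioc (0:ℝ) 1, ((x:ℂ)^((a:ℂ)-1) * (1-(x:ℂ))^((b:ℂ)-1)).re = x^(a-1) * (1-x)^(b-1) := by
    intro x ⟨hx1, hx2⟩
    norm_cast
    rw [← Complex.ofReal_cpow hx1.le, ← Complex.ofReal_cpow (by linarith),
      Complex.re_mul_ofReal, Complex.ofReal_re]
  constructor
  · rw [← integrableOn_Ioc_iff_integrableOn_Ioo]
    refine IntegrableOn.congr_fun ?_ heq measurableSet_Ioc
    exact hc.re
  · have h1 := ProbabilityTheory.beta_eq_betaIntegralReal a b ha hb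
    rw [ProbabilityTheory.beta] at h1
    rw [h1, Complex.betaIntegral, intervalIntegral.integral_of_le (by norm_num),
      ← integral_Ioc_eq_integral_Ioo, ← RCLike.re_to_complex, ← integral_re hc]
    exact (setIntegral_congr_fun measurableSet_Ioc heq).symm

lemma jac_change (α β : ℝ) (g : ℝ → ℝ) :
    ∫ θ, g ((1 - Real.cos θ)/2) ∂(jacobiMeasure α β) =
      ∫ u in Ioo (0:ℝ) 1, g u * (u^α * (1-u)^β) := by
  have himg : (fun θ : ℝ => (1 - Real.cos θ)/2) '' Ioo 0 π = Ioo 0 1 := by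
    ext u
    constructor
    · rintro ⟨θ, ⟨h1, h2⟩, rfl⟩
      have := Real.cos_lt_cos_of_nonneg_of_le_pi le_rfl h2.le h1
      have h3 := Real.cos_lt_cos_of_nonneg_of_le_pi h1.le le_rfl h2
      simp at this h3
      constructor <;> simp only <;> linarith
    · rintro ⟨h1, h2⟩
      refine ⟨Real.arccos (1-2*u), ⟨?_, ?_⟩, ?_⟩
      · rw [Real.arccos_pos]; linarith
      · have h3 := Real.arccos_lt_arccos (x := -1) (y := 1-2*u) le_rfl (by linarith) (by linarith)
        rwa [Real.arccos_neg_one] at h3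
      · simp only; rw [Real.cos_arccos (by linarith) (by linarith)]; ring
  have hinj : InjOn (fun θ : ℝ => (1 - Real.cos θ)/2) (Ioo 0 π) := by
    intro x hx y hy h
    simp only at h
    exact Real.injOn_cos ⟨hx.1.le, hx.2.le⟩ ⟨hy.1.le, hy.2.le⟩ (by linarith)
  have hder : ∀ x ∈ Ioo (0:ℝ) π, HasDerivWithinAt (fun θ : ℝ => (1 - Real.cos θ)/2)
      (Real.sin x / 2) (Ioo 0 π) x := by
    intro x _
    have := ((Real.hasDerivAt_cos x).const_sub 1).div_const 2
    simpa using this.hasDerivWithinAt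
  rw [← himg, integral_image_eq_integral_abs_deriv_smul measurableSet_Ioo hder hinj]
  unfold jacobiMeasure
  rw [integral_withDensity_eq_integral_toReal_smul (by fun_prop) (by simp)]
  apply setIntegral_congr_fun measurableSet_Ioo
  intro θ ⟨h1, h2⟩
  have hs : 0 < Real.sin (θ/2) := Real.sin_pos_of_pos_of_lt_pi (by linarith) (by linarith)
  have hc : 0 < Real.cos (θ/2) := Real.cos_pos_of_mem_Ioo ⟨by linarith, by linarith⟩
  have e1 : (1 - Real.cos θ)/2 = Real.sin (θ/2)^2 := by
    rw [Real.sin_sq_eq_half_sub]; rw [mul_div_cancel₀ _ (by norm_num)]; ring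
  have e2 : 1 - Real.sin (θ/2)^2 = Real.cos (θ/2)^2 := by
    have := Real.sin_sq_add_cos_sq (θ/2); linarith
  have e3 : Real.sin θ = 2 * Real.sin (θ/2) * Real.cos (θ/2) := by
    rw [← Real.sin_two_mul]; congr 1; ring
  have hr : ∀ {x : ℝ}, 0 < x → ∀ a : ℝ, x^(2*a+1) = x * (x^2)^a := by
    intro x hx a
    rw [Real.rpow_add hx, Real.rpow_one, Real.rpow_mul hx.le, Real.rpow_two]; ring
  simp only [smul_eq_mul]
  rw [e1, e2, e3, hr hs, hr hc, ENNReal.toReal_ofReal (by positivity), abs_of_pos (by positivity)]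
  ring

lemma mono_int {α β : ℝ} (hα : -1 < α) (hβ : -1 < β) (k l : ℕ) :
    IntegrableOn (fun u : ℝ => u^k * (1-u)^l * (u^α * (1-u)^β)) (Ioo 0 1) ∧
    ∫ u in Ioo (0:ℝ) 1, u^k * (1-u)^l * (u^α * (1-u)^β) =
      Real.Gamma (k+α+1) * Real.Gamma (l+β+1) / Real.Gamma (k+l+α+β+2) := by
  have h := beta_int (cast_add_pos hα k) (cast_add_pos hβ l)
  have heq : ∀ u ∈ Ioo (0:ℝ) 1, u^((k:ℝ)+α+1-1) * (1-u)^((l:ℝ)+β+1-1) =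
      u^k * (1-u)^l * (u^α * (1-u)^β) := by
    intro u ⟨h1, h2⟩
    have h3 : 0 < 1 - u := by linarith
    rw [show (k:ℝ)+α+1-1 = k + α by ring, show (l:ℝ)+β+1-1 = l+β by ring,
      Real.rpow_add h1, Real.rpow_add h3, Real.rpow_natCast, Real.rpow_natCast]
    ring
  rw [setIntegral_congr_fun measurableSet_Ioo heq] at h
  refine ⟨h.1.congr_fun heq measurableSet_Ioo, ?_⟩
  rw [h.2]; congr 2; ring

lemma jP_moment {α β : ℝ} (hα : -1 < α) (hβ : -1 < β) (n m : ℕ) (hm : m ≤ n) :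
    ∫ u in Ioo (0:ℝ) 1, (jP α β n).eval u * u^m * (u^α * (1-u)^β) =
      if m = n then (-1)^n * (Real.Gamma (n+α+1) * Real.Gamma (n+β+1) / Real.Gamma (2*n+α+β+2))
      else 0 := by
  have e : ∀ u : ℝ, (jP α β n).eval u * u^m * (u^α * (1-u)^β) =
      ∑ k ∈ Finset.range (n+1), (jA α β n k * (-1)^k) * (u^(k+m) * (1-u)^(n-k) * (u^α * (1-u)^β)) := by
    intro u
    unfold jP
    rw [eval_finsetSum, Finset.sum_mul, Finset.sum_mul]
    apply Finset.sum_congr rfl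
    intro k _
    simp only [eval_mul, eval_C, eval_pow, eval_X, eval_sub, eval_one]
    rw [pow_add]; ring
  simp_rw [e]
  rw [integral_finsetSum _ (fun k _ => ((mono_int hα hβ _ _).1.const_mul _))]
  simp_rw [integral_const_mul, (mono_int hα hβ _ _).2]
  have pα := (Real.Gamma_pos_of_pos (cast_add_pos hα n)).ne'
  have pβ := (Real.Gamma_pos_of_pos (cast_add_pos hβ n)).ne'
  have t : ∀ k ∈ Finset.range (n+1), (jA α β n k * (-1)^k) *
      (Real.Gamma (((k+m:ℕ):ℝ)+α+1) * Real.Gamma (((n-k:ℕ):ℝ)+β+1) /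
        Real.Gamma (((k+m:ℕ):ℝ)+(n-k:ℕ)+α+β+2)) =
      (Real.Gamma (n+α+1) * Real.Gamma (n+β+1) / (Real.Gamma (n+m+α+β+2) * n.factorial)) *
      ((-1)^k * (n.choose k) * ris ((α+1)+k) m) := by
    intro k hk
    have hk' : k ≤ n := by simpa [Nat.lt_succ_iff] using hk
    obtain ⟨d, rfl⟩ : ∃ d, n = k + d := ⟨n - k, by omega⟩
    have e : k + d - k = d := by omega
    unfold jA
    rw [e]
    have g1 : ((k+m:ℕ):ℝ)+α+1 = (α+1+k) + m := by push_cast; ring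
    have g2 : ((k+d:ℕ):ℝ)+β-k+1 = d + β + 1 := by push_cast; ring
    have g3 : ((k+m:ℕ):ℝ)+d+α+β+2 = ((k+d:ℕ):ℝ)+m+α+β+2 := by push_cast; ring
    have hk0 : (0:ℝ) ≤ k := Nat.cast_nonneg k
    have hd0 : (0:ℝ) ≤ d := Nat.cast_nonneg d
    have p1 : Real.Gamma (α+1+k) ≠ 0 := (Real.Gamma_pos_of_pos (by linarith)).ne'
    have p2 : Real.Gamma (d+β+1) ≠ 0 := (Real.Gamma_pos_of_pos (by linarith)).ne'
    rw [g1, g2, g3, gamma_add_nat (by linarith), show α + (k:ℝ) + 1 = α + 1 + k by ring]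
    have hch : ((k+d).choose k : ℝ) * (k.factorial * d.factorial) = (k+d).factorial := by
      have := Nat.choose_mul_factorial_mul_factorial hk'
      rw [e] at this
      rw [← this]; push_cast; ring
    have q1 : ((k+d).factorial:ℝ) ≠ 0 := by positivity
    have q2 : ((k).factorial:ℝ) ≠ 0 := by positivity
    have q3 : ((d).factorial:ℝ) ≠ 0 := by positivity
    generalize Real.Gamma (((k+d:ℕ):ℝ)+α+1) = G1
    generalize Real.Gamma (((k+d:ℕ):ℝ)+β+1) = G2
    generalize Real.Gamma (((k+d:ℕ):ℝ)+m+α+β+2) = G3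
    by_cases h3 : G3 = 0
    · simp [h3]
    rw [← hch]
    have q4 : ((k+d).choose k : ℝ) ≠ 0 := by
      intro h; rw [h] at hch; simp at hch; exact q1 hch.symm
    field_simp
  rw [Finset.sum_congr rfl t, ← Finset.mul_sum, alt_sum_ris n m hm]
  split_ifs with h
  · subst h
    have q1 : (m.factorial:ℝ) ≠ 0 := by positivity
    rw [show (m:ℝ)+m+α+β+2 = 2*m+α+β+2 by ring]
    field_simp
  · simp

/-- the norm squared -/
def jh (α β : ℝ) (n : ℕ) : ℝ := Real.Gamma (n+α+1) * Real.Gamma (n+β+1) * ris (n+α+β+1) n /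
  (Real.Gamma (2*n+α+β+2) * n.factorial)

lemma jP_norm {α β : ℝ} (hα : -1 < α) (hβ : -1 < β) (n : ℕ) :
    ∫ u in Ioo (0:ℝ) 1, (jP α β n).eval u^2 * (u^α * (1-u)^β) = jh α β n := by
  have e : ∀ u : ℝ, (jP α β n).eval u^2 * (u^α * (1-u)^β) =
      ∑ m ∈ Finset.range (n+1), (jP α β n).coeff m * ((jP α β n).eval u * u^m * (u^α * (1-u)^β)) := by
    intro u
    rw [sq]
    nth_rewrite 2 [eval_eq_sum_range' (Nat.lt_succ_of_le (jP_natDegree_le α β n))]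
    rw [Finset.mul_sum, Finset.sum_mul]
    apply Finset.sum_congr rfl; intro m _; ring
  simp_rw [e]
  have hintg : ∀ m : ℕ, IntegrableOn (fun u : ℝ => (jP α β n).eval u * u^m * (u^α * (1-u)^β)) (Ioo 0 1) := by
    intro m
    have e : ∀ u : ℝ, (jP α β n).eval u * u^m * (u^α * (1-u)^β) =
      ∑ k ∈ Finset.range (n+1), (jP α β n).coeff k * (u^(k+m) * (1-u)^0 * (u^α * (1-u)^β)) := by
      intro u
      rw [eval_eq_sum_range' (Nat.lt_succ_of_le (jP_natDegree_le α β n)), Finset.sum_mul, Finset.sum_mul]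
      apply Finset.sum_congr rfl; intro m _; rw [pow_add]; ring
    simp_rw [e]
    exact integrable_finsetSum _ (fun k _ => ((mono_int hα hβ _ _).1.const_mul _))
  rw [integral_finsetSum _ (fun m _ => (hintg m).const_mul _)]
  simp_rw [integral_const_mul]
  rw [Finset.sum_range_succ, Finset.sum_eq_zero, zero_add, jP_moment hα hβ n n le_rfl, if_pos rfl,
    jP_coeff_top hα hβ, jh]
  · have hs : ((-1:ℝ)^n) * (-1)^n = 1 := by rw [← mul_pow]; simp
    calc _ = (((-1:ℝ)^n) * (-1)^n) * (ris (n+α+β+1) n / n.factorial *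
      (Real.Gamma (n+α+1) * Real.Gamma (n+β+1) / Real.Gamma (2*n+α+β+2))) := by ring
      _ = _ := by rw [hs, one_mul, div_mul_div_comm]; congr 1 <;> ring
  · intro m hm
    have hm' : m < n := by simpa using hm
    rw [jP_moment hα hβ n m hm'.le, if_neg hm'.ne, mul_zero]

lemma c_sq {α β : ℝ} (hα : -1 < α) (hβ : -1 < β) {c : ℕ → ℝ} (hc : JacobiNormalized α β c) (n : ℕ) :
    c n ^ 2 * jh α β n = 1 := by
  have h := hc.2 n
  unfold nJacobi at h
  simp_rw [jacobiPoly_eq] at h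
  rw [jac_change α β (fun u => (c n * (jP α β n).eval u)^2)] at h
  rw [← h, ← jP_norm hα hβ, ← integral_const_mul]
  apply integral_congr_ae
  filter_upwards with u
  ring

end Norms

/-! ## Part 3 : the coefficient identity -/

/-- weights -/
def wco (l : ℕ) (σ : ℝ) : ℝ := ris σ l / l.factorial + (if l = 0 then 0 else ris σ (l-1) / (l-1).factorial)

def sigN (α β : ℝ) (N : ℕ) (p q : ℝ) : ℝ :=
  ∑ x ∈ Finset.HasAntidiagonal.antidiagonal N, p^x.1 * q^x.2 /
    (Real.Gamma (α+1+x.1) * Real.Gamma (β+1+x.2) * x.1.factorial * x.2.factorial)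

def SN (α β : ℝ) (N : ℕ) (p q : ℝ) : ℝ := Real.Gamma (2*N+α+β+2) * sigN α β N p q

lemma ris_add (x : ℝ) (a b : ℕ) : ris x (a+b) = ris x a * ris (x+a) b := by
  induction b with
  | zero => simp [ris_zero]
  | succ b ih => rw [← add_assoc, ris_succ, ih, ris_succ]; push_cast; ring

lemma ris_neg_nat (N l : ℕ) : ris (-((N+l:ℕ):ℝ)) N * l.factorial = (-1)^N * (N+l).factorial := by
  induction N generalizing l with
  | zero => simp [ris_zero]
  | succ N ih =>
    have := ih (l+1)
    rw [ris_succ]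
    have e : N + 1 + l = N + (l+1) := by ring
    rw [e, pow_succ]
    rw [Nat.factorial_succ l] at this
    push_cast at *
    linear_combination (-1) * this

lemma wco_eq {σ : ℝ} (hσ : 0 < σ) (l : ℕ) :
    ris σ (2*l) = wco l σ * (ris (σ+l-1) l * l.factorial) := by
  rcases l with _ | l
  · simp [wco, ris_zero]
  · unfold wco
    rw [if_neg (by omega)]
    have e : 2*(l+1) = l + ((l+1)+1) := by ring
    rw [e, ris_add, ris_succ (σ+l), show σ + ((l+1:ℕ):ℝ) - 1 = σ + l by push_cast; ring,
      Nat.add_sub_cancel, ris_succ σ l, Nat.factorial_succ]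
    have q3 : ((l).factorial:ℝ) ≠ 0 := by positivity
    have q4 : (l:ℝ)+1 ≠ 0 := by positivity
    push_cast
    field_simp

lemma double_sum_antidiag (n : ℕ) (F : ℕ → ℕ → ℝ) (hF : ∀ m k, n < m + k → F m k = 0) :
    ∑ m ∈ Finset.range (n+1), ∑ k ∈ Finset.range (n+1), F m k =
      ∑ N ∈ Finset.range (n+1), ∑ x ∈ Finset.HasAntidiagonal.antidiagonal N, F x.1 x.2 := by
  rw [← Finset.sum_product' (f := F)]
  have h1 : ∑ x ∈ Finset.range (n+1) ×ˢ Finset.range (n+1), F x.1 x.2 =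
      ∑ x ∈ (Finset.range (n+1) ×ˢ Finset.range (n+1)).filter (fun x => x.1 + x.2 ∈ Finset.range (n+1)),
        F x.1 x.2 := by
    symm
    apply Finset.sum_filter_of_ne
    intro x _ hx
    by_contra h
    apply hx; apply hF
    simpa using h
  rw [h1, ← Finset.sum_fiberwise_of_maps_to (g := fun x : ℕ × ℕ => x.1 + x.2) (t := Finset.range (n+1))]
  · apply Finset.sum_congr rfl
    intro N hN
    apply Finset.sum_congr _ (fun _ _ => rfl)
    ext x
    simp at hN ⊢
    omega
  · intro x hx
    simpa using (Finset.mem_filter.1 hx).2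

lemma kerA {α β : ℝ} (hα : -1 < α) (hβ : -1 < β) {c : ℕ → ℝ} (hc : JacobiNormalized α β c) (n : ℕ)
    (u v : ℝ) :
    c n ^ 2 * ((jP α β n).eval u * (jP α β n).eval v) =
      ∑ N ∈ Finset.range (n+1), (-1)^(n-N) * wco (n-N) (2*N+α+β+2) *
        SN α β N (u*v) ((1-u)*(1-v)) := by
  rw [jP_mul_jP hα hβ]
  unfold jQv
  rw [double_sum_antidiag]
  swap
  · intro m k h; unfold jB; rw [ris_neg_eq_zero h]; simp
  rw [Finset.mul_sum, Finset.mul_sum]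
  apply Finset.sum_congr rfl
  intro N hN
  have hN' : N ≤ n := by simpa [Nat.lt_succ_iff] using hN
  unfold SN sigN
  rw [Finset.mul_sum, Finset.mul_sum, Finset.mul_sum, Finset.mul_sum]
  apply Finset.sum_congr rfl
  rintro ⟨m, k⟩ hx
  simp only [Finset.HasAntidiagonal.mem_antidiagonal] at hx
  simp only
  unfold jB
  rw [hx]
  rw [gamma_add_nat (show 0 < α + 1 by linarith), gamma_add_nat (show 0 < β + 1 by linarith)]
  have h1 := c_sq hα hβ hc n
  unfold jh at h1
  have pα := (Real.Gamma_pos_of_pos (cast_add_pos hα n)).ne'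
  have pβ := (Real.Gamma_pos_of_pos (cast_add_pos hβ n)).ne'
  have p1 := (ris_pos (show 0 < α + 1 by linarith) m).ne'
  have p2 := (ris_pos (show 0 < β + 1 by linarith) k).ne'
  have p3 := (Real.Gamma_pos_of_pos (show 0 < α + 1 by linarith)).ne'
  have p4 := (Real.Gamma_pos_of_pos (show 0 < β + 1 by linarith)).ne'
  have p5 : (n.factorial:ℝ) ≠ 0 := by positivity
  have p6 : (m.factorial:ℝ) ≠ 0 := by positivity
  have p7 : (k.factorial:ℝ) ≠ 0 := by positivity
  obtain ⟨l, rfl⟩ : ∃ l, n = N + l := ⟨n - N, by omega⟩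
  have hN0 : (0:ℝ) ≤ N := Nat.cast_nonneg N
  have hl0 : (0:ℝ) ≤ l := Nat.cast_nonneg l
  have hσ : 0 < 2*(N:ℝ)+α+β+2 := by linarith
  have h2 := wco_eq hσ l
  have h3 := ris_neg_nat N l
  have h4 : Real.Gamma (2*((N+l:ℕ):ℝ)+α+β+2) = ris (2*(N:ℝ)+α+β+2) (2*l) * Real.Gamma (2*(N:ℝ)+α+β+2) := by
    rw [← gamma_add_nat hσ]; congr 1; push_cast; ring
  have h5 : ris (((N+l:ℕ):ℝ)+α+β+1) (N+l) = ris (((N+l:ℕ):ℝ)+α+β+1) N * ris (2*(N:ℝ)+α+β+2+l-1) l := by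
    rw [ris_add]; congr 2; push_cast; ring
  have p8 : Real.Gamma (2*((N+l:ℕ):ℝ)+α+β+2) ≠ 0 := by
    apply (Real.Gamma_pos_of_pos _).ne'; push_cast; linarith
  have hE : N + l - N = l := by omega
  rw [hE]
  rw [div_eq_mul_inv] at h1
  have hs : ((-1:ℝ)^l) * (-1)^l = 1 := by rw [← mul_pow]; simp
  have hsN : ((-1:ℝ)^N) * (-1)^N = 1 := by rw [← mul_pow]; simp
  rw [h4] at h1 p8
  rw [h2] at h1 p8
  rw [h5] at h1
  rw [pow_add]
  generalize Real.Gamma (((N+l:ℕ):ℝ)+α+1) = G1 at *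
  generalize Real.Gamma (((N+l:ℕ):ℝ)+β+1) = G2 at *
  generalize Real.Gamma (2*(N:ℝ)+α+β+2) = G3 at *
  generalize Real.Gamma (α+1) = G4 at *
  generalize Real.Gamma (β+1) = G5 at *
  generalize ris (((N+l:ℕ):ℝ)+α+β+1) N = R1 at *
  generalize ris (2*(N:ℝ)+α+β+2+l-1) l = R2 at *
  generalize ris (-((N+l:ℕ):ℝ)) N = R3 at *
  generalize wco l (2*(N:ℝ)+α+β+2) = w at *
  generalize ris (α+1) m = R4 at *
  generalize ris (β+1) k = R5 at *
  generalize (((N+l).factorial:ℕ):ℝ) = F at *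
  have p9 : (l.factorial:ℝ) ≠ 0 := by positivity
  generalize (l.factorial:ℝ) = Fl at *
  generalize (m.factorial:ℝ) = Fm at *
  generalize (k.factorial:ℝ) = Fk at *
  have hw : w ≠ 0 := by intro h; simp [h] at p8
  have hR2 : R2 ≠ 0 := by intro h; simp [h] at p8
  have hG3 : G3 ≠ 0 := by intro h; simp [h] at p8
  generalize c (N+l) = cc at *
  generalize ((1-u)*(1-v))^k = Y at *
  generalize (u*v)^m = Z at *
  generalize (-1:ℝ)^N = eN at *
  generalize (-1:ℝ)^l = el at *
  field_simp at h1 ⊢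
  have h6 : R3 * Fl = eN * F := h3
  apply mul_left_cancel₀ p9
  linear_combination (Z * Y * cc^2 * eN * el * G1 * G2 * R1) * h6 + (Z * Y * el * F) * h1 +
    (Z * Y * cc^2*el*G1*G2*R1*F)*hsN

/-! ## Part 4 : cosine expansions and growth -/
section Growth
open Polynomial

lemma cos_span (f : ℝ[X]) (d : ℕ) (hd : f.natDegree ≤ d) :
    (fun θ : ℝ => f.eval (Real.cos θ)) ∈
      Submodule.span ℝ (Set.range (fun k : Fin (d+1) => fun θ : ℝ => Real.cos ((k:ℕ) * θ))) := by
  induction d generalizing f with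
  | zero =>
    rw [eq_C_of_natDegree_le_zero hd]
    simp only [eval_C]
    have : (fun _ : ℝ => f.coeff 0) = f.coeff 0 • (fun θ : ℝ => Real.cos (((0 : Fin 1):ℕ) * θ)) := by
      ext θ; simp
    rw [this]
    exact Submodule.smul_mem _ _ (Submodule.subset_span ⟨0, rfl⟩)
  | succ d ih =>
    have hmem : ∀ k : ℕ, k ≤ d + 1 → (fun θ : ℝ => Real.cos ((k:ℕ) * θ)) ∈
      Submodule.span ℝ (Set.range (fun k : Fin (d+1+1) => fun θ : ℝ => Real.cos ((k:ℕ) * θ))) :=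
      fun k hk => Submodule.subset_span ⟨⟨k, by omega⟩, rfl⟩
    have h1 := ih f.divX (by rw [natDegree_divX_eq_natDegree_tsub_one]; omega)
    have hf : (fun θ : ℝ => f.eval (Real.cos θ)) =
        (LinearMap.mulLeft ℝ (fun θ : ℝ => Real.cos θ)) (fun θ : ℝ => f.divX.eval (Real.cos θ)) +
          f.coeff 0 • (fun θ : ℝ => Real.cos ((0:ℕ) * θ)) := by
      ext θ
      have := congrArg (eval (Real.cos θ)) (divX_mul_X_add f)
      simp at this ⊢
      linarith
    rw [hf]
    refine Submodule.add_mem _ ?_ (Submodule.smul_mem _ _ (hmem 0 (by omega)))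
    have hle : Submodule.span ℝ (Set.range (fun k : Fin (d+1) => fun θ : ℝ => Real.cos ((k:ℕ) * θ))) ≤
      (Submodule.span ℝ (Set.range (fun k : Fin (d+1+1) => fun θ : ℝ => Real.cos ((k:ℕ) * θ)))).comap
        (LinearMap.mulLeft ℝ (fun θ : ℝ => Real.cos θ)) := by
      rw [Submodule.span_le]
      rintro _ ⟨⟨k, hk⟩, rfl⟩
      simp only [Submodule.comap_coe, Set.mem_preimage, SetLike.mem_coe]
      rcases k with _ | k
      · have e : (LinearMap.mulLeft ℝ (fun θ : ℝ => Real.cos θ)) (fun θ : ℝ => Real.cos ((0:ℕ) * θ)) =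
            fun θ : ℝ => Real.cos ((1:ℕ) * θ) := by ext θ; simp
        rw [e]; exact hmem 1 (by omega)
      · have e : (LinearMap.mulLeft ℝ (fun θ : ℝ => Real.cos θ)) (fun θ : ℝ => Real.cos ((k+1:ℕ) * θ)) =
            (1/2:ℝ) • ((fun θ : ℝ => Real.cos ((k+2:ℕ) * θ)) + fun θ : ℝ => Real.cos ((k:ℕ) * θ)) := by
          ext θ
          simp only [LinearMap.mulLeft_apply, Pi.mul_apply, Pi.smul_apply, Pi.add_apply, smul_eq_mul]
          have e1 : ((k+2:ℕ):ℝ) * θ = ((k+1:ℕ):ℝ) * θ + θ := by push_cast; ring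
          have e2 : ((k:ℕ):ℝ) * θ = ((k+1:ℕ):ℝ) * θ - θ := by push_cast; ring
          rw [e1, e2, Real.cos_add, Real.cos_sub]; ring
        rw [e]
        exact Submodule.smul_mem _ _ (Submodule.add_mem _ (hmem _ (by omega)) (hmem _ (by omega)))
    exact hle h1

lemma cos_orth (k m : ℕ) : ∫ θ in (0:ℝ)..π, Real.cos (k*θ) * Real.cos (m*θ) =
    if k = m then (if k = 0 then π else π/2) else 0 := by
  have h : ∫ θ in (0:ℝ)..π, Real.cos (k*θ) * Real.cos (m*θ) =
      ∫ x, (Chebyshev.T ℝ k).eval x * (Chebyshev.T ℝ m).eval x ∂Chebyshev.measureT := by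
    rw [Chebyshev.integral_measureT_eq_integral_cos]
    simp [Chebyshev.T_real_cos]
  rw [h]
  split_ifs with h1 h2
  · subst h1; subst h2; exact Chebyshev.integral_eval_T_real_mul_self_measureT_zero
  · subst h1; exact Chebyshev.integral_T_real_mul_self_measureT_of_ne_zero h2
  · exact Chebyshev.integral_eval_T_real_mul_eval_T_real_measureT_of_ne h1

lemma cos_expand (f : ℝ[X]) (d : ℕ) (hd : f.natDegree ≤ d) :
    ∃ a : ℕ → ℝ, (∀ θ, f.eval (Real.cos θ) = ∑ k ∈ Finset.range (d+1), a k * Real.cos (k*θ)) ∧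
      ∀ k ∈ Finset.range (d+1), |a k| ≤ ∫ θ in (0:ℝ)..π, |f.eval (Real.cos θ)| := by
  obtain ⟨b, hb⟩ := (Submodule.mem_span_range_iff_exists_fun ℝ).1 (cos_span f d hd)
  have hb' : ∀ θ, f.eval (Real.cos θ) =
      ∑ k ∈ Finset.range (d+1), (if h : k < d+1 then b ⟨k,h⟩ else 0) * Real.cos (k*θ) := by
    intro θ
    have := congrFun hb θ
    rw [← this, Finset.sum_range]
    simp only [Finset.sum_apply, Pi.smul_apply, smul_eq_mul]
    apply Finset.sum_congr rfl
    intro x _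
    rw [dif_pos x.2]
  obtain ⟨a, hb'⟩ : ∃ a : ℕ → ℝ, ∀ θ, f.eval (Real.cos θ) =
      ∑ k ∈ Finset.range (d+1), a k * Real.cos (k*θ) := ⟨_, hb'⟩
  refine ⟨a, hb', ?_⟩
  intro k hk
  have h1 : ∫ θ in (0:ℝ)..π, f.eval (Real.cos θ) * Real.cos (k*θ) = a k * (if k = 0 then π else π/2) := by
    simp_rw [hb', Finset.sum_mul]
    rw [intervalIntegral.integral_finsetSum]
    · simp_rw [mul_assoc, intervalIntegral.integral_const_mul, cos_orth]
      rw [Finset.sum_eq_single k]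
      · simp
      · intro m _ hm; simp [hm]
      · intro h; exact absurd hk h
    · intro m _
      apply Continuous.intervalIntegrable
      fun_prop
  have h2 : |∫ θ in (0:ℝ)..π, f.eval (Real.cos θ) * Real.cos (k*θ)| ≤ ∫ θ in (0:ℝ)..π, |f.eval (Real.cos θ)| := by
    refine (intervalIntegral.abs_integral_le_integral_abs Real.pi_pos.le).trans ?_
    apply intervalIntegral.integral_mono_on Real.pi_pos.le
    · apply Continuous.intervalIntegrable; fun_prop
    · apply Continuous.intervalIntegrable; fun_prop
    · intro θ _
      rw [abs_mul]
      exact mul_le_of_le_one_right (abs_nonneg _) (Real.abs_cos_le_one _)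
  refine le_trans ?_ h2
  rw [h1, abs_mul]
  apply le_mul_of_one_le_right (abs_nonneg _)
  have := Real.pi_gt_three
  rw [abs_of_nonneg (by split_ifs <;> positivity)]
  split_ifs <;> linarith

lemma jac_bernstein (f : ℝ[X]) (d : ℕ) (hd : f.natDegree ≤ d) (M : ℝ) (hM : ∀ θ ∈ Ioo 0 π, |f.eval (Real.cos θ)| ≤ M)
    (j : ℕ) (θ : ℝ) :
    |iteratedDeriv j (fun θ => f.eval (Real.cos θ)) θ| ≤ (d+1) * (M * π) * d^j := by
  obtain ⟨a, h1, h2⟩ := cos_expand f d hd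
  have h3 : ∫ θ in (0:ℝ)..π, |f.eval (Real.cos θ)| ≤ M * π := by
    have : ∫ θ in (0:ℝ)..π, |f.eval (Real.cos θ)| ≤ ∫ θ in (0:ℝ)..π, M := by
      apply intervalIntegral.integral_mono_on_of_le_Ioo Real.pi_pos.le
      · apply Continuous.intervalIntegrable; fun_prop
      · apply Continuous.intervalIntegrable; fun_prop
      · exact hM
    simpa [mul_comm] using this
  have e : (fun θ => f.eval (Real.cos θ)) = fun θ => ∑ k ∈ Finset.range (d+1), a k * Real.cos (k*θ) := by
    ext θ; exact h1 θ
  rw [e, iteratedDeriv_fun_sum]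
  · refine (Finset.abs_sum_le_sum_abs _ _).trans ?_
    have : ∀ k ∈ Finset.range (d+1), |iteratedDeriv j (fun θ => a k * Real.cos (k*θ)) θ| ≤ (M * π) * d^j := by
      intro k hk
      have hk' : k ≤ d := by simpa [Nat.lt_succ_iff] using hk
      rw [iteratedDeriv_const_mul_field, iteratedDeriv_comp_const_mul Real.contDiff_cos]
      rw [abs_mul, abs_mul]
      have h4 : |iteratedDeriv j Real.cos (k*θ)| ≤ 1 := Real.abs_iteratedDeriv_cos_le_one _ _
      have h5 : |(k:ℝ)^j| ≤ d^j := by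
        rw [abs_of_nonneg (by positivity)]
        gcongr
      have h6 := (h2 k hk).trans h3
      have h7 : 0 ≤ M * π := (abs_nonneg _).trans h6
      calc _ ≤ (M * π) * (d^j * 1) := by gcongr
        _ = _ := by ring
    refine (Finset.sum_le_sum this).trans ?_
    simp
    apply le_of_eq; ring
  · intro k _
    fun_prop

lemma growth {α β : ℝ} {c : ℕ → ℝ} (hc : JacobiNormalized α β c) {θ : ℝ}
    (hθ : θ ∈ Ioo 0 π) : ∃ C : ℝ, 0 ≤ C ∧ ∀ n, |nJacobi α β c n θ| ≤ C * (n+1) := by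
  obtain ⟨K, hK⟩ : ∃ K : ℕ, |2*α+1| + |2*β+1| ≤ K := exists_nat_ge _
  have hKα : 2*α+1 ≤ 4*K := by
    have := le_abs_self (2*α+1); have := abs_nonneg (2*β+1); have : (0:ℝ) ≤ K := by positivity
    linarith
  have hKβ : 2*β+1 ≤ 4*K := by
    have := le_abs_self (2*β+1); have := abs_nonneg (2*α+1); have : (0:ℝ) ≤ K := by positivity
    linarith
  set C0 : ℝ := (1 + 2^(4*K) * π)/2 with hC0
  have hs : 0 < Real.sin θ := Real.sin_pos_of_pos_of_lt_pi hθ.1 hθ.2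
  refine ⟨(2*K+1) * C0 / Real.sin θ ^(2*K), by positivity, fun n => ?_⟩
  set f : ℝ[X] := C (c n) * (jP α β n).comp (C (1/2) * (1 - X)) * (1 - X^2)^K with hf
  have hfe : ∀ θ, f.eval (Real.cos θ) = nJacobi α β c n θ * Real.sin θ ^ (2*K) := by
    intro θ
    rw [hf, nJacobi, jacobiPoly_eq]
    simp only [eval_mul, eval_C, eval_comp, eval_pow, eval_sub, eval_one, eval_X]
    rw [pow_mul, Real.sin_sq]
    rw [show (1/2:ℝ) * (1 - Real.cos θ) = (1 - Real.cos θ)/2 by ring]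
  have hdeg : f.natDegree ≤ n + 2*K := by
    rw [hf]
    refine natDegree_mul_le.trans (add_le_add ?_ ?_)
    · refine (natDegree_C_mul_le _ _).trans (natDegree_comp_le.trans ?_)
      have h1 : (C (1/2) * (1 - X) : ℝ[X]).natDegree ≤ 1 := by
        refine (natDegree_C_mul_le _ _).trans ((natDegree_sub_le _ _).trans ?_)
        simp
      nlinarith [jP_natDegree_le α β n]
    · refine natDegree_pow_le.trans ?_
      have : (1 - X^2 : ℝ[X]).natDegree ≤ 2 := by
        refine (natDegree_sub_le _ _).trans ?_
        simp
      nlinarith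
  obtain ⟨a, h1, h2⟩ := cos_expand f _ hdeg
  have hintg : ∫ θ in (0:ℝ)..π, |f.eval (Real.cos θ)| ≤ C0 := by
    have hn := hc.2 n
    unfold jacobiMeasure at hn
    rw [integral_withDensity_eq_integral_toReal_smul (by fun_prop) (by simp)] at hn
    have hI : Integrable (fun θ => (ENNReal.ofReal ((Real.sin (θ/2)) ^ (2*α+1) * (Real.cos (θ/2)) ^ (2*β+1))).toReal •
      (nJacobi α β c n θ)^2) (volume.restrict (Ioo 0 π)) := by
      by_contra h
      rw [integral_undef h] at hn
      norm_num at hn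
    rw [intervalIntegral.integral_of_le Real.pi_pos.le, integral_Ioc_eq_integral_Ioo]
    have hle : ∫ θ in Ioo 0 π, |f.eval (Real.cos θ)| ≤ ∫ θ in Ioo 0 π,
        (((ENNReal.ofReal ((Real.sin (θ/2)) ^ (2*α+1) * (Real.cos (θ/2)) ^ (2*β+1))).toReal •
      (nJacobi α β c n θ)^2) + 2^(4*K))/2 := by
      apply setIntegral_mono_on
      · apply Continuous.integrableOn_Ioc (a := 0) (b := π) _ |>.mono_set Ioo_subset_Ioc_self
        fun_prop
      · exact (hI.add (integrable_const _)).div_const 2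
      · exact measurableSet_Ioo
      · intro θ ⟨h1, h2⟩
        have hs : 0 < Real.sin (θ/2) := Real.sin_pos_of_pos_of_lt_pi (by linarith) (by linarith)
        have hcc : 0 < Real.cos (θ/2) := Real.cos_pos_of_mem_Ioo ⟨by linarith, by linarith⟩
        have e3 : Real.sin θ = 2 * Real.sin (θ/2) * Real.cos (θ/2) := by
          rw [← Real.sin_two_mul]; congr 1; ring
        rw [hfe, ENNReal.toReal_ofReal (by positivity), smul_eq_mul, e3, abs_mul, abs_of_nonneg (a := _ ^ _) (by positivity)]
        generalize nJacobi α β c n θ = x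
        have w1 : (Real.sin (θ/2))^(4*K) ≤ (Real.sin (θ/2)) ^ (2*α+1) := by
          rw [← Real.rpow_natCast]
          apply Real.rpow_le_rpow_of_exponent_ge hs (Real.sin_le_one _)
          push_cast; exact hKα
        have w2 : (Real.cos (θ/2))^(4*K) ≤ (Real.cos (θ/2)) ^ (2*β+1) := by
          rw [← Real.rpow_natCast]
          apply Real.rpow_le_rpow_of_exponent_ge hcc (Real.cos_le_one _)
          push_cast; exact hKβ
        have w3 : (Real.sin (θ/2))^(4*K) * (Real.cos (θ/2))^(4*K) ≤ (Real.sin (θ/2)) ^ (2*α+1) * (Real.cos (θ/2)) ^ (2*β+1) := by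
          gcongr
        have w4 : ((2:ℝ)^(2*K))^2 = 2^(4*K) := by rw [← pow_mul]; congr 1; ring
        have w5 : ∀ y : ℝ, (y^(2*K))^2 = y^(4*K) := by intro y; rw [← pow_mul]; congr 1; ring
        rw [mul_pow, mul_pow]
        have w6 := mul_le_mul_of_nonneg_right w3 (sq_nonneg x)
        rw [← w5, ← w5, ← sq_abs x] at w6
        rw [← w4, ← sq_abs x]
        nlinarith [sq_nonneg (|x| * (Real.sin (θ/2)^(2*K) * Real.cos (θ/2)^(2*K)) - 2^(2*K))]
    refine hle.trans (le_of_eq ?_)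
    rw [integral_div, integral_add hI (integrable_const _), hn, hC0]
    simp [Real.pi_pos.le]
    ring
  have h3 : |nJacobi α β c n θ| * Real.sin θ ^(2*K) ≤ (n + 2*K+1) * C0 := by
    rw [← abs_of_nonneg (a := Real.sin θ ^(2*K)) (by positivity), ← abs_mul, ← hfe, h1]
    refine (Finset.abs_sum_le_sum_abs _ _).trans ?_
    have : ∀ k ∈ Finset.range (n + 2*K+1), |a k * Real.cos (k*θ)| ≤ C0 := by
      intro k hk
      rw [abs_mul]
      exact (mul_le_of_le_one_right (abs_nonneg _) (Real.abs_cos_le_one _)).trans ((h2 k hk).trans hintg)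
    refine (Finset.sum_le_sum this).trans ?_
    simp
  have hC0' : 0 ≤ C0 := by positivity
  rw [div_mul_eq_mul_div, le_div_iff₀ (by positivity)]
  refine h3.trans ?_
  have : (0:ℝ) ≤ n := by positivity
  have : (0:ℝ) ≤ K := by positivity
  calc (n + 2*K+1 : ℝ) * C0 ≤ ((2*K+1) * (n+1)) * C0 := by
        apply mul_le_mul_of_nonneg_right _ hC0'
        nlinarith
    _ = _ := by ring

end Growth

lemma ris_lower {x : ℝ} (hx : 0 < x) (m : ℕ) : min x 1 ≤ ris x m := by
  have key : ∀ m : ℕ, min x 1 ≤ ris x m ∧ (1 ≤ m → x ≤ ris x m) := by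
    intro m
    induction m with
    | zero => simp [ris_zero]
    | succ k ih =>
      have : x ≤ ris x (k+1) := by
        rw [ris_succ]
        rcases Nat.eq_zero_or_pos k with h | h
        · subst h; simp [ris_zero]
        · have h1 := ih.2 h
          have h2 : (1:ℝ) ≤ k := by exact_mod_cast h
          nlinarith
      exact ⟨le_trans (min_le_left _ _) this, fun _ => this⟩
  exact (key m).1

lemma inv_gamma_bound {α : ℝ} (hα : -1 < α) :
    ∃ K : ℝ, 0 < K ∧ ∀ m : ℕ, 1 / Gamma (α+1+m) ≤ K := by
  have h0 : 0 < α + 1 := by linarith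
  have hg : 0 < Gamma (α+1) := Gamma_pos_of_pos h0
  have hm : 0 < min (α+1) 1 := lt_min h0 one_pos
  refine ⟨1 / (min (α+1) 1 * Gamma (α+1)), by positivity, fun m => ?_⟩
  rw [gamma_add_nat h0]
  apply one_div_le_one_div_of_le (by positivity)
  exact mul_le_mul_of_nonneg_right (ris_lower h0 m) hg.le

def iotaC (α : ℝ) (z : ℂ) : ℂ :=
  ∑' m : ℕ, z^m / ((m.factorial : ℂ) * ((Gamma (α+1+m) : ℝ) : ℂ))

lemma iotaC_term_bound {α : ℝ} (hα : -1 < α) {K : ℝ} (hK : ∀ m : ℕ, 1 / Gamma (α+1+m) ≤ K)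
    (z : ℂ) (m : ℕ) :
    ‖z^m / ((m.factorial : ℂ) * ((Gamma (α+1+m) : ℝ) : ℂ))‖ ≤ K * (‖z‖^m / m.factorial) := by
  have hg : 0 < Gamma (α+1+m) := Gamma_pos_of_pos (by
    have : (0:ℝ) ≤ m := Nat.cast_nonneg m
    linarith)
  rw [norm_div, norm_mul, norm_pow, Complex.norm_natCast, Complex.norm_real, Real.norm_of_nonneg hg.le]
  calc ‖z‖^m / (m.factorial * Gamma (α+1+m)) = (1 / Gamma (α+1+m)) * (‖z‖^m / m.factorial) := by
        field_simp
    _ ≤ _ := mul_le_mul_of_nonneg_right (hK m) (by positivity)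

lemma iotaC_summable {α : ℝ} (hα : -1 < α) (z : ℂ) :
    Summable (fun m : ℕ => z^m / ((m.factorial : ℂ) * ((Gamma (α+1+m) : ℝ) : ℂ))) := by
  obtain ⟨K, _, hK⟩ := inv_gamma_bound hα
  exact Summable.of_norm_bounded ((Real.summable_pow_div_factorial ‖z‖).mul_left K)
    (fun m => iotaC_term_bound hα hK z m)

lemma iotaC_differentiable {α : ℝ} (hα : -1 < α) : Differentiable ℂ (iotaC α) := by
  obtain ⟨K, hK0, hK⟩ := inv_gamma_bound hα
  intro z
  have : DifferentiableOn ℂ (iotaC α) (Metric.ball 0 (‖z‖+1)) := by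
    apply Complex.differentiableOn_tsum_of_summable_norm
      ((Real.summable_pow_div_factorial (‖z‖+1)).mul_left K) ?_ Metric.isOpen_ball ?_
    · intro m; fun_prop
    · intro m w hw
      refine (iotaC_term_bound hα hK w m).trans ?_
      have : ‖w‖ ≤ ‖z‖+1 := by
        rw [mem_ball_zero_iff] at hw; exact hw.le
      gcongr
  exact this.differentiableAt (Metric.isOpen_ball.mem_nhds (by simp))

/-- recurrence -/
lemma iotaC_rec {α : ℝ} (hα : -1 < α) (z : ℂ) :
    iotaC α z = (α+1) * iotaC (α+1) z + z * iotaC (α+2) z := by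
  have s0 := iotaC_summable hα z
  have s1 := iotaC_summable (α := α+1) (by linarith) z
  have s2 := iotaC_summable (α := α+2) (by linarith) z
  have e0 : ∀ (γ : ℝ) (hγ : -1 < γ), iotaC γ z = z^0/ (((0:ℕ).factorial : ℂ) * ((Gamma (γ+1+(0:ℕ)) : ℝ) : ℂ))
     + ∑' m : ℕ, z^(m+1) / (((m+1).factorial : ℂ) * ((Gamma (γ+1+(m+1:ℕ)) : ℝ) : ℂ)) := by
    intro γ hγ
    exact (iotaC_summable hγ z).tsum_eq_zero_add
  rw [e0 α hα, e0 (α+1) (by linarith)]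
  rw [iotaC, mul_add, add_assoc (((α:ℂ)+1) * _), ← tsum_mul_left, ← tsum_mul_left, ← Summable.tsum_add]
  · congr 1
    · have : Gamma (α+1+1+(0:ℕ)) = (α+1) * Gamma (α+1+(0:ℕ)) := by
        simp only [Nat.cast_zero, add_zero]
        exact Gamma_add_one (by linarith)
      rw [this]
      have h1 : Gamma (α+1+(0:ℕ)) ≠ 0 := by
        simp only [Nat.cast_zero, add_zero]
        exact (Gamma_pos_of_pos (by linarith)).ne'
      have h1c : ((Gamma (α+1+(0:ℕ)) : ℝ) : ℂ) ≠ 0 := by exact_mod_cast h1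
      have h2 : ((α:ℂ)+1) ≠ 0 := by
        have : α + 1 ≠ 0 := by linarith
        exact_mod_cast this
      push_cast
      push_cast at h1c
      field_simp
    · apply tsum_congr
      intro m
      have hm : (0:ℝ) ≤ m := Nat.cast_nonneg m
      set G := Gamma (α+1+(m+1:ℕ)) with hG
      have hGp : 0 < G := Gamma_pos_of_pos (by push_cast; linarith)
      have g1 : Gamma (α+1+1+(m+1:ℕ)) = (α+1+(m+1:ℕ)) * G := by
        rw [hG, ← Gamma_add_one (by push_cast; linarith)]
        congr 1; ring
      have g2 : Gamma (α+2+1+(m:ℕ)) = (α+1+(m+1:ℕ)) * G := by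
        rw [← g1]; congr 1; push_cast; ring
      rw [g1, g2]
      have hGc : (G:ℂ) ≠ 0 := by exact_mod_cast hGp.ne'
      have h2 : ((α:ℂ)+1+(m+1)) ≠ 0 := by
        have : α + 1 + (m+1) ≠ 0 := by linarith
        exact_mod_cast this
      have h3 : (m.factorial : ℂ) ≠ 0 := by exact_mod_cast m.factorial_ne_zero
      have h4 : ((m:ℂ)+1) ≠ 0 := by exact_mod_cast Nat.succ_ne_zero m
      rw [Nat.factorial_succ]
      push_cast
      field_simp
      ring
  · exact ((summable_nat_add_iff 1).2 s1).mul_left _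
  · exact s2.mul_left _

def fC (α : ℝ) (z : ℂ) : ℂ := Complex.exp (-2*z) * iotaC α (z^2)

lemma fC_differentiable {α : ℝ} (hα : -1 < α) : Differentiable ℂ (fC α) := by
  have h := iotaC_differentiable hα
  have h2 : Differentiable ℂ (fun z : ℂ => iotaC α (z^2)) := h.comp (by fun_prop)
  unfold fC
  exact Differentiable.mul (by fun_prop) h2

/-- the weight -/
def wt (ν : ℝ) (w : ℝ) : ℝ := (w*(1-w))^ν

lemma wt_cont {ν : ℝ} (hν : 0 ≤ ν) : Continuous (wt ν) := by
  unfold wt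
  exact Continuous.rpow_const (by fun_prop) (fun x => Or.inr hν)

lemma wt_nonneg (ν : ℝ) {w : ℝ} (hw : w ∈ Icc (0:ℝ) 1) : 0 ≤ wt ν w :=
  rpow_nonneg (mul_nonneg hw.1 (by linarith [hw.2])) _

lemma wt_le {ν : ℝ} (hν : 0 ≤ ν) {w : ℝ} (hw : w ∈ Icc (0:ℝ) 1) : wt ν w ≤ w^ν := by
  unfold wt
  apply rpow_le_rpow (mul_nonneg hw.1 (by linarith [hw.2])) _ hν
  nlinarith [hw.1, hw.2]

def mom (ν : ℝ) (n : ℕ) : ℝ := ∫ w in (0:ℝ)..1, (1-2*w)^n * wt ν w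

lemma mom_rec {ν : ℝ} (hν : 0 ≤ ν) (n : ℕ) :
    mom ν (n+2) * (ν + 1 + (n+1)/2) = (n+1)/2 * mom ν n := by
  have hc := wt_cont hν
  have hd : ∀ w ∈ uIcc (0:ℝ) 1, HasDerivAt (fun w : ℝ => (1-2*w)^(n+1) * (w*(1-w))^(ν+1))
      ((ν + 1 + (n+1)/2) * ((1-2*w)^(n+2) * wt ν w) - (n+1)/2 * ((1-2*w)^n * wt ν w)) w := by
    intro w hw
    rw [uIcc_of_le zero_le_one] at hw
    have hw0 : 0 ≤ w*(1-w) := mul_nonneg hw.1 (by linarith [hw.2])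
    have h1 : HasDerivAt (fun w : ℝ => (1-2*w)) (-2) w := by
      simpa using ((hasDerivAt_id w).const_mul 2).const_sub 1
    have h2 : HasDerivAt (fun w : ℝ => w*(1-w)) (1-2*w) w := by
      have := (hasDerivAt_id w).mul ((hasDerivAt_id w).const_sub 1)
      refine this.congr_deriv ?_
      simp only [id]; ring
    have h3 := h2.rpow_const (p := ν+1) (Or.inr (by linarith))
    have h4 := (h1.fun_pow (n+1)).mul h3
    refine h4.congr_deriv ?_
    have e1 : (w*(1-w))^(ν+1) = (w*(1-w))^ν * (w*(1-w)) := Real.rpow_add_one' hw0 (by linarith)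
    rw [e1]
    simp only [wt, add_sub_cancel_right, Nat.add_sub_cancel]
    push_cast
    ring
  have h := intervalIntegral.integral_eq_sub_of_hasDerivAt hd (by
    apply Continuous.intervalIntegrable; fun_prop)
  rw [intervalIntegral.integral_sub (by apply Continuous.intervalIntegrable; fun_prop)
    (by apply Continuous.intervalIntegrable; fun_prop),
    intervalIntegral.integral_const_mul, intervalIntegral.integral_const_mul] at h
  have hz : (0:ℝ)^(ν+1) = 0 := zero_rpow (by linarith)
  simp only [sub_self, mul_zero, zero_mul, hz] at h
  unfold mom
  linarith

lemma mom_one (ν : ℝ) (hν : 0 ≤ ν) : mom ν 1 = 0 := by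
  have h : mom ν 1 = - mom ν 1 := by
    have h0 := intervalIntegral.integral_comp_sub_left (a := 0) (b := 1)
      (fun w => (1-2*w)^1 * wt ν w) 1
    simp only [sub_self, sub_zero] at h0
    unfold mom
    rw [← intervalIntegral.integral_neg, ← h0]
    congr 1; ext w
    unfold wt
    rw [show (1-w)*(1-(1-w)) = w*(1-w) by ring]
    ring
  linarith

lemma mom_odd (ν : ℝ) (hν : 0 ≤ ν) (m : ℕ) : mom ν (2*m+1) = 0 := by
  induction m with
  | zero => exact mom_one ν hν
  | succ k ih =>
    have h := mom_rec hν (2*k+1)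
    rw [ih, mul_zero] at h
    have : (0:ℝ) < ν + 1 + ((2*k+1:ℕ)+1)/2 := by positivity
    rcases mul_eq_zero.1 h with h | h
    · rw [show 2*(k+1)+1 = 2*k+1+2 by ring]; exact h
    · exact absurd h this.ne'

lemma mom_even {α : ℝ} (hα : 1/2 ≤ α) (m : ℕ) :
    mom (α-1/2) (2*m) * (4^m * m.factorial * ris (α+1) m) = mom (α-1/2) 0 * (2*m).factorial := by
  induction m with
  | zero => simp [ris_zero]
  | succ k ih =>
    have h := mom_rec (ν := α-1/2) (by linarith) (2*k)
    rw [show 2*(k+1) = 2*k+2 by ring, ris_succ, Nat.factorial_succ, Nat.factorial_succ,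
      Nat.factorial_succ (2*k)]
    push_cast at h ⊢
    linear_combination (2*(k+1:ℝ)*(2*k+1)) * ih + 4*(k+1)*(4^k * k.factorial * ris (α+1) k) * h

lemma mom_zero_pos {ν : ℝ} (hν : 0 ≤ ν) : 0 < mom ν 0 := by
  unfold mom
  apply intervalIntegral.intervalIntegral_pos_of_pos_on
  · apply Continuous.intervalIntegrable
    have := wt_cont hν; fun_prop
  · intro x hx
    simp only [pow_zero, one_mul]
    exact rpow_pos_of_pos (mul_pos hx.1 (by linarith [hx.2])) _
  · exact one_pos

lemma exp_int {α : ℝ} (hα : 1/2 ≤ α) (z : ℂ) :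
    ∫ w in (0:ℝ)..1, Complex.exp (2*z*((1-2*w:ℝ):ℂ)) * ((wt (α-1/2) w : ℝ) : ℂ)
      = ((mom (α-1/2) 0 * Gamma (α+1) : ℝ):ℂ) * iotaC α (z^2) := by
  set ν := α - 1/2 with hν
  have hν0 : 0 ≤ ν := by rw [hν]; linarith
  have hc := wt_cont hν0
  have hsum : HasSum (fun n : ℕ => ∫ w in (0:ℝ)..1, ((2*z)^n / n.factorial) * (((1-2*w)^n * wt ν w : ℝ):ℂ))
      (∫ w in (0:ℝ)..1, Complex.exp (2*z*((1-2*w:ℝ):ℂ)) * ((wt ν w : ℝ) : ℂ)) := by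
    apply intervalIntegral.hasSum_integral_of_dominated_convergence
      (fun n w => ‖2*z‖^n / n.factorial)
    · intro n
      apply Continuous.aestronglyMeasurable
      fun_prop
    · intro n
      refine Filter.Eventually.of_forall fun w hw => ?_
      rw [uIoc_of_le zero_le_one] at hw
      have hw' : w ∈ Icc (0:ℝ) 1 := ⟨hw.1.le, hw.2⟩
      rw [norm_mul, norm_div, norm_pow, Complex.norm_natCast, Complex.norm_real]
      have : ‖(1-2*w)^n * wt ν w‖ ≤ 1 := by
        rw [norm_mul, norm_pow, Real.norm_eq_abs, Real.norm_eq_abs, abs_of_nonneg (wt_nonneg ν hw')]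
        have h1 : |1-2*w|^n ≤ 1 := pow_le_one₀ (abs_nonneg _) (abs_le.2 ⟨by linarith [hw.2], by linarith [hw.1]⟩)
        have h2 : wt ν w ≤ 1 := (wt_le hν0 hw').trans (rpow_le_one hw'.1 hw'.2 hν0)
        exact mul_le_one₀ h1 (wt_nonneg ν hw') h2
      exact mul_le_of_le_one_right (by positivity) this
    · exact Filter.Eventually.of_forall fun w hw => Real.summable_pow_div_factorial _
    · exact intervalIntegrable_const
    · refine Filter.Eventually.of_forall fun w hw => ?_
      have h := NormedSpace.expSeries_div_hasSum_exp (2*z*((1-2*w:ℝ):ℂ))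
      rw [← Complex.exp_eq_exp_ℂ] at h
      refine (h.mul_right ((wt ν w : ℝ) : ℂ)).congr_fun ?_
      intro n
      push_cast
      rw [mul_pow (2*z) (1 - 2*(w:ℂ))]
      ring
  have hterm : ∀ n : ℕ, ∫ w in (0:ℝ)..1, ((2*z)^n / n.factorial) * (((1-2*w)^n * wt ν w : ℝ):ℂ)
      = ((2*z)^n / n.factorial) * ((mom ν n : ℝ) : ℂ) := by
    intro n
    rw [intervalIntegral.integral_const_mul, intervalIntegral.integral_ofReal]
    rfl
  simp only [hterm] at hsum
  have hinj : Function.Injective (fun m : ℕ => 2*m) := fun a b h => by simpa using h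
  rw [← hinj.hasSum_iff] at hsum
  · rw [← hsum.tsum_eq, iotaC, ← tsum_mul_left]
    apply tsum_congr
    intro m
    have h := mom_even hα m
    rw [← hν] at h
    have hr : 0 < ris (α+1) m := ris_pos (by linarith) m
    have hg : 0 < Gamma (α+1) := Gamma_pos_of_pos (by linarith)
    have hm : mom ν (2*m) = mom ν 0 * (2*m).factorial / (4^m * m.factorial * ris (α+1) m) := by
      rw [eq_div_iff (by positivity)]; exact h
    simp only [Function.comp]
    rw [hm, gamma_add_nat (by linarith)]
    have hrc : ((ris (α+1) m : ℝ):ℂ) ≠ 0 := by exact_mod_cast hr.ne'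
    have hgc : ((Gamma (α+1) : ℝ):ℂ) ≠ 0 := by exact_mod_cast hg.ne'
    have hf : ((2*m).factorial : ℂ) ≠ 0 := by exact_mod_cast (Nat.factorial_ne_zero _)
    have hf' : ((m).factorial : ℂ) ≠ 0 := by exact_mod_cast (Nat.factorial_ne_zero _)
    have e4 : (2*z)^(2*m) = 4^m * (z^2)^m := by
      rw [pow_mul, mul_pow, mul_pow]; norm_num
    rw [e4]
    push_cast
    field_simp
  · intro n hn
    rcases Nat.even_or_odd' n with ⟨k, hk | hk⟩
    · exact absurd ⟨k, hk.symm⟩ hn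
    · rw [hk, mom_odd ν hν0]; simp

lemma fC_int {α : ℝ} (hα : 1/2 ≤ α) (z : ℂ) :
    ((mom (α-1/2) 0 * Gamma (α+1) : ℝ):ℂ) * fC α z =
    ∫ w in (0:ℝ)..1, Complex.exp (-4*z*w) * ((wt (α-1/2) w : ℝ) : ℂ) := by
  unfold fC
  rw [mul_left_comm, ← exp_int hα, ← intervalIntegral.integral_const_mul]
  congr 1; ext w
  rw [← mul_assoc, ← Complex.exp_add]
  congr 2
  push_cast; ring

lemma fC_bound_large {α : ℝ} (hα : 1/2 ≤ α) : ∃ C : ℝ, 0 ≤ C ∧ ∀ (x u : ℝ) (z : ℂ), 0 ≤ x → 0 ≤ u →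
    ‖z - x‖ ≤ (x+u)/16 → ‖fC α z‖ ≤ C * exp (u/4) * (1+x)^(-(α+1/2)) := by
  set ν := α - 1/2 with hν
  have hν0 : 0 ≤ ν := by rw [hν]; linarith
  have hK : 0 < mom ν 0 * Gamma (α+1) := mul_pos (mom_zero_pos hν0) (Gamma_pos_of_pos (by linarith))
  refine ⟨(exp 1 * Gamma (α+1/2)) / (mom ν 0 * Gamma (α+1)), ?_, ?_⟩
  · have := Gamma_pos_of_pos (show 0 < α+1/2 by linarith)
    positivity
  intro x u z hx hu hz
  have hintg : IntegrableOn (fun w : ℝ => w^((α+1/2)-1) * exp (-((1+x)*w))) (Ioi 0) := by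
    by_contra hcon
    have := Real.integral_rpow_mul_exp_neg_mul_Ioi (a := α+1/2) (r := 1+x) (by linarith) (by linarith)
    rw [integral_undef hcon] at this
    have h2 : 0 < (1/(1+x))^(α+1/2) * Gamma (α+1/2) :=
      mul_pos (rpow_pos_of_pos (by positivity) _) (Gamma_pos_of_pos (by linarith))
    linarith
  have hre : x - (x+u)/16 ≤ z.re := by
    have h1 : |(z - x).re| ≤ (x+u)/16 := (Complex.abs_re_le_norm _).trans hz
    simp only [Complex.sub_re, Complex.ofReal_re] at h1
    linarith [neg_le_of_abs_le h1]
  have hb : ‖∫ w in (0:ℝ)..1, Complex.exp (-4*z*w) * ((wt ν w : ℝ) : ℂ)‖ ≤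
      ∫ w in (0:ℝ)..1, exp (u/4) * exp 1 * (w^((α+1/2)-1) * exp (-((1+x)*w))) := by
    apply intervalIntegral.norm_integral_le_of_norm_le zero_le_one
    · refine Filter.Eventually.of_forall fun w hw => ?_
      have hw' : w ∈ Icc (0:ℝ) 1 := ⟨hw.1.le, hw.2⟩
      rw [norm_mul, Complex.norm_exp, Complex.norm_real, Real.norm_of_nonneg (wt_nonneg ν hw')]
      have e1 : (-4*z*(w:ℂ)).re = -4*z.re*w := by simp
      rw [e1]
      have e2 : exp (-4*z.re*w) ≤ exp (u/4) * exp 1 * exp (-((1+x)*w)) := by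
        rw [← exp_add, ← exp_add]
        apply exp_le_exp.2
        nlinarith [hw.1, hw.2, mul_nonneg hw.1.le hx, mul_nonneg (sub_nonneg.2 hw.2) hu, mul_le_mul_of_nonneg_left hre hw.1.le]
      have e3 := wt_le hν0 hw'
      have e4 : α+1/2-1 = ν := by rw [hν]; ring
      rw [e4]
      calc _ ≤ (exp (u/4) * exp 1 * exp (-((1+x)*w))) * w^ν :=
            mul_le_mul e2 e3 (wt_nonneg ν hw') (by positivity)
        _ = _ := by ring
    · rw [intervalIntegrable_iff_integrableOn_Ioc_of_le zero_le_one]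
      exact (hintg.mono_set Ioc_subset_Ioi_self).const_mul _
  have hb2 : ∫ w in (0:ℝ)..1, exp (u/4) * exp 1 * (w^((α+1/2)-1) * exp (-((1+x)*w))) ≤
      exp (u/4) * exp 1 * ((1/(1+x))^(α+1/2) * Gamma (α+1/2)) := by
    rw [← Real.integral_rpow_mul_exp_neg_mul_Ioi (a := α+1/2) (r := 1+x) (by linarith) (by linarith),
      intervalIntegral.integral_const_mul, intervalIntegral.integral_of_le zero_le_one]
    apply mul_le_mul_of_nonneg_left _ (by positivity)
    apply setIntegral_mono_set hintg
    · refine (ae_restrict_mem measurableSet_Ioi).mono fun w hw => ?_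
      have : (0:ℝ) ≤ w := (mem_Ioi.1 hw).le
      simp only [Pi.zero_apply]
      positivity
    · exact Ioc_subset_Ioi_self.eventuallyLE
  have hfin := hb.trans hb2
  rw [← fC_int hα, norm_mul, Complex.norm_real, Real.norm_of_nonneg hK.le] at hfin
  rw [one_div, inv_rpow (by linarith), ← rpow_neg (by linarith)] at hfin
  rw [div_mul_eq_mul_div, div_mul_eq_mul_div, le_div_iff₀ hK]
  linarith

lemma fC_rec {α : ℝ} (hα : -1 < α) (z : ℂ) :
    fC α z = (α+1) * fC (α+1) z + z^2 * fC (α+2) z := by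
  unfold fC; rw [iotaC_rec hα]; ring

lemma fC_bound_aux (k : ℕ) : ∀ α : ℝ, -1 < α → 1/2 - k ≤ α → ∃ C : ℝ, ∃ M : ℕ, 0 ≤ C ∧ ∀ (x u : ℝ) (z : ℂ), 0 ≤ x → 0 ≤ u →
    ‖z - x‖ ≤ (x+u)/16 → ‖fC α z‖ ≤ C * exp (u/4) * (1+u)^M * (1+x)^(-(α+1/2)) := by
  induction k with
  | zero =>
    intro α hα hk
    obtain ⟨C, hC, h⟩ := fC_bound_large (α := α) (by simpa using hk)
    exact ⟨C, 0, hC, fun x u z hx hu hz => by simpa using h x u z hx hu hz⟩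
  | succ k ih =>
    intro α hα hk
    push_cast at hk
    obtain ⟨C1, M1, hC1, h1⟩ := ih (α+1) (by linarith) (by linarith)
    obtain ⟨C2, M2, hC2, h2⟩ := ih (α+2) (by linarith) (by linarith)
    refine ⟨(α+1)*C1 + 4*C2, M1+M2+2, by nlinarith, fun x u z hx hu hz => ?_⟩
    have hz2 : ‖z‖ ≤ 2*((1+x)*(1+u)) := by
      have := norm_add_le (z - x) (x:ℂ)
      rw [sub_add_cancel, Complex.norm_real, Real.norm_of_nonneg hx] at this
      nlinarith [mul_nonneg hx hu]
    have hz3 : ‖z‖^2 ≤ 4*((1+x)^2*(1+u)^2) := by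
      calc ‖z‖^2 ≤ (2*((1+x)*(1+u)))^2 := by gcongr
        _ = _ := by ring
    have hX : 0 < 1+x := by linarith
    have hP : (1+x)^(-(α+2+1/2)) * (1+x)^2 = (1+x)^(-(α+1/2)) := by
      rw [← rpow_natCast, ← rpow_add hX]; congr 1; push_cast; ring
    have hQ : (1+x)^(-(α+1+1/2)) ≤ (1+x)^(-(α+1/2)) :=
      rpow_le_rpow_of_exponent_le (by linarith) (by linarith)
    have hU1 : (1+u)^M1 ≤ (1+u)^(M1+M2+2) := pow_le_pow_right₀ (by linarith) (by omega)
    have hU2 : (1+u)^(M2+2) ≤ (1+u)^(M1+M2+2) := pow_le_pow_right₀ (by linarith) (by omega)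
    rw [fC_rec hα]
    have n1 : ‖((α:ℂ)+1)‖ = α+1 := by
      rw [← Complex.ofReal_one, ← Complex.ofReal_add, Complex.norm_real, Real.norm_of_nonneg (by linarith)]
    have hα1 : 0 ≤ α+1 := by linarith
    calc _ ≤ ‖((α:ℂ)+1) * fC (α+1) z‖ + ‖z^2 * fC (α+2) z‖ := norm_add_le _ _
      _ = (α+1) * ‖fC (α+1) z‖ + ‖z‖^2 * ‖fC (α+2) z‖ := by rw [norm_mul, norm_mul, norm_pow, n1]
      _ ≤ (α+1) * (C1 * exp (u/4) * (1+u)^M1 * (1+x)^(-(α+1+1/2)))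
          + (4*((1+x)^2*(1+u)^2)) * (C2 * exp (u/4) * (1+u)^M2 * (1+x)^(-(α+2+1/2))) := by
          gcongr
          · exact h1 x u z hx hu hz
          · exact h2 x u z hx hu hz
      _ = (α+1) * (C1 * exp (u/4) * (1+u)^M1 * (1+x)^(-(α+1+1/2)))
          + 4*C2 * exp (u/4) * (1+u)^(M2+2) * (1+x)^(-(α+1/2)) := by rw [← hP, pow_add]; ring
      _ ≤ (α+1) * (C1 * exp (u/4) * (1+u)^(M1+M2+2) * (1+x)^(-(α+1/2)))
          + 4*C2 * exp (u/4) * (1+u)^(M1+M2+2) * (1+x)^(-(α+1/2)) := by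
          gcongr
      _ = _ := by ring

lemma fC_bound {α : ℝ} (hα : -1 < α) : ∃ C : ℝ, ∃ M : ℕ, 0 ≤ C ∧ ∀ (x u : ℝ) (z : ℂ), 0 ≤ x → 0 ≤ u →
    ‖z - x‖ ≤ (x+u)/16 → ‖fC α z‖ ≤ C * exp (u/4) * (1+u)^M * (1+x)^(-(α+1/2)) :=
  fC_bound_aux 2 α hα (by norm_num; linarith)

lemma intg0 {γ δ : ℝ} (hγ : -1 < γ) (hδ : 0 < δ) :
    IntegrableOn (fun s : ℝ => s^γ * exp (-(δ*s))) (Ioi 0) := by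
  by_contra hcon
  have := Real.integral_rpow_mul_exp_neg_mul_Ioi (a := γ+1) (r := δ) (by linarith) (by linarith)
  rw [show γ + 1 - 1 = γ by ring, integral_undef hcon] at this
  have h2 : 0 < (1/δ)^(γ+1) * Gamma (γ+1) :=
    mul_pos (rpow_pos_of_pos (by positivity) _) (Gamma_pos_of_pos (by linarith))
  linarith

lemma pow_le_exp (M : ℕ) {δ : ℝ} (hδ : 0 < δ) : ∃ K : ℝ, 0 ≤ K ∧ ∀ s : ℝ, 0 ≤ s →
    (1+s)^M ≤ K * exp (δ*s) := by
  refine ⟨M.factorial / δ^M * exp δ, by positivity, fun s hs => ?_⟩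
  have h := Real.pow_div_factorial_le_exp (δ*(1+s)) (by positivity) M
  rw [mul_pow, div_le_iff₀ (by positivity)] at h
  rw [show M.factorial / δ^M * exp δ * exp (δ*s) = (exp (δ*(1+s)) * M.factorial) / δ^M by
    rw [mul_add, exp_add]; ring_nf]
  rw [le_div_iff₀ (by positivity)]
  linarith

lemma intg {γ δ : ℝ} (hγ : -1 < γ) (hδ : 0 < δ) (M : ℕ) :
    IntegrableOn (fun s : ℝ => s^γ * (1+s)^M * exp (-(δ*s))) (Ioi 0) := by
  obtain ⟨K, hK, h⟩ := pow_le_exp M (half_pos hδ)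
  have hi := (intg0 hγ (half_pos hδ)).const_mul K
  refine Integrable.mono' hi ?_ ?_
  · apply Measurable.aestronglyMeasurable
    fun_prop
  · refine (ae_restrict_mem measurableSet_Ioi).mono fun s hs => ?_
    have hs0 : (0:ℝ) ≤ s := (mem_Ioi.1 hs).le
    rw [Real.norm_of_nonneg (by positivity)]
    have e : exp (-(δ*s)) = exp (-(δ/2*s)) * exp (-(δ/2*s)) := by rw [← exp_add]; ring_nf
    have e2 : exp (δ/2*s) * exp (-(δ/2*s)) = 1 := by rw [← exp_add]; simp
    calc s^γ * (1+s)^M * exp (-(δ*s)) ≤ s^γ * (K * exp (δ/2*s)) * exp (-(δ*s)) := by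
          gcongr
          exact h s hs0
      _ = K * (s^γ * exp (-(δ/2*s))) * (exp (δ/2*s) * exp (-(δ/2*s))) := by rw [e]; ring
      _ = _ := by rw [e2, mul_one]

/-- real version -/
def iotaR (α y : ℝ) : ℝ := ∑' m : ℕ, y^m / (m.factorial * Gamma (α+1+m))

lemma iotaC_ofReal (α y : ℝ) : iotaC α (y:ℂ) = (iotaR α y : ℂ) := by
  unfold iotaC iotaR
  rw [Complex.ofReal_tsum]
  apply tsum_congr
  intro m; push_cast; rfl

lemma iotaR_summable {α : ℝ} (hα : -1 < α) (y : ℝ) :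
    Summable (fun m : ℕ => y^m / (m.factorial * Gamma (α+1+m))) := by
  have h := iotaC_summable hα (y:ℂ)
  rw [← Complex.summable_ofReal]
  refine h.congr fun m => ?_
  push_cast; rfl

lemma gpos {α : ℝ} (hα : -1 < α) (m : ℕ) : 0 < Gamma (α+1+m) := Gamma_pos_of_pos (by
    have : (0:ℝ) ≤ m := Nat.cast_nonneg m
    linarith)

lemma iotaR_nonneg {α : ℝ} (hα : -1 < α) {y : ℝ} (hy : 0 ≤ y) : 0 ≤ iotaR α y := by
  apply tsum_nonneg
  intro m
  have := gpos hα m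
  positivity

lemma iotaR_cont {α : ℝ} (hα : -1 < α) : Continuous (iotaR α) := by
  have h := (iotaC_differentiable hα).continuous
  have h2 : Continuous (fun y : ℝ => (iotaC α (y:ℂ)).re) := by fun_prop
  refine h2.congr fun y => ?_
  rw [iotaC_ofReal, Complex.ofReal_re]

lemma iotaR_bound {α : ℝ} (hα : -1 < α) : ∃ C : ℝ, ∃ M : ℕ, 0 ≤ C ∧ ∀ x : ℝ, 0 ≤ x →
    iotaR α (x^2) ≤ C * (1+x)^M * exp (2*x) := by
  obtain ⟨C, M, hC, h⟩ := fC_bound hα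
  refine ⟨C, 1, hC, fun x hx => ?_⟩
  have h1 := h x 0 x hx le_rfl (by simp; linarith)
  have e : fC α (x:ℂ) = ((exp (-2*x) * iotaR α (x^2) : ℝ):ℂ) := by
    unfold fC; push_cast; rw [← iotaC_ofReal]; push_cast; rfl
  rw [e, Complex.norm_real, Real.norm_of_nonneg (mul_nonneg (exp_pos _).le (iotaR_nonneg hα (sq_nonneg x)))] at h1
  simp only [zero_div, exp_zero, mul_one, add_zero, one_pow] at h1
  have h2 : (1+x)^(-(α+1/2)) ≤ (1+x)^(1:ℝ) := rpow_le_rpow_of_exponent_le (by linarith) (by linarith)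
  rw [rpow_one] at h2
  have e2 : exp (2*x) * exp (-2*x) = 1 := by rw [← exp_add]; simp
  calc iotaR α (x^2) = exp (2*x) * (exp (-2*x) * iotaR α (x^2)) := by rw [← mul_assoc, e2, one_mul]
    _ ≤ exp (2*x) * (C * (1+x)) :=
      mul_le_mul_of_nonneg_left (h1.trans (mul_le_mul_of_nonneg_left h2 hC)) (exp_pos _).le
    _ = _ := by ring

lemma sigN_hasSum {α β : ℝ} (hα : -1 < α) (hβ : -1 < β) (p q s : ℝ) :
    HasSum (fun N : ℕ => sigN α β N p q * s^N) (iotaR α (p*s) * iotaR β (q*s)) := by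
  have h1 := iotaR_summable hα (p*s)
  have h2 := iotaR_summable hβ (q*s)
  have h1n := h1.norm
  have h2n := h2.norm
  have hs := summable_norm_sum_mul_antidiagonal_of_summable_norm h1n h2n
  have ht := tsum_mul_tsum_eq_tsum_sum_antidiagonal_of_summable_norm h1n h2n
  have e : ∀ N : ℕ, ∑ kl ∈ Finset.HasAntidiagonal.antidiagonal N, ((p*s)^kl.1 / (kl.1.factorial * Gamma (α+1+kl.1))) *
      ((q*s)^kl.2 / (kl.2.factorial * Gamma (β+1+kl.2))) = sigN α β N p q * s^N := by
    intro N
    unfold sigN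
    rw [Finset.sum_mul]
    apply Finset.sum_congr rfl
    intro x hx
    rw [Finset.HasAntidiagonal.mem_antidiagonal] at hx
    rw [← hx, mul_pow, mul_pow, pow_add]
    have g1 := gpos hα x.1
    have g2 := gpos hβ x.2
    field_simp
  simp only [e] at hs ht
  have := hs.of_norm.hasSum
  rw [← ht] at this
  exact this

lemma sigN_nonneg {α β : ℝ} (hα : -1 < α) (hβ : -1 < β) {p q : ℝ} (hp : 0 ≤ p) (hq : 0 ≤ q) (N : ℕ) :
    0 ≤ sigN α β N p q := by
  unfold sigN
  apply Finset.sum_nonneg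
  intro x hx
  have g1 := gpos hα x.1
  have g2 := gpos hβ x.2
  positivity

lemma SN_nonneg {α β : ℝ} (hα : -1 < α) (hβ : -1 < β) {p q : ℝ} (hp : 0 ≤ p) (hq : 0 ≤ q) (N : ℕ) :
    0 ≤ SN α β N p q := by
  unfold SN
  have : (0:ℝ) ≤ N := Nat.cast_nonneg N
  exact mul_nonneg (Gamma_pos_of_pos (by linarith)).le (sigN_nonneg hα hβ hp hq N)

def Wint (α β a b X s : ℝ) : ℝ :=
  s^(α+β+1) * exp (-(X*s)) * (iotaR α ((a*s)^2) * iotaR β ((b*s)^2))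

lemma Wint_integrable {α β : ℝ} (hα : -1 < α) (hβ : -1 < β) {a b X : ℝ} (ha : 0 ≤ a) (hb : 0 ≤ b)
    (hX : 2*(a+b) < X) : IntegrableOn (Wint α β a b X) (Ioi 0) := by
  obtain ⟨C1, M1, hC1, h1⟩ := iotaR_bound hα
  obtain ⟨C2, M2, hC2, h2⟩ := iotaR_bound hβ
  set δ := X - 2*(a+b) with hδ
  have hδ0 : 0 < δ := by linarith
  have hi := (intg (γ := α+β+1) (by linarith) hδ0 (M1+M2)).const_mul (C1*C2*((1+a)^M1*(1+b)^M2))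
  refine Integrable.mono' hi ?_ ?_
  · apply Measurable.aestronglyMeasurable
    have c1 := (iotaR_cont hα).measurable
    have c2 := (iotaR_cont hβ).measurable
    unfold Wint
    fun_prop
  · refine (ae_restrict_mem measurableSet_Ioi).mono fun s hs => ?_
    have hs0 : (0:ℝ) ≤ s := (mem_Ioi.1 hs).le
    have n1 := iotaR_nonneg hα (sq_nonneg (a*s))
    have n2 := iotaR_nonneg hβ (sq_nonneg (b*s))
    unfold Wint
    rw [Real.norm_of_nonneg (by positivity)]
    have b1 : (1+a*s)^M1 ≤ ((1+a)*(1+s))^M1 := by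
      gcongr; nlinarith
    have b2 : (1+b*s)^M2 ≤ ((1+b)*(1+s))^M2 := by
      gcongr; nlinarith
    calc _ ≤ s^(α+β+1) * exp (-(X*s)) * ((C1 * ((1+a)*(1+s))^M1 * exp (2*(a*s))) * (C2 * ((1+b)*(1+s))^M2 * exp (2*(b*s)))) := by
          gcongr
          · exact (h1 (a*s) (by positivity)).trans (by gcongr)
          · exact (h2 (b*s) (by positivity)).trans (by gcongr)
      _ = C1*C2*((1+a)^M1*(1+b)^M2) * (s^(α+β+1) * (1+s)^(M1+M2) * (exp (-(X*s)) * exp (2*(a*s)) * exp (2*(b*s)))) := by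
          rw [mul_pow, mul_pow, pow_add]; ring
      _ = _ := by
          rw [← exp_add, ← exp_add]
          congr 3
          rw [hδ]; ring

lemma SN_hasSum {α β : ℝ} (hα : -1 < α) (hβ : -1 < β) {a b X : ℝ} (ha : 0 ≤ a) (hb : 0 ≤ b)
    (hX : 2*(a+b) < X) :
    HasSum (fun N : ℕ => SN α β N (a^2) (b^2) * X^(-(2*N+α+β+2))) (∫ s in Ioi (0:ℝ), Wint α β a b X s) := by
  have hX0 : 0 < X := by linarith
  have hsum : ∀ s ∈ Ioi (0:ℝ), HasSum (fun N : ℕ => s^(α+β+1) * exp (-(X*s)) * (sigN α β N (a^2) (b^2) * (s^2)^N)) (Wint α β a b X s) := by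
    intro s hs
    have := (sigN_hasSum hα hβ (a^2) (b^2) (s^2)).mul_left (s^(α+β+1) * exp (-(X*s)))
    unfold Wint
    rw [mul_pow, mul_pow]
    exact this
  have key := hasSum_integral_of_dominated_convergence (μ := volume.restrict (Ioi (0:ℝ)))
    (F := fun (N:ℕ) s => s^(α+β+1) * exp (-(X*s)) * (sigN α β N (a^2) (b^2) * (s^2)^N))
    (f := Wint α β a b X)
    (fun (N:ℕ) s => s^(α+β+1) * exp (-(X*s)) * (sigN α β N (a^2) (b^2) * (s^2)^N))
    (fun N => by
      apply Measurable.aestronglyMeasurable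
      fun_prop)
    (fun N => by
      refine (ae_restrict_mem measurableSet_Ioi).mono fun s hs => ?_
      have hs0 : (0:ℝ) ≤ s := (mem_Ioi.1 hs).le
      have := sigN_nonneg hα hβ (sq_nonneg a) (sq_nonneg b) N
      rw [Real.norm_of_nonneg (by positivity)])
    (by
      refine (ae_restrict_mem measurableSet_Ioi).mono fun s hs => ?_
      exact (hsum s hs).summable)
    (by
      refine (Wint_integrable hα hβ ha hb hX).congr ?_
      refine (ae_restrict_mem measurableSet_Ioi).mono fun s hs => ?_
      exact (hsum s hs).tsum_eq.symm)
    (by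
      refine (ae_restrict_mem measurableSet_Ioi).mono fun s hs => ?_
      exact hsum s hs)
  refine key.congr_fun fun N => ?_
  have hN : (0:ℝ) ≤ N := Nat.cast_nonneg N
  have e : ∫ s in Ioi (0:ℝ), s^(α+β+1) * exp (-(X*s)) * (sigN α β N (a^2) (b^2) * (s^2)^N) =
      sigN α β N (a^2) (b^2) * ∫ s in Ioi (0:ℝ), s^((2*N+α+β+2)-1) * exp (-(X*s)) := by
    rw [← integral_const_mul]
    apply setIntegral_congr_fun measurableSet_Ioi
    intro s hs
    have hs0 : (0:ℝ) < s := hs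
    have : s^((2*N+α+β+2)-1) = s^(α+β+1) * (s^2)^N := by
      rw [← pow_mul, ← rpow_natCast, ← rpow_add hs0]
      congr 1; push_cast; ring
    simp only [this]
    ring
  rw [e, Real.integral_rpow_mul_exp_neg_mul_Ioi (by linarith) hX0]
  unfold SN
  rw [one_div, inv_rpow hX0.le, ← rpow_neg hX0.le]
  ring

lemma psan (a : ℕ → ℝ) {R : ℝ} (hR : 0 < R) (h : ∀ z, 0 < z → z < R → Summable (fun n => |a n| * z^n)) :
    AnalyticOnNhd ℝ (fun z => ∑' n, a n * z^n) (Metric.ball 0 R) := by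
  set p := FormalMultilinearSeries.ofScalars ℝ a with hp
  have hrad : ENNReal.ofReal R ≤ p.radius := by
    apply le_of_forall_lt
    intro c hc
    obtain ⟨d, hcd, hdR⟩ := exists_between hc
    have hdtop : d ≠ ⊤ := ne_top_of_lt hdR
    lift d to NNReal using hdtop
    refine hcd.trans_le ?_
    have hd0 : (0:ℝ) < d := by
      have : (0:ENNReal) < d := lt_of_le_of_lt (zero_le) hcd
      exact_mod_cast this
    have hdR' : (d:ℝ) < R := by
      have := (ENNReal.lt_ofReal_iff_toReal_lt (by simp)).1 hdR
      simpa using this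
    have hs := h d hd0 hdR'
    apply p.le_radius_of_bound (∑' n, |a n| * (d:ℝ)^n)
    intro n
    rw [hp, FormalMultilinearSeries.ofScalars_norm, Real.norm_eq_abs]
    exact hs.le_tsum n (fun m _ => by positivity)
  have hr0 : 0 < p.radius := lt_of_lt_of_le (by simpa using hR) hrad
  have h1 := (p.hasFPowerSeriesOnBall hr0).analyticOnNhd
  have h2 : p.sum = fun z => ∑' n, a n * z^n := by
    ext z
    have := FormalMultilinearSeries.ofScalars_sum_eq (E := ℝ) a z
    simpa [FormalMultilinearSeries.ofScalarsSum] using this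
  rw [h2] at h1
  refine h1.mono ?_
  rw [← Metric.eball_ofReal]
  exact Metric.eball_subset_eball hrad

lemma choose_ris (σ : ℝ) (l : ℕ) : Ring.choose (σ + l - 1) l = ris σ l / l.factorial := by
  have h := Ring.factorial_nsmul_multichoose_eq_ascPochhammer σ l
  have e : Ring.choose (σ + l - 1) l = Ring.multichoose σ l := by
    rw [Ring.choose]; congr 1; ring
  have e2 : Polynomial.smeval (ascPochhammer ℕ l) σ = ris σ l := by
    rw [← Polynomial.eval₂_smulOneHom_eq_smeval]
    clear h e
    induction l with
    | zero => simp [ris_zero]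
    | succ k ih => rw [ascPochhammer_succ_right, Polynomial.eval₂_mul, ih, ris_succ]; simp
  rw [e, eq_div_iff (by positivity), ← e2, ← h, nsmul_eq_mul, mul_comm]

lemma binom_hasSum (σ : ℝ) {x : ℝ} (hx : |x| < 1) :
    HasSum (fun l : ℕ => ris σ l / l.factorial * x^l) ((1-x)^(-σ)) := by
  have h := (Real.one_div_one_sub_rpow_hasFPowerSeriesOnBall_zero σ).hasSum (y := x) (by
    simpa [enorm_eq_nnnorm, ← NNReal.coe_lt_coe] using hx)
  have hpos : 0 ≤ 1 - x := by linarith [(abs_lt.1 hx).2]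
  rw [zero_add, one_div, ← rpow_neg hpos] at h
  refine h.congr_fun fun l => ?_
  rw [← choose_ris]
  simp [mul_comm]

lemma wco_hasSum (σ : ℝ) {x : ℝ} (hx : |x| < 1) :
    HasSum (fun l : ℕ => wco l σ * x^l) ((1+x) * (1-x)^(-σ)) := by
  have h := binom_hasSum σ hx
  have h2 : HasSum (fun l : ℕ => (if l = 0 then 0 else ris σ (l-1) / (l-1).factorial) * x^l) (x * (1-x)^(-σ)) := by
    rw [← hasSum_nat_add_iff' 1]
    simp only [Finset.range_one, Finset.sum_singleton, if_true, zero_mul, sub_zero]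
    refine (h.mul_left x).congr_fun fun l => ?_
    simp only [Nat.add_eq_zero_iff, one_ne_zero, and_false, if_false, Nat.add_sub_cancel, pow_succ]
    ring
  have h3 := h.add h2
  rw [show (1-x)^(-σ) + x * (1-x)^(-σ) = (1+x) * (1-x)^(-σ) by ring] at h3
  refine h3.congr_fun fun l => ?_
  unfold wco; ring

lemma wco_nonneg {σ : ℝ} (hσ : 0 < σ) (l : ℕ) : 0 ≤ wco l σ := by
  unfold wco
  have h1 := ris_pos hσ l
  have h2 := ris_pos hσ (l-1)
  split_ifs <;> positivity

lemma rpow_split {α β : ℝ} {r Y : ℝ} (hr : 0 < r) (hY : 0 < Y) (N : ℕ) :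
    (Y / √r)^(-(2*N+α+β+2)) = r^((α+β+2)/2) * (r^N * Y^(-(2*N+α+β+2))) := by
  rw [div_rpow hY.le (sqrt_nonneg r), sqrt_eq_rpow, ← rpow_mul hr.le, div_eq_mul_inv, ← rpow_neg hr.le,
    ← mul_assoc, ← rpow_natCast r N, ← rpow_add hr, mul_comm]
  congr 2; ring

lemma S_summable {α β : ℝ} (hα : -1 < α) (hβ : -1 < β) {a b : ℝ} (ha : 0 ≤ a) (hb : 0 ≤ b) {r Y : ℝ} (hr : 0 < r) (hY : 0 < Y) (hX : 2*(a+b) < Y/√r) :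
    Summable (fun N : ℕ => SN α β N (a^2) (b^2) * (r^N * Y^(-(2*N+α+β+2)))) := by
  have h := (SN_hasSum hα hβ ha hb hX).summable.mul_left (r^((α+β+2)/2))⁻¹
  refine h.congr fun N => ?_
  rw [rpow_split hr hY]
  have : r^((α+β+2)/2) ≠ 0 := (rpow_pos_of_pos hr _).ne'
  field_simp

lemma G_summable {α β : ℝ} (hα : -1 < α) (hβ : -1 < β) {a b : ℝ} (ha : 0 ≤ a) (hb : 0 ≤ b) (hab : a + b ≤ 1)
    {z : ℝ} (hz : 0 < z) (hz4 : z < 1/4) :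
    Summable (fun N : ℕ => SN α β N (a^2) (b^2) * z^N) := by
  have h := S_summable hα hβ ha hb hz one_pos (by
    rw [lt_div_iff₀ (sqrt_pos.2 hz)]
    have : √z < 1/2 := by
      rw [sqrt_lt' (by norm_num)]; linarith
    nlinarith [sqrt_nonneg z])
  simpa using h

lemma gen_small {α β : ℝ} (hα : -1 < α) (hβ : -1 < β) {a b : ℝ} (ha : 0 ≤ a) (hb : 0 ≤ b) (hab : a + b ≤ 1)
    {r : ℝ} (hr : 0 < r) (hr1 : r < 1/10) :
    HasSum (fun n : ℕ => (∑ N ∈ Finset.range (n+1), (-1)^(n-N) * wco (n-N) (2*N+α+β+2) * SN α β N (a^2) (b^2)) * r^n)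
      (∑' N : ℕ, SN α β N (a^2) (b^2) * (r^N * ((1-r) * (1+r)^(-(2*N+α+β+2))))) := by
  have hσ : ∀ N : ℕ, (0:ℝ) < 2*N+α+β+2 := fun N => by
    have : (0:ℝ) ≤ N := Nat.cast_nonneg N
    linarith
  have hrabs : |r| < 1 := by rw [abs_of_pos hr]; linarith
  have hrabs' : |-r| < 1 := by rw [abs_neg]; exact hrabs
  set F : ℕ × ℕ → ℝ := fun x => SN α β x.1 (a^2) (b^2) * (r^x.1 * (wco x.2 (2*x.1+α+β+2) * (-r)^x.2)) with hF
  have hFnorm : ∀ x, ‖F x‖ = SN α β x.1 (a^2) (b^2) * (r^x.1 * (wco x.2 (2*x.1+α+β+2) * r^x.2)) := by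
    intro x
    simp only [hF, norm_mul, norm_pow, norm_neg]
    rw [Real.norm_of_nonneg hr.le, Real.norm_of_nonneg (SN_nonneg hα hβ (sq_nonneg a) (sq_nonneg b) _),
      Real.norm_of_nonneg (wco_nonneg (hσ _) _)]
  have hinner : ∀ N : ℕ, HasSum (fun l => SN α β N (a^2) (b^2) * (r^N * (wco l (2*N+α+β+2) * r^l)))
      (SN α β N (a^2) (b^2) * (r^N * ((1+r) * (1-r)^(-(2*N+α+β+2))))) := fun N =>
    ((wco_hasSum _ hrabs).mul_left _).mul_left _
  have hs : Summable F := by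
    apply Summable.of_norm
    rw [summable_prod_of_nonneg (fun x => norm_nonneg _)]
    simp only [hFnorm]
    refine ⟨fun N => (hinner N).summable, ?_⟩
    simp only [fun N => (hinner N).tsum_eq]
    have h := (S_summable hα hβ ha hb hr (Y := 1-r) (by linarith) (by
      rw [lt_div_iff₀ (sqrt_pos.2 hr)]
      have : √r < 9/20 := by
        rw [sqrt_lt' (by norm_num)]; norm_num; linarith
      nlinarith [sqrt_nonneg r])).mul_left (1+r)
    refine h.congr fun N => ?_
    ring
  have h1 : HasSum F (∑' N : ℕ, SN α β N (a^2) (b^2) * (r^N * ((1-r) * (1+r)^(-(2*N+α+β+2))))) := by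
    have h2 := hs.hasSum
    have h3 := h2.tsum_eq
    rw [hs.tsum_prod] at h3
    rw [hs.tsum_prod] at h2
    convert h2 using 1
    apply tsum_congr
    intro N
    have := ((wco_hasSum (2*N+α+β+2) hrabs').mul_left (r^N)).mul_left (SN α β N (a^2) (b^2))
    rw [← sub_eq_add_neg, sub_neg_eq_add] at this
    exact this.tsum_eq.symm
  have h4 := (Finset.HasAntidiagonal.sigmaAntidiagonalEquivProd (A := ℕ)).hasSum_iff.2 h1
  have h5 := h4.sigma (fun n => hasSum_fintype _)
  refine h5.congr_fun fun n => ?_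
  simp only [Function.comp, Finset.HasAntidiagonal.sigmaAntidiagonalEquivProd_apply]
  rw [Finset.sum_coe_sort (Finset.HasAntidiagonal.antidiagonal n) F]
  rw [Finset.Nat.sum_antidiagonal_eq_sum_range_succ_mk, Finset.sum_mul]
  apply Finset.sum_congr rfl
  intro N hN
  have hN' : N ≤ n := by
    rw [Finset.mem_range] at hN; omega
  simp only [hF]
  rw [neg_pow r, show r^n = r^N * r^(n-N) by rw [← pow_add]; congr 1; omega]
  ring

lemma gen_all {α β : ℝ} (hα : -1 < α) (hβ : -1 < β) {a b : ℝ} (ha : 0 ≤ a) (hb : 0 ≤ b) (hab : a + b ≤ 1)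
    (A : ℕ → ℝ) (hA : ∀ n, A n = ∑ N ∈ Finset.range (n+1), (-1)^(n-N) * wco (n-N) (2*N+α+β+2) * SN α β N (a^2) (b^2))
    (K : ℝ) (hg : ∀ n, |A n| ≤ K * ((n:ℝ)+1)^2) {r : ℝ} (hr : 0 < r) (hr1 : r < 1) :
    ∑' n, A n * r^n = (1-r) * ∑' N : ℕ, SN α β N (a^2) (b^2) * (r^N * (1+r)^(-(2*N+α+β+2))) := by
  set G : ℝ → ℝ := fun z => ∑' N, SN α β N (a^2) (b^2) * z^N with hG
  have hGan : AnalyticOnNhd ℝ G (Metric.ball 0 (1/4)) := by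
    apply psan _ (by norm_num)
    intro z hz hz4
    refine (G_summable hα hβ ha hb hab hz hz4).congr fun N => ?_
    rw [abs_of_nonneg (SN_nonneg hα hβ (sq_nonneg a) (sq_nonneg b) _)]
  have hLan : AnalyticOnNhd ℝ (fun z => ∑' n, A n * z^n) (Metric.ball 0 1) := by
    apply psan _ one_pos
    intro z hz hz1
    have h0 : Summable (fun n : ℕ => K * (((n:ℝ)+1)^2 * z^n)) := by
      apply Summable.mul_left
      have hz' : ‖z‖ < 1 := by rw [Real.norm_of_nonneg hz.le]; exact hz1
      have s2 := summable_pow_mul_geometric_of_norm_lt_one 2 hz'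
      have s1 := summable_pow_mul_geometric_of_norm_lt_one 1 hz'
      have s0 := summable_pow_mul_geometric_of_norm_lt_one 0 hz'
      refine ((s2.add (s1.mul_left 2)).add s0).congr fun n => ?_
      ring
    refine Summable.of_nonneg_of_le (fun n => by positivity) (fun n => ?_) h0
    rw [← mul_assoc]
    exact mul_le_mul_of_nonneg_right (hg n) (by positivity)
  set Rf : ℝ → ℝ := fun z => (1-z) * (1+z)^(-(α+β+2)) * G (z/(1+z)^2) with hRf
  have hRan : AnalyticOnNhd ℝ Rf (Ioo 0 1) := by
    intro z hz
    have h1 : AnalyticAt ℝ (fun z : ℝ => (1+z)^(-(α+β+2))) z := by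
      have h0 : AnalyticAt ℝ (fun z : ℝ => exp (Real.log (1+z) * (-(α+β+2)))) z := by
        have hl : AnalyticAt ℝ (fun z : ℝ => Real.log (1+z)) z :=
          AnalyticAt.log (by fun_prop) (by linarith [hz.1])
        have hm : AnalyticAt ℝ (fun z : ℝ => Real.log (1+z) * (-(α+β+2))) z := hl.mul analyticAt_const
        exact analyticAt_rexp.comp hm
      refine h0.congr ?_
      filter_upwards [Ioi_mem_nhds hz.1] with y hy
      have : (0:ℝ) < 1 + y := by have : (0:ℝ) < y := hy
                                 linarith
      rw [rpow_def_of_pos this]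
    have h2 : AnalyticAt ℝ (fun z : ℝ => z/(1+z)^2) z := by
      apply AnalyticAt.div
      · fun_prop
      · fun_prop
      · have := hz.1; positivity
    have h3 : AnalyticAt ℝ (fun z => G (z/(1+z)^2)) z := by
      have hmem : z/(1+z)^2 ∈ Metric.ball (0:ℝ) (1/4) := by
        have hz0 := hz.1
        rw [mem_ball_zero_iff, Real.norm_of_nonneg (by positivity), div_lt_iff₀ (by positivity)]
        have : 0 < (1-z)^2 := by have := hz.2; exact pow_pos (by linarith) 2
        nlinarith
      exact AnalyticAt.comp (f := fun z : ℝ => z/(1+z)^2) (hGan _ hmem) h2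
    exact ((by fun_prop : AnalyticAt ℝ (fun z : ℝ => 1-z) z).mul h1).mul h3
  have hRval : ∀ z ∈ Ioo (0:ℝ) 1, Rf z = (1-z) * ∑' N : ℕ, SN α β N (a^2) (b^2) * (z^N * (1+z)^(-(2*N+α+β+2))) := by
    intro z hz
    simp only [hRf, hG]
    rw [mul_assoc, ← tsum_mul_left]
    congr 1
    apply tsum_congr
    intro N
    have h1z : 0 < 1 + z := by linarith [hz.1]
    have : (1+z)^(-(2*N+α+β+2)) = (1+z)^(-(α+β+2)) * ((1+z)^(2*N))⁻¹ := by
      rw [← rpow_natCast (1+z) (2*N), ← rpow_neg h1z.le, ← rpow_add h1z]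
      congr 1; push_cast; ring
    rw [this, div_pow, ← pow_mul]
    ring
  have hev : (fun z => ∑' n, A n * z^n) =ᶠ[nhds (1/20)] Rf := by
    have : Ioo (0:ℝ) (1/10) ∈ nhds (1/20:ℝ) := Ioo_mem_nhds (by norm_num) (by norm_num)
    filter_upwards [this] with z hz
    rw [hRval z ⟨hz.1, by linarith [hz.2]⟩, ← tsum_mul_left]
    simp only [hA]
    rw [(gen_small hα hβ ha hb hab hz.1 hz.2).tsum_eq]
    apply tsum_congr
    intro N; ring
  have hL' : AnalyticOnNhd ℝ (fun z => ∑' n, A n * z^n) (Ioo 0 1) := hLan.mono (fun z hz => by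
    rw [mem_ball_zero_iff, Real.norm_of_nonneg hz.1.le]; exact hz.2)
  have := hL'.eqOn_of_preconnected_of_eventuallyEq hRan isPreconnected_Ioo
    (z₀ := 1/20) ⟨by norm_num, by norm_num⟩ hev ⟨hr, hr1⟩
  rw [← hRval r ⟨hr, hr1⟩]
  exact this

def Htil (α β : ℝ) (c : ℕ → ℝ) (t θ φ : ℝ) : ℝ :=
  ∑' n : ℕ, Real.exp (-t * ((n:ℝ) + jacobiTau α β)) * nJacobi α β c n θ * nJacobi α β c n φ

lemma nJ_mul_growth {α β : ℝ} {c : ℕ → ℝ} (hc : JacobiNormalized α β c) {θ φ : ℝ}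
    (hθ : θ ∈ Ioo 0 π) (hφ : φ ∈ Ioo 0 π) :
    ∃ K : ℝ, 0 ≤ K ∧ ∀ n, |nJacobi α β c n θ * nJacobi α β c n φ| ≤ K * ((n:ℝ)+1)^2 := by
  obtain ⟨C1, h1, g1⟩ := growth hc hθ
  obtain ⟨C2, h2, g2⟩ := growth hc hφ
  refine ⟨C1*C2, by positivity, fun n => ?_⟩
  rw [abs_mul]
  calc _ ≤ (C1*(n+1)) * (C2*(n+1)) := mul_le_mul (g1 n) (g2 n) (abs_nonneg _) (by positivity)
    _ = _ := by ring

lemma exp_term (α β t : ℝ) (n : ℕ) :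
    Real.exp (-t * ((n:ℝ) + jacobiTau α β)) = exp (-t * jacobiTau α β) * (exp (-t))^n := by
  rw [← Real.exp_nat_mul, ← exp_add]; congr 1; ring

lemma Htil_summable {α β : ℝ} {c : ℕ → ℝ} (hc : JacobiNormalized α β c) {t θ φ : ℝ} (ht : 0 < t)
    (hθ : θ ∈ Ioo 0 π) (hφ : φ ∈ Ioo 0 π) :
    Summable (fun n : ℕ => Real.exp (-t * ((n:ℝ) + jacobiTau α β)) * nJacobi α β c n θ * nJacobi α β c n φ) := by
  obtain ⟨K, hK, h⟩ := nJ_mul_growth hc hθ hφ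
  set z := exp (-t) with hz
  have hz0 : 0 < z := exp_pos _
  have hz1 : z < 1 := by rw [hz]; exact Real.exp_lt_one_iff.2 (by linarith)
  have hz' : ‖z‖ < 1 := by rw [Real.norm_of_nonneg hz0.le]; exact hz1
  have s2 := summable_pow_mul_geometric_of_norm_lt_one 2 hz'
  have s1 := summable_pow_mul_geometric_of_norm_lt_one 1 hz'
  have s0 := summable_pow_mul_geometric_of_norm_lt_one 0 hz'
  have hs := ((s2.add (s1.mul_left 2)).add s0).mul_left (exp (-t * jacobiTau α β) * K)
  refine Summable.of_norm_bounded hs fun n => ?_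
  rw [mul_assoc, norm_mul, exp_term, Real.norm_of_nonneg (by positivity), Real.norm_eq_abs]
  calc _ ≤ exp (-t * jacobiTau α β) * z^n * (K * ((n:ℝ)+1)^2) := by
        gcongr
        exact h n
    _ = _ := by ring

lemma ab_le (θ φ : ℝ) : sin (θ/2) * sin (φ/2) + cos (θ/2) * cos (φ/2) ≤ 1 := by
  have := cos_sub (θ/2) (φ/2)
  linarith [cos_le_one (θ/2 - φ/2)]

lemma half_pos_trig {θ : ℝ} (hθ : θ ∈ Ioo 0 π) : 0 < sin (θ/2) ∧ 0 < cos (θ/2) := by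
  constructor
  · exact sin_pos_of_pos_of_lt_pi (by linarith [hθ.1]) (by linarith [hθ.2, pi_pos])
  · exact cos_pos_of_mem_Ioo ⟨by linarith [hθ.1, pi_pos], by linarith [hθ.2]⟩

lemma Htil_eq {α β : ℝ} (hα : -1 < α) (hβ : -1 < β) {c : ℕ → ℝ} (hc : JacobiNormalized α β c)
    {t θ φ : ℝ} (ht : 0 < t) (hθ : θ ∈ Ioo 0 π) (hφ : φ ∈ Ioo 0 π) :
    Htil α β c t θ φ = 2 * sinh (t/2) *
      ∫ s in Ioi (0:ℝ), Wint α β (sin (θ/2) * sin (φ/2)) (cos (θ/2) * cos (φ/2)) (2 * cosh (t/2)) s := by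
  set a := sin (θ/2) * sin (φ/2) with ha
  set b := cos (θ/2) * cos (φ/2) with hb
  have ha0 : 0 ≤ a := (mul_pos (half_pos_trig hθ).1 (half_pos_trig hφ).1).le
  have hb0 : 0 ≤ b := (mul_pos (half_pos_trig hθ).2 (half_pos_trig hφ).2).le
  have hab : a + b ≤ 1 := ab_le θ φ
  have hch : 1 < cosh (t/2) := one_lt_cosh.2 (by linarith)
  have hX : 2*(a+b) < 2*cosh (t/2) := by linarith
  have hS := SN_hasSum hα hβ ha0 hb0 hX
  set r := exp (-t) with hr
  have hr0 : 0 < r := exp_pos _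
  have hr1 : r < 1 := by rw [hr]; exact Real.exp_lt_one_iff.2 (by linarith)
  have hsq : √r = exp (-(t/2)) := by
    rw [hr, show -t = -(t/2) + -(t/2) by ring, exp_add, sqrt_mul_self (exp_pos _).le]
  have hr2 : r = exp (-(t/2)) * exp (-(t/2)) := by rw [hr, ← exp_add]; congr 1; ring
  have hinv : exp (t/2) * exp (-(t/2)) = 1 := by rw [← exp_add]; simp
  have hXr : 2 * cosh (t/2) = (1+r)/√r := by
    rw [hsq, cosh_eq, eq_div_iff (exp_pos _).ne', hr2]
    linear_combination hinv
  have hsh : 2 * sinh (t/2) = (1-r)/√r := by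
    rw [hsq, sinh_eq, eq_div_iff (exp_pos _).ne', hr2]
    linear_combination hinv
  obtain ⟨K, hK, hg⟩ := nJ_mul_growth hc hθ hφ
  have hsin : ∀ x : ℝ, sin (x/2)^2 = (1 - cos x)/2 := by
    intro x
    have h1 := cos_sq' (x/2)
    have h2 := cos_sq (x/2)
    rw [show 2*(x/2) = x by ring] at h2
    linarith
  have hcos : ∀ x : ℝ, cos (x/2)^2 = 1 - (1 - cos x)/2 := by
    intro x
    have h1 := cos_sq' (x/2)
    rw [h1, hsin]
  have hgen := gen_all hα hβ ha0 hb0 hab (fun n => nJacobi α β c n θ * nJacobi α β c n φ) (by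
    intro n
    have hk := kerA hα hβ hc n ((1 - cos θ)/2) ((1 - cos φ)/2)
    have e1 : a^2 = (1 - cos θ)/2 * ((1 - cos φ)/2) := by
      rw [ha, mul_pow, hsin, hsin]
    have e2 : b^2 = (1 - (1 - cos θ)/2) * (1 - (1 - cos φ)/2) := by
      rw [hb, mul_pow, hcos, hcos]
    rw [e1, e2, ← hk]
    simp only [nJacobi, jacobiPoly_eq]
    ring) K hg hr0 hr1
  have hL : Htil α β c t θ φ = exp (-t * jacobiTau α β) * ∑' n, nJacobi α β c n θ * nJacobi α β c n φ * r^n := by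
    unfold Htil
    rw [← tsum_mul_left]
    apply tsum_congr
    intro n
    rw [exp_term, hr]; ring
  rw [hL, hgen, ← hS.tsum_eq, hXr, hsh]
  have h1r : 0 < 1 + r := by linarith
  have e3 : ∀ N : ℕ, SN α β N (a^2) (b^2) * ((1+r)/√r)^(-(2*N+α+β+2)) =
      r^((α+β+2)/2) * (SN α β N (a^2) (b^2) * (r^N * (1+r)^(-(2*N+α+β+2)))) := by
    intro N
    rw [rpow_split hr0 h1r]; ring
  simp only [e3]
  rw [tsum_mul_left]
  have e4 : exp (-t * jacobiTau α β) = r^((α+β+2)/2) / √r := by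
    rw [hsq, hr, ← exp_mul, ← exp_sub]
    congr 1
    unfold jacobiTau; ring
  rw [e4]; ring

lemma poisson_eq {α β : ℝ} (hα : -1 < α) (hβ : -1 < β) {c : ℕ → ℝ} (hc : JacobiNormalized α β c)
    {t θ φ : ℝ} (ht : 0 < t) (hθ : θ ∈ Ioo 0 π) (hφ : φ ∈ Ioo 0 π) :
    poissonKer α β c t θ φ = Htil α β c t θ φ +
      (exp (-t * |jacobiTau α β|) - exp (-t * jacobiTau α β)) * c 0 ^ 2 := by
  have hs := Htil_summable hc ht hθ hφ
  have hs1 := (summable_nat_add_iff 1).2 hs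
  have hτ : ∀ n : ℕ, |((n+1:ℕ):ℝ) + jacobiTau α β| = ((n+1:ℕ):ℝ) + jacobiTau α β := by
    intro n
    apply abs_of_nonneg
    have : (0:ℝ) ≤ n := Nat.cast_nonneg n
    unfold jacobiTau; push_cast; linarith
  have hP : ∀ x, nJacobi α β c 0 x = c 0 := by
    intro x
    have g1 : Gamma (α+1) ≠ 0 := (Gamma_pos_of_pos (by linarith)).ne'
    have g2 : Gamma (β+1) ≠ 0 := (Gamma_pos_of_pos (by linarith)).ne'
    unfold nJacobi jacobiPoly
    simp [g1, g2]
  have hs2 : Summable (fun n : ℕ => Real.exp (-t * |(n:ℝ) + jacobiTau α β|) * nJacobi α β c n θ * nJacobi α β c n φ) := by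
    rw [← summable_nat_add_iff 1]
    refine hs1.congr fun n => ?_
    rw [hτ]
  unfold poissonKer Htil
  rw [hs2.tsum_eq_zero_add, hs.tsum_eq_zero_add]
  simp only [hτ, hP, Nat.cast_zero, zero_add]
  ring

lemma csin_le {h : ℂ} (hh : ‖h‖ ≤ 1) : ‖Complex.sin h‖ ≤ 2 * ‖h‖ := by
  have e : Complex.sin h = ((Complex.exp (-h * Complex.I) - 1) - (Complex.exp (h * Complex.I) - 1))
      * Complex.I / 2 := by
    unfold Complex.sin; ring
  have n1 : ‖-h * Complex.I‖ ≤ 1 := by simpa using hh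
  have n2 : ‖h * Complex.I‖ ≤ 1 := by simpa using hh
  have b1 := Complex.norm_exp_sub_one_le n1
  have b2 := Complex.norm_exp_sub_one_le n2
  rw [e, norm_div, norm_mul, Complex.norm_I]
  have b3 := norm_sub_le (Complex.exp (-h * Complex.I) - 1) (Complex.exp (h * Complex.I) - 1)
  simp only [norm_mul, norm_neg, Complex.norm_I, mul_one] at b1 b2
  have : ‖(2:ℂ)‖ = 2 := by simp
  rw [this]; linarith

lemma ccos_le {h : ℂ} (hh : ‖h‖ ≤ 1) : ‖1 - Complex.cos h‖ ≤ 2 * ‖h‖^2 := by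
  have e : 1 - Complex.cos h = 2 * Complex.sin (h/2)^2 := by
    have h1 := Complex.cos_two_mul (h/2)
    have h2 := Complex.sin_sq_add_cos_sq (h/2)
    rw [show 2 * (h/2) = h by ring] at h1
    rw [h1]; linear_combination (-2)*h2
  have n1 : ‖h/2‖ = ‖h‖/2 := by simp
  have := csin_le (h := h/2) (by rw [n1]; linarith)
  rw [n1] at this
  rw [e, norm_mul, norm_pow]
  have : ‖(2:ℂ)‖ = 2 := by simp
  rw [this]
  have : ‖Complex.sin (h/2)‖^2 ≤ ‖h‖^2 := by gcongr; linarith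
  linarith

def aC (φ : ℝ) (z : ℂ) : ℂ := Complex.sin (z/2) * (sin (φ/2) : ℝ)
def bC (φ : ℝ) (z : ℂ) : ℂ := Complex.cos (z/2) * (cos (φ/2) : ℝ)
def DC (t φ : ℝ) (z : ℂ) : ℂ := (cosh (t/2) : ℝ) - Complex.cos ((z-φ)/2)
def aR (θ φ : ℝ) : ℝ := sin (θ/2) * sin (φ/2)
def bR (θ φ : ℝ) : ℝ := cos (θ/2) * cos (φ/2)
def DR (t θ φ : ℝ) : ℝ := cosh (t/2) - cos ((θ-φ)/2)

lemma aC_real (φ θ : ℝ) : aC φ θ = (aR θ φ : ℝ) := by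
  unfold aC aR; push_cast; rfl
lemma bC_real (φ θ : ℝ) : bC φ θ = (bR θ φ : ℝ) := by
  unfold bC bR; push_cast; rfl
lemma DC_real (t φ θ : ℝ) : DC t φ θ = (DR t θ φ : ℝ) := by
  unfold DC DR; push_cast; rfl

lemma abD (t θ φ : ℝ) : aR θ φ + bR θ φ + DR t θ φ = cosh (t/2) := by
  unfold aR bR DR
  rw [show (θ-φ)/2 = θ/2 - φ/2 by ring, cos_sub]; ring

lemma DR_pos {t : ℝ} (ht : 0 < t) (θ φ : ℝ) : 0 < DR t θ φ := by
  unfold DR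
  have := Real.one_lt_cosh.2 (show t/2 ≠ 0 by positivity)
  have := cos_le_one ((θ-φ)/2)
  linarith

lemma cosh_half_le {t : ℝ} (ht : 0 < t) (ht1 : t ≤ 1) : cosh (t/2) ≤ 2 := by
  have h1 : cosh (t/2) ≤ exp (t/2) := by
    rw [Real.cosh_eq]
    have : exp (-(t/2)) ≤ exp (t/2) := exp_le_exp.2 (by linarith)
    linarith
  have h2 : exp (t/2) ≤ 2 := by
    have := Real.exp_bound_div_one_sub_of_interval (x := t/2) (by linarith) (by linarith)
    refine this.trans ?_
    rw [div_le_iff₀ (by linarith)]; linarith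
  linarith

lemma sq_le_of {x y k : ℝ} (hk : 0 ≤ k) (hy : 0 ≤ y) (h : x^2 ≤ k^2 * y) : |x| ≤ k * √y := by
  refine abs_le_of_sq_le_sq ?_ (by positivity)
  rw [mul_pow, sq_sqrt hy]; exact h

set_option maxHeartbeats 1000000 in
lemma geom {t θ φ : ℝ} (ht : 0 < t) (ht1 : t ≤ 1) (hθ : θ ∈ Ioo 0 π) (hφ : φ ∈ Ioo 0 π)
    {z : ℂ} (hz : ‖z - θ‖ ≤ √(DR t θ φ) / 64) :
    ‖DC t φ z - DR t θ φ‖ ≤ DR t θ φ / 4 ∧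
    ‖aC φ z - aR θ φ‖ ≤ (aR θ φ + DR t θ φ) / 16 ∧
    ‖bC φ z - bR θ φ‖ ≤ (bR θ φ + DR t θ φ) / 16 := by
  set D := DR t θ φ with hD
  have hD0 : 0 < D := DR_pos ht θ φ
  obtain ⟨s1, c1⟩ := half_pos_trig hθ
  obtain ⟨s2, c2⟩ := half_pos_trig hφ
  have hch : 1 ≤ cosh (t/2) := Real.one_le_cosh _
  have hch2 := cosh_half_le ht ht1
  have hD4 : D ≤ 4 := by
    rw [hD]; unfold DR
    have := neg_one_le_cos ((θ-φ)/2)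
    linarith
  obtain ⟨h, hh⟩ : ∃ h : ℂ, h = (z-θ)/2 := ⟨_, rfl⟩
  have hz2 : z = θ + 2*h := by rw [hh]; ring
  have nh : ‖h‖ ≤ √D/128 := by
    rw [hh, norm_div]
    have : ‖(2:ℂ)‖ = 2 := by simp
    rw [this]; linarith
  have hsq : √D * √D = D := Real.mul_self_sqrt hD0.le
  have hs2 : √D ≤ 2 := by
    rw [show (2:ℝ) = √4 by rw [show (4:ℝ) = 2^2 by norm_num]; simp]
    exact Real.sqrt_le_sqrt hD4
  have hs0 : 0 < √D := Real.sqrt_pos.2 hD0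
  have nh1 : ‖h‖ ≤ 1 := by linarith
  have nn := norm_nonneg h
  have nhsq : ‖h‖^2 ≤ D/16384 := by
    have : ‖h‖^2 ≤ (√D/128)^2 := by gcongr
    nlinarith
  have S := csin_le nh1
  have Cc := ccos_le nh1
  have ha0 : 0 < aR θ φ := mul_pos s1 s2
  have hb0 : 0 < bR θ φ := mul_pos c1 c2
  have key := abD t θ φ
  rw [← hD] at key
  have ctriv : ∀ (x y : ℝ), 0 ≤ y → y ≤ 1 → x^2 + y^2 = 1 → x^2 ≤ 2*(1-y) := by
    intro x y hy hy1 hxy; nlinarith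
  refine ⟨?_, ?_, ?_⟩
  · set w := (θ-φ)/2 with hw
    have e : DC t φ z - D = (cos w : ℝ) * (1 - Complex.cos h) + (sin w : ℝ) * Complex.sin h := by
      rw [hD]; unfold DC DR
      rw [← hw, hz2, show ((θ:ℂ) + 2*h - φ)/2 = ((w:ℝ):ℂ) + h by rw [hw]; push_cast; ring, Complex.cos_add]
      push_cast; ring
    have hsw : |sin w| ≤ 3/2 * √D := by
      refine sq_le_of (by norm_num) hD0.le ?_
      have h3 := sin_sq_add_cos_sq w
      have : cosh (t/2) = D + cos w := by rw [hD]; unfold DR; ring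
      nlinarith [cos_le_one w, neg_one_le_cos w]
    rw [e]
    refine (norm_add_le _ _).trans ?_
    rw [norm_mul, norm_mul, Complex.norm_real, Complex.norm_real, Real.norm_eq_abs, Real.norm_eq_abs]
    have h1 : |cos w| * ‖1 - Complex.cos h‖ ≤ 1 * (2*‖h‖^2) := by
      gcongr; exact abs_cos_le_one w
    have h2 : |sin w| * ‖Complex.sin h‖ ≤ (3/2*√D) * (2*(√D/128)) := by
      gcongr; linarith
    nlinarith
  · have e : aC φ z - aR θ φ = (sin (φ/2) : ℝ) * (cos (θ/2) : ℝ) * Complex.sin h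
        - (aR θ φ : ℝ) * (1 - Complex.cos h) := by
      unfold aC aR
      rw [hz2, show ((θ:ℂ) + 2*h)/2 = ((θ/2:ℝ):ℂ) + h by push_cast; ring, Complex.sin_add]
      push_cast; ring
    have hE : 0 < aR θ φ + D := by linarith
    have hsw : |sin (φ/2)| ≤ 3/2 * √(aR θ φ + D) := by
      refine sq_le_of (by norm_num) hE.le ?_
      have h3 := sin_sq_add_cos_sq (φ/2)
      have h4 := ctriv _ _ c2.le (cos_le_one _) h3
      have : bR θ φ ≤ cos (φ/2) := by
        unfold bR; exact mul_le_of_le_one_left c2.le (cos_le_one _)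
      linarith
    have hmono : √D ≤ √(aR θ φ + D) := Real.sqrt_le_sqrt (by linarith)
    have hsqE : √(aR θ φ + D) * √(aR θ φ + D) = aR θ φ + D := Real.mul_self_sqrt hE.le
    rw [e]
    refine (norm_sub_le _ _).trans ?_
    rw [norm_mul, norm_mul, norm_mul, Complex.norm_real, Complex.norm_real, Complex.norm_real,
      Real.norm_eq_abs, Real.norm_eq_abs, Real.norm_eq_abs]
    have ha1 : |aR θ φ| ≤ 1 := by
      rw [abs_of_pos ha0]; unfold aR; exact mul_le_one₀ (sin_le_one _) s2.le (sin_le_one _)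
    have h1 : |aR θ φ| * ‖1 - Complex.cos h‖ ≤ 1 * (2*‖h‖^2) := by
      gcongr
    have h2 : |sin (φ/2)| * |cos (θ/2)| * ‖Complex.sin h‖ ≤
        (3/2*√(aR θ φ + D)) * 1 * (2*(√(aR θ φ + D)/128)) := by
      gcongr
      · exact abs_cos_le_one _
      · linarith
    linarith
  · have e : bC φ z - bR θ φ = -((cos (φ/2) : ℝ) * (sin (θ/2) : ℝ) * Complex.sin h
        + (bR θ φ : ℝ) * (1 - Complex.cos h)) := by
      unfold bC bR
      rw [hz2, show ((θ:ℂ) + 2*h)/2 = ((θ/2:ℝ):ℂ) + h by push_cast; ring, Complex.cos_add]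
      push_cast; ring
    have hE : 0 < bR θ φ + D := by linarith
    have hsw : |cos (φ/2)| ≤ 3/2 * √(bR θ φ + D) := by
      refine sq_le_of (by norm_num) hE.le ?_
      have h3 := cos_sq_add_sin_sq (φ/2)
      have h4 := ctriv _ _ s2.le (sin_le_one _) h3
      have : aR θ φ ≤ sin (φ/2) := by
        unfold aR; exact mul_le_of_le_one_left s2.le (sin_le_one _)
      linarith
    have hmono : √D ≤ √(bR θ φ + D) := Real.sqrt_le_sqrt (by linarith)
    have hsqE : √(bR θ φ + D) * √(bR θ φ + D) = bR θ φ + D := Real.mul_self_sqrt hE.le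
    rw [e, norm_neg]
    refine (norm_add_le _ _).trans ?_
    rw [norm_mul, norm_mul, norm_mul, Complex.norm_real, Complex.norm_real, Complex.norm_real,
      Real.norm_eq_abs, Real.norm_eq_abs, Real.norm_eq_abs]
    have hb1 : |bR θ φ| ≤ 1 := by
      rw [abs_of_pos hb0]; unfold bR; exact mul_le_one₀ (cos_le_one _) c2.le (cos_le_one _)
    have h1 : |bR θ φ| * ‖1 - Complex.cos h‖ ≤ 1 * (2*‖h‖^2) := by
      gcongr
    have h2 : |cos (φ/2)| * |sin (θ/2)| * ‖Complex.sin h‖ ≤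
        (3/2*√(bR θ φ + D)) * 1 * (2*(√(bR θ φ + D)/128)) := by
      gcongr
      · exact abs_sin_le_one _
      · linarith
    nlinarith

lemma rpow_scale {p u y : ℝ} (hp : -(1/2) < p) (hu : 0 < u) (hy : 0 ≤ y) :
    (1+u*y)^(-p) ≤ (1+u) * (1 + u^(-(max p 0))) * (1+y)^(-p) := by
  have hy1 : 0 < 1 + y := by linarith
  have hB : 0 < (1+y)^(-p) := rpow_pos_of_pos hy1 _
  rcases le_or_gt 0 p with h | h
  · rw [max_eq_left h]
    have hup : 0 < u^(-p) := rpow_pos_of_pos hu _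
    rcases le_or_gt 1 u with h1 | h1
    · have : (1+u*y)^(-p) ≤ (1+y)^(-p) :=
        rpow_le_rpow_of_nonpos hy1 (by nlinarith) (by linarith)
      have h2 : 1 ≤ (1+u)*(1+u^(-p)) := by nlinarith [mul_pos hu hup]
      nlinarith
    · have : (1+u*y)^(-p) ≤ (u*(1+y))^(-p) :=
        rpow_le_rpow_of_nonpos (by positivity) (by nlinarith) (by linarith)
      rw [mul_rpow hu.le hy1.le] at this
      have h2 : u^(-p) ≤ (1+u)*(1+u^(-p)) := by nlinarith [mul_pos hu hup]
      nlinarith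
  · rw [max_eq_right h.le]
    have : (1+u*y)^(-p) ≤ ((1+u)*(1+y))^(-p) :=
      rpow_le_rpow (by positivity) (by nlinarith) (by linarith)
    rw [mul_rpow (by linarith) hy1.le] at this
    have h2 : (1+u)^(-p) ≤ (1+u) := by
      have := rpow_le_rpow_of_exponent_le (x := 1+u) (by linarith) (show -p ≤ 1 by linarith)
      simpa using this
    simp only [neg_zero, rpow_zero]
    nlinarith

def PhiF (p q : ℝ) (M : ℕ) (u : ℝ) : ℝ :=
  u^(p+q) * (1+u)^(M+2) * ((1 + u^(-(max p 0))) * (1 + u^(-(max q 0)))) * exp (-u)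

lemma PhiF_int {p q : ℝ} (hp : -(1/2) < p) (hq : -(1/2) < q) (M : ℕ) :
    IntegrableOn (PhiF p q M) (Ioi 0) := by
  have h1 := intg (γ := p+q) (δ := 1) (by linarith) one_pos (M+2)
  have h2 := intg (γ := p+q-max p 0) (δ := 1) (by rcases max_cases p 0 with h | h <;> linarith) one_pos (M+2)
  have h3 := intg (γ := p+q-max q 0) (δ := 1) (by rcases max_cases q 0 with h | h <;> linarith) one_pos (M+2)
  have h4 := intg (γ := p+q-max p 0-max q 0) (δ := 1)
    (by rcases max_cases p 0 with h | h <;> rcases max_cases q 0 with h' | h' <;> linarith) one_pos (M+2)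
  refine (((h1.add h2).add h3).add h4).congr_fun ?_ measurableSet_Ioi
  intro u hu
  have hu : 0 < u := hu
  simp only [PhiF, Pi.add_apply, one_mul]
  rw [rpow_sub hu, rpow_sub hu, rpow_sub hu, rpow_neg hu.le, rpow_neg hu.le]
  have e1 := (rpow_pos_of_pos hu (max p 0)).ne'
  have e2 := (rpow_pos_of_pos hu (max q 0)).ne'
  rw [rpow_sub hu]
  field_simp
  ring

lemma PhiF_nonneg (p q : ℝ) (M : ℕ) {u : ℝ} (hu : 0 < u) : 0 ≤ PhiF p q M u := by
  unfold PhiF; positivity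

def KC (α β t φ : ℝ) (s : ℝ) (z : ℂ) : ℂ :=
  Complex.exp (-2*s*DC t φ z) * (fC α (aC φ z * s) * fC β (bC φ z * s))

lemma aR_pos {θ φ : ℝ} (hθ : θ ∈ Ioo 0 π) (hφ : φ ∈ Ioo 0 π) : 0 < aR θ φ :=
  mul_pos (half_pos_trig hθ).1 (half_pos_trig hφ).1
lemma bR_pos {θ φ : ℝ} (hθ : θ ∈ Ioo 0 π) (hφ : φ ∈ Ioo 0 π) : 0 < bR θ φ :=
  mul_pos (half_pos_trig hθ).2 (half_pos_trig hφ).2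

lemma scale_id {p q D a b s : ℝ} (hD : 0 < D) (ha : 0 < a) (hb : 0 < b) (hs : 0 < s) :
    s^(p+q) * ((1+a/D)^(-p) * (1+b/D)^(-q)) = (D+a)^(-p) * (D+b)^(-q) * (s*D)^(p+q) := by
  rw [mul_rpow hs.le hD.le, show 1+a/D = (D+a)/D by field_simp, show 1+b/D = (D+b)/D by field_simp,
    div_rpow (by linarith) hD.le, div_rpow (by linarith) hD.le, rpow_add hD, rpow_neg hD.le, rpow_neg hD.le]
  have := (rpow_pos_of_pos hD p).ne'
  have := (rpow_pos_of_pos hD q).ne'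
  field_simp

set_option maxHeartbeats 1000000 in
lemma KC_bound {α β : ℝ} (hα : -1 < α) (hβ : -1 < β) : ∃ C : ℝ, ∃ M : ℕ, 0 ≤ C ∧
    ∀ t θ φ : ℝ, 0 < t → t ≤ 1 → θ ∈ Ioo 0 π → φ ∈ Ioo 0 π → ∀ z : ℂ,
      ‖z - θ‖ ≤ √(DR t θ φ) / 64 → ∀ s : ℝ, 0 < s →
      s^(α+β+1) * ‖KC α β t φ s z‖ ≤ C * ((DR t θ φ + aR θ φ)^(-(α+1/2)) *
        (DR t θ φ + bR θ φ)^(-(β+1/2))) * PhiF (α+1/2) (β+1/2) M (s * DR t θ φ) := by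
  obtain ⟨C1, M1, hC1, h1⟩ := fC_bound hα
  obtain ⟨C2, M2, hC2, h2⟩ := fC_bound hβ
  refine ⟨C1*C2, M1+M2, by positivity, ?_⟩
  intro t θ φ ht ht1 hθ hφ z hz s hs
  obtain ⟨gD, ga, gb⟩ := geom ht ht1 hθ hφ hz
  have hD := DR_pos ht θ φ
  have ha := aR_pos hθ hφ
  have hb := bR_pos hθ hφ
  set D := DR t θ φ
  set a := aR θ φ
  set b := bR θ φ
  set p := α + 1/2 with hp
  set q := β + 1/2 with hq
  have hpq : α+β+1 = p+q := by rw [hp, hq]; ring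
  set u := s*D with hu
  have hu0 : 0 < u := mul_pos hs hD
  have f1 : ‖fC α (aC φ z * s)‖ ≤ C1 * exp (u/4) * (1+u)^M1 * (1+s*a)^(-p) := by
    refine h1 (s*a) u _ (by positivity) hu0.le ?_
    have : aC φ z * s - ((s*a:ℝ):ℂ) = s * (aC φ z - a) := by push_cast; ring
    rw [this, norm_mul, Complex.norm_real, Real.norm_eq_abs, abs_of_pos hs, hu]
    nlinarith
  have f2 : ‖fC β (bC φ z * s)‖ ≤ C2 * exp (u/4) * (1+u)^M2 * (1+s*b)^(-q) := by
    refine h2 (s*b) u _ (by positivity) hu0.le ?_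
    have : bC φ z * s - ((s*b:ℝ):ℂ) = s * (bC φ z - b) := by push_cast; ring
    rw [this, norm_mul, Complex.norm_real, Real.norm_eq_abs, abs_of_pos hs, hu]
    nlinarith
  have f0 : ‖Complex.exp (-2*s*DC t φ z)‖ ≤ exp (-(3/2*u)) := by
    rw [Complex.norm_exp]
    refine exp_le_exp.2 ?_
    have e : (-2*s*DC t φ z).re = -2*s*(DC t φ z).re := by
      rw [show (-2*s*DC t φ z) = ((-2*s:ℝ):ℂ) * DC t φ z by push_cast; ring, Complex.re_ofReal_mul]
    rw [e]
    have h3 := (Complex.abs_re_le_norm (DC t φ z - D)).trans gD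
    rw [Complex.sub_re, Complex.ofReal_re] at h3
    have h4 := (abs_le.1 h3).1
    have : s*(3/4*D) ≤ s*(DC t φ z).re := by gcongr; linarith
    rw [hu]; nlinarith
  have g1 : (1+s*a)^(-p) ≤ (1+u)*(1+u^(-(max p 0)))*(1+a/D)^(-p) := by
    have := rpow_scale (p := p) (u := u) (y := a/D) (by rw [hp]; linarith) hu0 (by positivity)
    rwa [show u*(a/D) = s*a by rw [hu]; field_simp] at this
  have g2 : (1+s*b)^(-q) ≤ (1+u)*(1+u^(-(max q 0)))*(1+b/D)^(-q) := by
    have := rpow_scale (p := q) (u := u) (y := b/D) (by rw [hq]; linarith) hu0 (by positivity)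
    rwa [show u*(b/D) = s*b by rw [hu]; field_simp] at this
  have e3 : exp (-(3/2*u)) * (exp (u/4) * exp (u/4)) = exp (-u) := by
    rw [← exp_add, ← exp_add]; congr 1; ring
  unfold KC
  rw [norm_mul, norm_mul, hpq]
  calc s^(p+q) * (‖Complex.exp (-2*s*DC t φ z)‖ * (‖fC α (aC φ z * s)‖ * ‖fC β (bC φ z * s)‖))
      ≤ s^(p+q) * (exp (-(3/2*u)) * ((C1 * exp (u/4) * (1+u)^M1 * ((1+u)*(1+u^(-(max p 0)))*(1+a/D)^(-p))) *
        (C2 * exp (u/4) * (1+u)^M2 * ((1+u)*(1+u^(-(max q 0)))*(1+b/D)^(-q))))) := by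
        gcongr
        · exact f1.trans (by gcongr)
        · exact f2.trans (by gcongr)
    _ = C1*C2*(exp (-(3/2*u)) * (exp (u/4) * exp (u/4))) * (s^(p+q) * ((1+a/D)^(-p) * (1+b/D)^(-q))) *
        ((1+u)^(M1+M2+2) * ((1 + u^(-(max p 0))) * (1 + u^(-(max q 0))))) := by
        rw [pow_add, pow_add]; ring
    _ = _ := by
        rw [e3, scale_id hD ha hb hs]
        unfold PhiF
        ring

lemma holo_int {K : ℝ → ℂ → ℂ} (hK : Continuous (Function.uncurry fun (s : ℝ) z => K s z))
    (hd : ∀ s, Differentiable ℂ (K s)) {w : ℝ → ℂ} (hw : Measurable w) {B : ℝ → ℝ}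
    (hB : IntegrableOn B (Ioi 0)) {z0 : ℂ} {R : ℝ}
    (hb : ∀ z ∈ Metric.ball z0 R, ∀ s, 0 < s → ‖w s * K s z‖ ≤ B s) :
    DifferentiableOn ℂ (fun z => ∫ s in Ioi (0:ℝ), w s * K s z) (Metric.ball z0 R) := by
  intro z1 hz1
  refine DifferentiableAt.differentiableWithinAt ?_
  obtain ⟨ε, hε, hball⟩ := Metric.isOpen_iff.1 Metric.isOpen_ball z1 hz1
  have hcont : ∀ z, Continuous (fun s => K s z) := fun z =>
    hK.comp (Continuous.prodMk continuous_id continuous_const)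
  have hmeas : ∀ z, AEStronglyMeasurable (fun s => w s * K s z) (volume.restrict (Ioi 0)) := fun z =>
    (hw.mul (hcont z).measurable).aestronglyMeasurable
  have hmd : Measurable (fun s => deriv (K s) z1) := by
    have := measurable_deriv_with_param (𝕜 := ℂ) (f := K) hK
    exact this.comp (measurable_id.prodMk measurable_const)
  have := hasDerivAt_integral_of_dominated_loc_of_deriv_le (𝕜 := ℂ) (μ := volume.restrict (Ioi (0:ℝ)))
    (F := fun z s => w s * K s z) (F' := fun z s => w s * deriv (K s) z) (x₀ := z1)
    (s := Metric.ball z1 (ε/2)) (bound := fun s => B s / (ε/4))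
    (Metric.ball_mem_nhds _ (by positivity)) (Eventually.of_forall hmeas) ?_ ?_ ?_ ?_ ?_
  · exact this.2.differentiableAt
  · refine Integrable.mono' hB (hmeas z1) ?_
    exact (ae_restrict_iff' measurableSet_Ioi).2 (Eventually.of_forall fun s hs => hb z1 hz1 s hs)
  · exact (hw.mul hmd).aestronglyMeasurable
  · refine (ae_restrict_iff' measurableSet_Ioi).2 (Eventually.of_forall fun s hs z hz => ?_)
    have h1 : deriv (fun z => w s * K s z) z = w s * deriv (K s) z := by
      rw [deriv_const_mul]; exact (hd s) z
    rw [← h1]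
    refine Complex.norm_deriv_le_of_forall_mem_sphere_norm_le (by positivity)
      ((hd s).const_mul (w s)).diffContOnCl ?_
    intro y hy
    refine hb y (hball ?_) s hs
    have h2 := Metric.mem_ball.1 hz
    have h3 := Metric.mem_sphere.1 hy
    have h4 := dist_triangle y z z1
    exact Metric.mem_ball.2 (by linarith)
  · exact hB.div_const _
  · refine Eventually.of_forall fun s z _ => ?_
    exact ((hd s) z).hasDerivAt.const_mul (w s)

def FCi (α β t φ : ℝ) (z : ℂ) : ℂ :=
  ∫ s in Ioi (0:ℝ), ((s^(α+β+1) : ℝ) : ℂ) * KC α β t φ s z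

lemma KC_cont {α β : ℝ} (hα : -1 < α) (hβ : -1 < β) (t φ : ℝ) :
    Continuous (Function.uncurry fun (s : ℝ) z => KC α β t φ s z) := by
  have h1 := (fC_differentiable hα).continuous
  have h2 := (fC_differentiable hβ).continuous
  unfold KC aC bC DC Function.uncurry
  have c1 : Continuous (fun a : ℝ × ℂ => fC α (Complex.sin (a.2/2) * (sin (φ/2):ℝ) * (a.1:ℂ))) :=
    h1.comp (by fun_prop)
  have c2 : Continuous (fun a : ℝ × ℂ => fC β (Complex.cos (a.2/2) * (cos (φ/2):ℝ) * (a.1:ℂ))) :=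
    h2.comp (by fun_prop)
  exact Continuous.mul (by fun_prop) (c1.mul c2)

lemma KC_diff {α β : ℝ} (hα : -1 < α) (hβ : -1 < β) (t φ s : ℝ) :
    Differentiable ℂ (KC α β t φ s) := by
  have h1 := (fC_differentiable hα)
  have h2 := (fC_differentiable hβ)
  unfold KC aC bC DC
  have c1 : Differentiable ℂ (fun a : ℂ => fC α (Complex.sin (a/2) * (sin (φ/2):ℝ) * (s:ℂ))) :=
    h1.comp (by fun_prop)
  have c2 : Differentiable ℂ (fun a : ℂ => fC β (Complex.cos (a/2) * (cos (φ/2):ℝ) * (s:ℂ))) :=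
    h2.comp (by fun_prop)
  exact Differentiable.mul (by fun_prop) (c1.mul c2)

lemma KC_real (α β t φ s θ : ℝ) :
    ((s^(α+β+1) : ℝ) : ℂ) * KC α β t φ s θ =
      ((Wint α β (aR θ φ) (bR θ φ) (2*cosh (t/2)) s : ℝ) : ℂ) := by
  unfold KC Wint fC
  rw [aC_real, bC_real, DC_real]
  rw [show ((aR θ φ:ℝ):ℂ) * s = ((aR θ φ * s : ℝ):ℂ) by push_cast; rfl,
    show ((bR θ φ:ℝ):ℂ) * s = ((bR θ φ * s : ℝ):ℂ) by push_cast; rfl,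
    ← Complex.ofReal_pow, ← Complex.ofReal_pow, iotaC_ofReal, iotaC_ofReal, ← abD t θ φ]
  rw [show -(2*(aR θ φ + bR θ φ + DR t θ φ)*s) = (-2*s*DR t θ φ) + ((-2*(aR θ φ*s)) + (-2*(bR θ φ*s))) by ring,
    Real.exp_add, Real.exp_add]
  push_cast
  ring

lemma FCi_real {α β : ℝ} (hα : -1 < α) (hβ : -1 < β) {c : ℕ → ℝ} (hc : JacobiNormalized α β c)
    {t θ φ : ℝ} (ht : 0 < t) (hθ : θ ∈ Ioo 0 π) (hφ : φ ∈ Ioo 0 π) :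
    ((2 * sinh (t/2) : ℝ) : ℂ) * FCi α β t φ θ = (Htil α β c t θ φ : ℝ) := by
  rw [Htil_eq hα hβ hc ht hθ hφ]
  unfold FCi
  simp_rw [KC_real]
  rw [integral_complex_ofReal]
  push_cast
  rfl

lemma FCi_bound {α β : ℝ} (hα : -1 < α) (hβ : -1 < β) : ∃ C : ℝ, 0 ≤ C ∧
    ∀ t θ φ : ℝ, 0 < t → t ≤ 1 → θ ∈ Ioo 0 π → φ ∈ Ioo 0 π →
      DifferentiableOn ℂ (FCi α β t φ) (Metric.ball (θ:ℂ) (√(DR t θ φ)/64)) ∧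
      ∀ z ∈ Metric.ball (θ:ℂ) (√(DR t θ φ)/64), ‖FCi α β t φ z‖ ≤
        C * ((DR t θ φ + aR θ φ)^(-(α+1/2)) * (DR t θ φ + bR θ φ)^(-(β+1/2))) / DR t θ φ := by
  obtain ⟨C, M, hC, hK⟩ := KC_bound hα hβ
  have hI := PhiF_int (p := α+1/2) (q := β+1/2) (by linarith) (by linarith) M
  have hI0 : 0 ≤ ∫ u in Ioi (0:ℝ), PhiF (α+1/2) (β+1/2) M u :=
    setIntegral_nonneg measurableSet_Ioi fun u hu => PhiF_nonneg _ _ _ hu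
  refine ⟨C * ∫ u in Ioi (0:ℝ), PhiF (α+1/2) (β+1/2) M u, by positivity, ?_⟩
  intro t θ φ ht ht1 hθ hφ
  have hD := DR_pos ht θ φ
  have hK1 := hK t θ φ ht ht1 hθ hφ
  set D := DR t θ φ
  set E := (D + aR θ φ)^(-(α+1/2)) * (D + bR θ φ)^(-(β+1/2)) with hE
  have hBi : IntegrableOn (fun s => C * E * PhiF (α+1/2) (β+1/2) M (s * D)) (Ioi 0) := by
    refine Integrable.const_mul ?_ _
    refine (integrableOn_Ioi_comp_mul_right_iff _ 0 hD).2 ?_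
    simpa using hI
  have hb : ∀ z ∈ Metric.ball (θ:ℂ) (√D/64), ∀ s, 0 < s →
      ‖((s^(α+β+1) : ℝ) : ℂ) * KC α β t φ s z‖ ≤ C * E * PhiF (α+1/2) (β+1/2) M (s * D) := by
    intro z hz s hs
    have := hK1 z (by rw [← dist_eq_norm]; exact (Metric.mem_ball.1 hz).le) s hs
    rw [norm_mul, Complex.norm_real, Real.norm_eq_abs, abs_of_nonneg (by positivity)]
    exact this
  refine ⟨holo_int (KC_cont hα hβ t φ) (KC_diff hα hβ t φ) (by fun_prop) hBi hb, ?_⟩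
  intro z hz
  unfold FCi
  have := norm_integral_le_of_norm_le hBi (f := fun s => ((s^(α+β+1) : ℝ) : ℂ) * KC α β t φ s z)
    ((ae_restrict_iff' measurableSet_Ioi).2 (Eventually.of_forall fun s hs => hb z hz s hs))
  refine this.trans (le_of_eq ?_)
  rw [integral_const_mul, integral_comp_mul_right_Ioi _ _ hD, zero_mul, smul_eq_mul]
  field_simp

lemma iter_link (j : ℕ) : ∀ {F : ℂ → ℂ} {f : ℝ → ℝ} {U : Set ℂ} {V : Set ℝ}, IsOpen U → IsOpen V →
    DifferentiableOn ℂ F U → (∀ x ∈ V, (x:ℂ) ∈ U) → (∀ x ∈ V, F x = (f x : ℂ)) →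
    ∀ x ∈ V, iteratedDeriv j F (x:ℂ) = ((iteratedDeriv j f x : ℝ) : ℂ) := by
  induction j with
  | zero => intro F f U V hU hV hd hUV hf x hx; simpa using hf x hx
  | succ j ih =>
    intro F f U V hU hV hd hUV hf x hx
    rw [iteratedDeriv_succ', iteratedDeriv_succ']
    refine ih hU hV (hd.deriv hU) hUV ?_ x hx
    intro y hy
    have h1 : HasDerivAt F (deriv F y) (y:ℂ) :=
      ((hd y (hUV y hy)).differentiableAt (hU.mem_nhds (hUV y hy))).hasDerivAt
    have h2 := h1.comp_ofReal
    have h3 := h1.real_of_complex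
    have ev : ∀ᶠ u in nhds y, F (u:ℝ) = (f u : ℂ) := by
      filter_upwards [hV.mem_nhds hy] with u hu using hf u hu
    have h4 : HasDerivAt f (deriv F y).re y := by
      refine h3.congr_of_eventuallyEq ?_
      filter_upwards [ev] with u hu
      rw [hu]; rfl
    have h5 := h4.ofReal_comp
    have h6 : HasDerivAt (fun u : ℝ => F u) (((deriv F y).re : ℝ) : ℂ) y := h5.congr_of_eventuallyEq ev
    rw [h4.deriv]
    exact h2.unique h6

lemma sinh_half_le {t : ℝ} (ht : 0 < t) (ht1 : t ≤ 1) : 2 * sinh (t/2) ≤ 2 * t := by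
  have h1 : exp (t/2) ≤ 1 + t := by
    have := Real.exp_bound_div_one_sub_of_interval (x := t/2) (by linarith) (by linarith)
    refine this.trans ?_
    rw [div_le_iff₀ (by linarith)]; nlinarith
  have h2 : 1 - t/2 ≤ exp (-(t/2)) := by
    have := Real.add_one_le_exp (-(t/2)); linarith
  rw [Real.sinh_eq]; linarith

set_option maxHeartbeats 1000000 in
lemma Htil_small {α β : ℝ} (hα : -1 < α) (hβ : -1 < β) {c : ℕ → ℝ} (hc : JacobiNormalized α β c)
    (j : ℕ) : ∃ C : ℝ, 0 ≤ C ∧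
    ∀ t θ φ : ℝ, 0 < t → t ≤ 1 → θ ∈ Ioo 0 π → φ ∈ Ioo 0 π →
      |iteratedDeriv j (fun θ' => Htil α β c t θ' φ) θ| ≤
        C * ((DR t θ φ + aR θ φ)^(-(α+1/2)) * (DR t θ φ + bR θ φ)^(-(β+1/2))) *
          (t / (DR t θ φ)^((1:ℝ)+(j:ℝ)/2)) := by
  obtain ⟨C, hC, hF⟩ := FCi_bound hα hβ
  refine ⟨j.factorial * 128^j * 2 * C, by positivity, ?_⟩
  intro t θ φ ht ht1 hθ hφ
  have hD := DR_pos ht θ φ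
  have ha := aR_pos hθ hφ
  have hb := bR_pos hθ hφ
  obtain ⟨hd, hbd⟩ := hF t θ φ ht ht1 hθ hφ
  set D := DR t θ φ
  set E := (D + aR θ φ)^(-(α+1/2)) * (D + bR θ φ)^(-(β+1/2)) with hE
  have hE0 : 0 ≤ E := by positivity
  have hsD : 0 < √D := Real.sqrt_pos.2 hD
  set G : ℂ → ℂ := fun z => ((2 * sinh (t/2) : ℝ) : ℂ) * FCi α β t φ z with hG
  have hGd : DifferentiableOn ℂ G (Metric.ball (θ:ℂ) (√D/64)) := hd.const_mul _
  have hsh0 : 0 < sinh (t/2) := Real.sinh_pos_iff.2 (by linarith)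
  have hsh := sinh_half_le ht ht1
  have hGb : ∀ z ∈ Metric.ball (θ:ℂ) (√D/64), ‖G z‖ ≤ 2*t*(C*E/D) := by
    intro z hz
    rw [hG]; simp only
    rw [norm_mul, Complex.norm_real, Real.norm_eq_abs, abs_of_pos (by positivity)]
    have := hbd z hz
    gcongr
  have hlink := iter_link j (F := G) (f := fun θ' => Htil α β c t θ' φ)
    (U := Metric.ball (θ:ℂ) (√D/64)) (V := Metric.ball θ (√D/64) ∩ Ioo 0 π) Metric.isOpen_ball
    (Metric.isOpen_ball.inter isOpen_Ioo) hGd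
    (by
      intro x hx
      have := Metric.mem_ball.1 hx.1
      refine Metric.mem_ball.2 ?_
      rw [dist_eq_norm, ← Complex.ofReal_sub, Complex.norm_real, ← dist_eq_norm]
      exact this)
    (by
      intro x hx
      exact FCi_real hα hβ hc ht hx.2 hφ) θ ⟨Metric.mem_ball_self (by positivity), hθ⟩
  have hR : 0 < √D/128 := by positivity
  have hsub : Metric.closedBall (θ:ℂ) (√D/128) ⊆ Metric.ball (θ:ℂ) (√D/64) :=
    Metric.closedBall_subset_ball (by linarith)
  have hcau := Complex.norm_iteratedDeriv_le_of_forall_mem_sphere_norm_le j hR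
    (f := G) (c := (θ:ℂ)) (C := 2*t*(C*E/D))
    ((hGd.mono hsub).diffContOnCl_ball subset_rfl)
    (fun z hz => hGb z (hsub (Metric.sphere_subset_closedBall hz)))
  rw [hlink, Complex.norm_real, Real.norm_eq_abs] at hcau
  refine hcau.trans (le_of_eq ?_)
  rw [rpow_add hD, rpow_one]
  have e : D^((j:ℝ)/2) = √D^j := by
    rw [Real.sqrt_eq_rpow, ← Real.rpow_natCast, ← Real.rpow_mul hD.le]; congr 1; ring
  rw [e, div_pow]
  field_simp

lemma cosh_low {t : ℝ} (ht : 0 < t) : t^2/8 ≤ cosh (t/2) - 1 := by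
  have h1 : cosh (t/2) = 1 + 2*sinh (t/4)^2 := by
    rw [show t/2 = 2*(t/4) by ring, Real.cosh_two_mul, Real.cosh_sq]; ring
  have h2 := Real.self_le_sinh_iff.2 (show 0 ≤ t/4 by linarith)
  have : (t/4)^2 ≤ sinh (t/4)^2 := by gcongr
  linarith

lemma cosh_up {t : ℝ} (ht : 0 < t) (ht1 : t ≤ 1) : cosh (t/2) - 1 ≤ t^2 := by
  have h1 : cosh (t/2) = 1 + 2*sinh (t/4)^2 := by
    rw [show t/2 = 2*(t/4) by ring, Real.cosh_two_mul, Real.cosh_sq]; ring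
  have h2 := sinh_half_le (t := t/2) (by linarith) (by linarith)
  rw [show t/2/2 = t/4 by ring] at h2
  have h0 : 0 ≤ sinh (t/4) := Real.sinh_nonneg_iff.2 (by linarith)
  have : sinh (t/4)^2 ≤ (t/2)^2 := by gcongr; linarith
  nlinarith

lemma cos_low {x : ℝ} (hx : |x| ≤ π) : x^2/5 ≤ 1 - cos x := by
  have h := Real.cos_le_one_sub_mul_cos_sq hx
  have : π^2 ≤ 10 := by nlinarith [Real.pi_lt_d2, Real.pi_pos]
  have h2 : 1/5 ≤ 2/π^2 := by
    rw [div_le_div_iff₀ (by norm_num) (by positivity)]; linarith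
  nlinarith [sq_nonneg x]

lemma D_low {t θ φ : ℝ} (ht : 0 < t) (hθ : θ ∈ Ioo 0 π) (hφ : φ ∈ Ioo 0 π) :
    (t^2 + (θ-φ)^2)/20 ≤ DR t θ φ := by
  have h1 := cosh_low ht
  have h2 := cos_low (x := (θ-φ)/2) (by
    rw [abs_le]; constructor <;> linarith [hθ.1, hθ.2, hφ.1, hφ.2])
  unfold DR
  nlinarith [sq_nonneg t, sq_nonneg (θ-φ)]

lemma b_comp {t θ φ : ℝ} (ht : 0 < t) (ht1 : t ≤ 1) (hθ : θ ∈ Ioo 0 π) (hφ : φ ∈ Ioo 0 π) :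
    (t^2 + θ^2 + φ^2)/40 ≤ cosh (t/2) - bR θ φ ∧ cosh (t/2) - bR θ φ ≤ t^2 + θ^2 + φ^2 := by
  have h1 := cosh_low ht
  have h1' := cosh_up ht ht1
  have c1 := (half_pos_trig hθ).2
  have c2 := (half_pos_trig hφ).2
  have l1 := cos_low (x := θ/2) (by rw [abs_le]; constructor <;> linarith [hθ.1, hθ.2])
  have l2 := cos_low (x := φ/2) (by rw [abs_le]; constructor <;> linarith [hφ.1, hφ.2])
  have u1 := Real.one_sub_sq_div_two_le_cos (x := θ/2)
  have u2 := Real.one_sub_sq_div_two_le_cos (x := φ/2)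
  have m1 := cos_le_one (θ/2)
  have m2 := cos_le_one (φ/2)
  have b1 : bR θ φ ≤ cos (φ/2) := mul_le_of_le_one_left c2.le m1
  have b2 : bR θ φ ≤ cos (θ/2) := mul_le_of_le_one_right c1.le m2
  have b3 : cos (θ/2) + cos (φ/2) - 1 ≤ bR θ φ := by unfold bR; nlinarith
  constructor <;> nlinarith [sq_nonneg t, sq_nonneg θ, sq_nonneg φ]

lemma a_eq (θ φ : ℝ) : aR θ φ = bR (π-θ) (π-φ) := by
  unfold aR bR
  rw [show (π-θ)/2 = π/2 - θ/2 by ring, show (π-φ)/2 = π/2 - φ/2 by ring, cos_pi_div_two_sub,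
    cos_pi_div_two_sub]

lemma rpow_comp {X Y : ℝ} (r : ℝ) (hX : 0 < X) (h1 : X/40 ≤ Y) (h2 : Y ≤ X) :
    Y^r ≤ (1 + 40^(-r)) * X^r := by
  have hX' := rpow_pos_of_pos hX r
  have h40 : (0:ℝ) < 40^(-r) := by positivity
  rcases le_or_gt 0 r with h | h
  · have := rpow_le_rpow (by linarith [show 0 < X/40 by positivity]) h2 h
    nlinarith
  · have := rpow_le_rpow_of_nonpos (show 0 < X/40 by positivity) h1 h.le
    rw [div_rpow hX.le (by norm_num), div_eq_mul_inv, ← rpow_neg (by norm_num)] at this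
    nlinarith

/-- The right-hand side of the small-time estimate, without the constant. -/
def RHS (α β : ℝ) (j : ℕ) (t θ φ : ℝ) : ℝ :=
  (t^2 + θ^2 + φ^2) ^ (-α - 1/2) * (t^2 + (π - θ)^2 + (π - φ)^2) ^ (-β - 1/2) *
    (t / (t^2 + (θ - φ)^2) ^ ((1:ℝ) + (j:ℝ)/2))

lemma RHS_nonneg (α β : ℝ) (j : ℕ) {t : ℝ} (ht : 0 < t) (θ φ : ℝ) : 0 ≤ RHS α β j t θ φ := by
  unfold RHS; positivity

lemma Htil_small2 {α β : ℝ} (hα : -1 < α) (hβ : -1 < β) {c : ℕ → ℝ} (hc : JacobiNormalized α β c)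
    (j : ℕ) : ∃ C : ℝ, 0 ≤ C ∧
    ∀ t θ φ : ℝ, 0 < t → t ≤ 1 → θ ∈ Ioo 0 π → φ ∈ Ioo 0 π →
      |iteratedDeriv j (fun θ' => Htil α β c t θ' φ) θ| ≤ C * RHS α β j t θ φ := by
  obtain ⟨C, hC, h⟩ := Htil_small hα hβ hc j
  refine ⟨C * ((1+40^(-(-α-1/2))) * (1+40^(-(-β-1/2)))) * 20^((1:ℝ)+(j:ℝ)/2), by positivity, ?_⟩
  intro t θ φ ht ht1 hθ hφ
  have hθ' : π - θ ∈ Ioo 0 π := ⟨by linarith [hθ.2], by linarith [hθ.1]⟩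
  have hφ' : π - φ ∈ Ioo 0 π := ⟨by linarith [hφ.2], by linarith [hφ.1]⟩
  have hD := DR_pos ht θ φ
  have key := abD t θ φ
  refine (h t θ φ ht ht1 hθ hφ).trans ?_
  obtain ⟨x1, x2⟩ := b_comp ht ht1 hθ hφ
  obtain ⟨y1, y2⟩ := b_comp ht ht1 hθ' hφ'
  rw [← a_eq] at y1 y2
  rw [show cosh (t/2) - bR θ φ = DR t θ φ + aR θ φ by linarith] at x1 x2
  rw [show cosh (t/2) - aR θ φ = DR t θ φ + bR θ φ by linarith] at y1 y2
  have r1 := rpow_comp (-α-1/2) (by positivity) x1 x2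
  have r2 := rpow_comp (-β-1/2) (by positivity) y1 y2
  have dl := D_low ht hθ hφ
  have hX : 0 < t^2 + (θ-φ)^2 := by positivity
  have r3 : t / (DR t θ φ)^((1:ℝ)+(j:ℝ)/2) ≤
      20^((1:ℝ)+(j:ℝ)/2) * (t / (t^2 + (θ-φ)^2)^((1:ℝ)+(j:ℝ)/2)) := by
    have := rpow_le_rpow (by positivity) dl (show (0:ℝ) ≤ 1+(j:ℝ)/2 by positivity)
    rw [div_rpow hX.le (by norm_num)] at this
    calc _ ≤ t / ((t^2 + (θ-φ)^2)^((1:ℝ)+(j:ℝ)/2) / 20^((1:ℝ)+(j:ℝ)/2)) := by gcongr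
      _ = _ := by field_simp
  rw [show -(α+1/2) = -α-1/2 by ring, show -(β+1/2) = -β-1/2 by ring]
  have ha := aR_pos hθ hφ
  have hb := bR_pos hθ hφ
  calc _ ≤ C * (((1+40^(-(-α-1/2))) * (t^2+θ^2+φ^2)^(-α-1/2)) *
        ((1+40^(-(-β-1/2))) * (t^2+(π-θ)^2+(π-φ)^2)^(-β-1/2))) *
        (20^((1:ℝ)+(j:ℝ)/2) * (t / (t^2 + (θ-φ)^2)^((1:ℝ)+(j:ℝ)/2))) := by gcongr
    _ = _ := by unfold RHS; ring

lemma rpow_lower {X X1 r : ℝ} (hr : r < 1/2) (h1 : 0 < X1) (h2 : X1 ≤ X) (h3 : X ≤ 21) :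
    21^(r-1/2) * X1^((1:ℝ)/2) ≤ X^r := by
  have hX : 0 < X := by linarith
  have e : X^r = X^(r-1/2) * X^((1:ℝ)/2) := by rw [← rpow_add hX]; congr 1; ring
  rw [e]
  have := rpow_le_rpow_of_nonpos hX h3 (show r-1/2 ≤ 0 by linarith)
  have := rpow_le_rpow h1.le h2 (show (0:ℝ) ≤ 1/2 by norm_num)
  gcongr

lemma RHS_lower {α β : ℝ} (hα : -1 < α) (hβ : -1 < β) {t θ φ : ℝ} (ht : 0 < t) (ht1 : t ≤ 1)
    (hθ : θ ∈ Ioo 0 π) (hφ : φ ∈ Ioo 0 π) :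
    21^((-α-1/2)-1/2) * 21^((-β-1/2)-1/2) * t ≤ RHS α β 0 t θ φ := by
  have hπ : π^2 ≤ 10 := by nlinarith [Real.pi_lt_d2, Real.pi_pos]
  have a1 := hθ.1
  have a2 := hθ.2
  have b1 := hφ.1
  have b2 := hφ.2
  have hX1 : 0 < t^2 + (θ-φ)^2 := by positivity
  have sqb : ∀ x, 0 < x → x < π → x^2 ≤ 10 := fun x h1 h2 => by nlinarith
  have t2 : t^2 ≤ 1 := by nlinarith
  have q1 := rpow_lower (X := t^2+θ^2+φ^2) (X1 := t^2 + (θ-φ)^2) (r := -α-1/2) (by linarith) hX1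
    (by nlinarith [mul_pos a1 b1]) (by linarith [sqb θ a1 a2, sqb φ b1 b2])
  have q2 := rpow_lower (X := t^2+(π-θ)^2+(π-φ)^2) (X1 := t^2 + (θ-φ)^2) (r := -β-1/2) (by linarith) hX1
    (by nlinarith [mul_pos (sub_pos.2 a2) (sub_pos.2 b2)])
    (by linarith [sqb (π-θ) (by linarith) (by linarith), sqb (π-φ) (by linarith) (by linarith)])
  have e : (t^2 + (θ-φ)^2)^((1:ℝ)/2) * (t^2 + (θ-φ)^2)^((1:ℝ)/2) = t^2 + (θ-φ)^2 := by
    rw [← rpow_add hX1]; norm_num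
  unfold RHS
  calc _ = (21^((-α-1/2)-1/2) * (t^2 + (θ-φ)^2)^((1:ℝ)/2)) * (21^((-β-1/2)-1/2) * (t^2 + (θ-φ)^2)^((1:ℝ)/2)) *
        (t / (t^2 + (θ-φ)^2)^((1:ℝ)+((0:ℕ):ℝ)/2)) := by
        simp only [Nat.cast_zero, zero_div, add_zero, rpow_one]
        rw [show ∀ A B Z W : ℝ, A*Z*(B*Z)*W = A*B*((Z*Z)*W) by intros; ring, e]
        field_simp
    _ ≤ _ := by gcongr

lemma tau_gap {τ t : ℝ} (hτ : -(1/2) < τ) (ht : 0 < t) (ht1 : t ≤ 1) :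
    |exp (-t*|τ|) - exp (-t*τ)| ≤ 2*t := by
  rcases le_or_gt 0 τ with h | h
  · rw [abs_of_nonneg h]; simp; linarith
  · rw [abs_of_neg h, abs_sub_comm]
    have h1 : exp (-t*τ) - exp (-t * -τ) = 2*sinh (-t*τ) := by
      rw [Real.sinh_eq, show -t * -τ = -(-t*τ) by ring]; ring
    have h2 : sinh (-t*τ) ≤ sinh (t/2) := Real.sinh_le_sinh.2 (by nlinarith)
    have h0 : 0 ≤ sinh (-t*τ) := Real.sinh_nonneg_iff.2 (by nlinarith)
    rw [h1, abs_of_nonneg (by linarith)]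
    linarith [sinh_half_le ht ht1]

lemma poisson_iter {α β : ℝ} (hα : -1 < α) (hβ : -1 < β) {c : ℕ → ℝ} (hc : JacobiNormalized α β c)
    {t θ φ : ℝ} (ht : 0 < t) (hθ : θ ∈ Ioo 0 π) (hφ : φ ∈ Ioo 0 π) {j : ℕ} (hj : 0 < j) :
    iteratedDeriv j (fun θ' => poissonKer α β c t θ' φ) θ =
      iteratedDeriv j (fun θ' => Htil α β c t θ' φ) θ := by
  have : (fun θ' => poissonKer α β c t θ' φ) =ᶠ[nhds θ] fun θ' =>
      (exp (-t * |jacobiTau α β|) - exp (-t * jacobiTau α β)) * c 0 ^ 2 + Htil α β c t θ' φ := by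
    filter_upwards [isOpen_Ioo.mem_nhds hθ] with x hx
    rw [poisson_eq hα hβ hc ht hx hφ]; ring
  rw [this.iteratedDeriv_eq, iteratedDeriv_const_add hj]

lemma tau_gt {α β : ℝ} (hα : -1 < α) (hβ : -1 < β) : -(1/2) < jacobiTau α β := by
  unfold jacobiTau; linarith

lemma small_part {α β : ℝ} (hα : -1 < α) (hβ : -1 < β) {c : ℕ → ℝ} (hc : JacobiNormalized α β c)
    (j : ℕ) : ∃ C : ℝ, ∀ t θ φ : ℝ, 0 < t → t ≤ 1 → θ ∈ Ioo 0 π → φ ∈ Ioo 0 π →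
      |iteratedDeriv j (fun θ' => poissonKer α β c t θ' φ) θ| ≤ C * RHS α β j t θ φ := by
  obtain ⟨C, hC, h⟩ := Htil_small2 hα hβ hc j
  rcases Nat.eq_zero_or_pos j with rfl | hj
  · set k : ℝ := 21^((-α-1/2)-1/2) * 21^((-β-1/2)-1/2) with hk
    have hk0 : 0 < k := by positivity
    refine ⟨C + 2 * c 0^2 / k, ?_⟩
    intro t θ φ ht ht1 hθ hφ
    have h1 := h t θ φ ht ht1 hθ hφ
    simp only [iteratedDeriv_zero] at h1 ⊢
    rw [poisson_eq hα hβ hc ht hθ hφ]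
    have h2 := tau_gap (tau_gt hα hβ) ht ht1
    have h3 : k * t ≤ _ := RHS_lower hα hβ ht ht1 hθ hφ
    have h4 : |(exp (-t * |jacobiTau α β|) - exp (-t * jacobiTau α β)) * c 0 ^ 2| ≤
        2 * c 0^2 / k * RHS α β 0 t θ φ := by
      rw [abs_mul, abs_of_nonneg (sq_nonneg (c 0))]
      calc _ ≤ 2*t*c 0^2 := by gcongr
        _ = 2 * c 0^2/k * (k*t) := by field_simp
        _ ≤ _ := by gcongr
    rw [add_mul]
    exact (abs_add_le _ _).trans (add_le_add h1 h4)
  · refine ⟨C, fun t θ φ ht ht1 hθ hφ => ?_⟩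
    rw [poisson_iter hα hβ hc ht hθ hφ hj]
    exact h t θ φ ht ht1 hθ hφ

lemma rpow_two_side {X : ℝ} (r : ℝ) (h1 : 1/4 ≤ X) (h2 : X ≤ 21) : X^r ≤ (1/4)^r + 21^r := by
  have a1 : (0:ℝ) ≤ (1/4)^r := by positivity
  have a2 : (0:ℝ) ≤ 21^r := by positivity
  rcases le_or_gt 0 r with h | h
  · have := rpow_le_rpow (by linarith) h2 h
    linarith
  · have := rpow_le_rpow_of_nonpos (by norm_num) h1 h.le
    linarith

lemma nJ_sup {α β : ℝ} (hα : -1 < α) (hβ : -1 < β) {c : ℕ → ℝ} (hc : JacobiNormalized α β c) :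
    ∃ S : ℝ, 0 ≤ S ∧ ∀ (n : ℕ), ∀ θ ∈ Ioo 0 π, |nJacobi α β c n θ| ≤ S * exp ((n:ℝ)/4) := by
  obtain ⟨C, hC, h⟩ := Htil_small2 hα hβ hc 0
  set Q : ℝ := C * (((1/4)^(-α-1/2) + 21^(-α-1/2)) * ((1/4)^(-β-1/2) + 21^(-β-1/2)) * 2) with hQ
  have hQ0 : 0 ≤ Q := by positivity
  refine ⟨√(Q * exp (jacobiTau α β/2)), by positivity, ?_⟩
  intro n θ hθ
  have hπ : π^2 ≤ 10 := by nlinarith [Real.pi_lt_d2, Real.pi_pos]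
  have a1 := hθ.1
  have a2 := hθ.2
  have sqb : ∀ x, 0 < x → x < π → x^2 ≤ 10 := fun x h1 h2 => by nlinarith
  have h1 := h (1/2) θ θ (by norm_num) (by norm_num) hθ hθ
  simp only [iteratedDeriv_zero] at h1
  have h2 : RHS α β 0 (1/2) θ θ ≤ ((1/4)^(-α-1/2) + 21^(-α-1/2)) * ((1/4)^(-β-1/2) + 21^(-β-1/2)) * 2 := by
    unfold RHS
    have q1 := rpow_two_side (X := (1/2)^2+θ^2+θ^2) (-α-1/2) (by nlinarith) (by linarith [sqb θ a1 a2])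
    have q2 := rpow_two_side (X := (1/2)^2+(π-θ)^2+(π-θ)^2) (-β-1/2) (by nlinarith)
      (by linarith [sqb (π-θ) (by linarith) (by linarith)])
    have q3 : (1/2:ℝ) / ((1/2)^2 + (θ-θ)^2)^((1:ℝ)+((0:ℕ):ℝ)/2) = 2 := by
      simp only [sub_self, Nat.cast_zero, zero_div, add_zero, rpow_one]; norm_num
    rw [q3]
    gcongr
  have h3 : Htil α β c (1/2) θ θ ≤ Q := by
    refine (le_abs_self _).trans (h1.trans ?_)
    rw [hQ]; gcongr
  have hs := Htil_summable hc (t := 1/2) (by norm_num) hθ hθ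
  have h4 : exp (-(1/2)*((n:ℝ)+jacobiTau α β))*nJacobi α β c n θ*nJacobi α β c n θ ≤ Htil α β c (1/2) θ θ := by
    refine hs.le_tsum n fun i _ => ?_
    rw [mul_assoc]
    exact mul_nonneg (exp_pos _).le (mul_self_nonneg _)
  refine abs_le_of_sq_le_sq ?_ (by positivity)
  rw [mul_pow, sq_sqrt (by positivity), ← exp_nat_mul]
  have h5 := h4.trans h3
  have e1 : exp (-(1/2)*((n:ℝ)+jacobiTau α β)) * (exp (jacobiTau α β/2) * exp ((2:ℕ)*((n:ℝ)/4))) = 1 := by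
    rw [← exp_add, ← exp_add, Real.exp_eq_one_iff]; push_cast; ring
  have e2 : 0 < exp (jacobiTau α β/2) * exp ((2:ℕ)*((n:ℝ)/4)) := by positivity
  calc nJacobi α β c n θ^2 = (exp (-(1/2)*((n:ℝ)+jacobiTau α β))*nJacobi α β c n θ*nJacobi α β c n θ) *
        (exp (jacobiTau α β/2) * exp ((2:ℕ)*((n:ℝ)/4))) := by
        linear_combination (-(nJacobi α β c n θ^2)) * e1
    _ ≤ Q * (exp (jacobiTau α β/2) * exp ((2:ℕ)*((n:ℝ)/4))) := by gcongr
    _ = _ := by ring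

open Polynomial in
lemma nJ_poly (α β : ℝ) (c : ℕ → ℝ) (n : ℕ) (A : ℝ) : ∃ f : ℝ[X], f.natDegree ≤ n ∧
    ∀ θ, A * nJacobi α β c n θ = f.eval (Real.cos θ) := by
  refine ⟨C (A * c n) * (jP α β n).comp (C (1/2) * (1 - X)), ?_, ?_⟩
  · refine (natDegree_C_mul_le _ _).trans (natDegree_comp_le.trans ?_)
    have h1 := jP_natDegree_le α β n
    have h2 : (C (1/2:ℝ) * (1 - X)).natDegree ≤ 1 := by
      refine (natDegree_C_mul_le _ _).trans ?_
      refine (natDegree_sub_le _ _).trans (by simp)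
    calc _ ≤ n * 1 := Nat.mul_le_mul h1 h2
      _ = n := mul_one n
  · intro θ
    unfold nJacobi
    rw [jacobiPoly_eq]
    simp only [eval_mul, eval_C, eval_comp, eval_sub, eval_one, eval_X]
    rw [show 1/2 * (1 - Real.cos θ) = (1 - Real.cos θ)/2 by ring]; ring

lemma w_summable (k : ℕ) : Summable (fun n : ℕ => exp (-((n:ℝ)/2)) * ((n+1)*(n:ℝ)^k)) := by
  have hr : ‖exp (-(1/2:ℝ))‖ < 1 := by
    rw [Real.norm_eq_abs, abs_of_pos (exp_pos _), Real.exp_lt_one_iff]; norm_num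
  have h1 := summable_pow_mul_geometric_of_norm_lt_one (k+1) hr
  have h2 := summable_pow_mul_geometric_of_norm_lt_one k hr
  refine (h1.add h2).congr fun n => ?_
  rw [← exp_nat_mul, show (n:ℝ) * -(1/2) = -((n:ℝ)/2) by ring]; ring

set_option maxHeartbeats 1000000 in
lemma large_part {α β : ℝ} (hα : -1 < α) (hβ : -1 < β) {c : ℕ → ℝ} (hc : JacobiNormalized α β c)
    (j : ℕ) : ∃ Q : ℝ, 0 ≤ Q ∧ ∀ t θ φ : ℝ, 1 ≤ t → φ ∈ Ioo 0 π →
      |iteratedDeriv j (fun θ' => poissonKer α β c t θ' φ) θ| ≤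
        ((if j = 0 then exp (-t*|jacobiTau α β|) else 0) + exp (-((t-1)/2))) * Q := by
  obtain ⟨S, hS, hsup⟩ := nJ_sup hα hβ hc
  have hτ := tau_gt hα hβ
  set τ := jacobiTau α β with hτd
  set Q0 : ℝ := exp (1/2) * S * S * π with hQ0
  have hQ0p : 0 ≤ Q0 := by positivity
  refine ⟨Q0 * ∑' n : ℕ, exp (-((n:ℝ)/2)) * ((n+1)*(n:ℝ)^j),
    mul_nonneg hQ0p (tsum_nonneg fun n => by positivity), ?_⟩
  intro t θ φ ht hφ
  choose f hf1 hf2 using fun n : ℕ => nJ_poly α β c n (exp (-t*|(n:ℝ)+τ|) * nJacobi α β c n φ)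
  have hH : (fun θ' => poissonKer α β c t θ' φ) = fun θ' => ∑' n, (f n).eval (Real.cos θ') := by
    funext x
    unfold poissonKer
    refine tsum_congr fun n => ?_
    rw [← hf2]; ring
  -- termwise bound
  have hterm : ∀ (n k : ℕ) (x : ℝ), |iteratedDeriv k (fun θ' => (f n).eval (Real.cos θ')) x| ≤
      exp (-t*|(n:ℝ)+τ|) * exp ((n:ℝ)/2) * (S*S*π) * ((n+1)*(n:ℝ)^k) := by
    intro n k x
    have := jac_bernstein (f n) n (hf1 n) (exp (-t*|(n:ℝ)+τ|) * (S*exp ((n:ℝ)/4)) * (S*exp ((n:ℝ)/4))) (by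
      intro y hy
      rw [← hf2, abs_mul, abs_mul, abs_of_pos (exp_pos _)]
      gcongr
      · exact hsup n φ hφ
      · exact hsup n y hy) k x
    refine this.trans (le_of_eq ?_)
    have e : exp ((n:ℝ)/2) = exp ((n:ℝ)/4) * exp ((n:ℝ)/4) := by rw [← exp_add]; congr 1; ring
    rw [e]; ring
  have hexp1 : ∀ n : ℕ, exp (-t*|(n:ℝ)+τ|) * exp ((n:ℝ)/2) ≤ exp (1/2) * exp (-((n:ℝ)/2)) := by
    intro n
    rw [← exp_add, ← exp_add]
    refine exp_le_exp.2 ?_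
    have h1 := le_abs_self ((n:ℝ)+τ)
    have h2 := abs_nonneg ((n:ℝ)+τ)
    nlinarith
  have hexp2 : ∀ n : ℕ, 1 ≤ n → exp (-t*|(n:ℝ)+τ|) * exp ((n:ℝ)/2) ≤
      exp (-((t-1)/2)) * (exp (1/2) * exp (-((n:ℝ)/2))) := by
    intro n hn
    have hn' : (1:ℝ) ≤ n := by exact_mod_cast hn
    rw [← exp_add, ← exp_add, ← exp_add]
    refine exp_le_exp.2 ?_
    rw [abs_of_pos (by linarith)]
    nlinarith
  set v : ℕ → ℕ → ℝ := fun k n => Q0 * (exp (-((n:ℝ)/2)) * ((n+1)*(n:ℝ)^k)) with hv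
  have hvs : ∀ k, Summable (v k) := fun k => (w_summable k).mul_left Q0
  have hfd := iteratedFDeriv_tsum_apply (𝕜 := ℝ) (N := ⊤) (f := fun n x => (f n).eval (Real.cos x)) (v := v)
    (fun n => by
      have h0 : ContDiff ℝ ((⊤ : ℕ∞) : WithTop ℕ∞) (fun x : ℝ => (f n).eval x) := by
        simpa using (f n).contDiff_aeval (𝕜 := ℝ) ((⊤ : ℕ∞) : WithTop ℕ∞)
      exact h0.comp Real.contDiff_cos) (fun k _ => hvs k)
    (fun k n x _ => by
      rw [norm_iteratedFDeriv_eq_norm_iteratedDeriv, Real.norm_eq_abs]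
      refine (hterm n k x).trans ?_
      calc _ ≤ (exp (1/2) * exp (-((n:ℝ)/2))) * (S*S*π) * ((n+1)*(n:ℝ)^k) := by
            gcongr ?_ * _ * _
            exact hexp1 n
        _ = _ := by rw [hv, hQ0]; ring) (k := j) le_top θ
  set G : ℝ := (if j = 0 then exp (-t*|τ|) else 0) + exp (-((t-1)/2)) with hG
  have hsum : HasSum (fun n => G * v j n) (G * (Q0 * ∑' n : ℕ, exp (-((n:ℝ)/2)) * ((n+1)*(n:ℝ)^j))) :=
    ((w_summable j).hasSum.mul_left Q0).mul_left G
  rw [hH, ← Real.norm_eq_abs, ← norm_iteratedFDeriv_eq_norm_iteratedDeriv, hfd]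
  refine tsum_of_norm_bounded hsum ?_
  intro n
  rw [norm_iteratedFDeriv_eq_norm_iteratedDeriv, Real.norm_eq_abs]
  refine (hterm n j θ).trans ?_
  rcases Nat.eq_zero_or_pos n with rfl | hn
  · rcases Nat.eq_zero_or_pos j with rfl | hj
    · simp only [hG, hv, hQ0, if_true]
      simp
      have h1 : 1 ≤ exp (2⁻¹:ℝ) := Real.one_le_exp (by norm_num)
      have h2 : 0 ≤ S*S*π := by positivity
      have h3 := exp_pos (-(t*|τ|))
      have h4 := exp_pos (-((t-1)/2))
      calc exp (-(t*|τ|)) * (S*S*π) ≤ (exp (-(t*|τ|)) + exp (-((t-1)/2))) * (1 * (S*S*π)) := by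
            nlinarith
        _ ≤ (exp (-(t*|τ|)) + exp (-((t-1)/2))) * (exp (2⁻¹:ℝ) * (S*S*π)) := by gcongr
        _ = _ := by ring
    · simp [hv, hj.ne']
  · calc _ ≤ exp (-((t-1)/2)) * (exp (1/2) * exp (-((n:ℝ)/2))) * (S*S*π) * ((n+1)*(n:ℝ)^j) := by
          gcongr ?_ * _ * _
          exact hexp2 n hn
      _ = exp (-((t-1)/2)) * v j n := by rw [hv, hQ0]; ring
      _ ≤ _ := by
          have : 0 ≤ v j n := by rw [hv]; positivity
          gcongr
          rw [hG]
          have : 0 ≤ (if j = 0 then exp (-t*|τ|) else 0) := by split_ifs <;> positivity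
          linarith

lemma large_part2 {α β : ℝ} (hα : -1 < α) (hβ : -1 < β) {c : ℕ → ℝ} (hc : JacobiNormalized α β c)
    (j : ℕ) (hj : ¬ (j = 0 ∧ jacobiTau α β = 0)) :
    ∃ C cc : ℝ, 0 < cc ∧ ∀ t θ φ : ℝ, 1 ≤ t → θ ∈ Ioo 0 π → φ ∈ Ioo 0 π →
        |iteratedDeriv j (fun θ' => poissonKer α β c t θ' φ) θ| ≤ C * exp (-cc * t) := by
  obtain ⟨Q, hQ, h⟩ := large_part hα hβ hc j
  have hsecond : ∀ t : ℝ, exp (-((t-1)/2)) = exp (1/2) * exp (-(1/2)*t) := by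
    intro t; rw [← exp_add]; congr 1; ring
  rcases Nat.eq_zero_or_pos j with rfl | hj0
  · have hτ : 0 < |jacobiTau α β| := abs_pos.2 fun h0 => hj ⟨rfl, h0⟩
    refine ⟨(1 + exp (1/2)) * Q, min (|jacobiTau α β|) (1/2), lt_min hτ (by norm_num), ?_⟩
    intro t θ φ ht hθ hφ
    refine (h t θ φ ht hφ).trans ?_
    rw [if_pos rfl, hsecond]
    have e1 : exp (-t*|jacobiTau α β|) ≤ exp (-(min (|jacobiTau α β|) (1/2))*t) := by
      refine exp_le_exp.2 ?_
      have := min_le_left (|jacobiTau α β|) (1/2)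
      nlinarith
    have e2 : exp (-(1/2)*t) ≤ exp (-(min (|jacobiTau α β|) (1/2))*t) := by
      refine exp_le_exp.2 ?_
      have := min_le_right (|jacobiTau α β|) (1/2)
      nlinarith
    calc _ ≤ (exp (-(min (|jacobiTau α β|) (1/2))*t) + exp (1/2) * exp (-(min (|jacobiTau α β|) (1/2))*t)) * Q := by
          gcongr
      _ = _ := by ring
  · refine ⟨exp (1/2) * Q, 1/2, by norm_num, ?_⟩
    intro t θ φ ht hθ hφ
    refine (h t θ φ ht hφ).trans (le_of_eq ?_)
    rw [if_neg hj0.ne', hsecond]; ring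

/-- estimates for the derivatives `∂_θ^j H_t(θ,φ)` of the Jacobi-Poisson
kernel: a sharp bound for `0 < t ≤ 1`, and exponential decay for `t ≥ 1` (the latter
provided not both `j = 0` and `τ = 0`). -/
theorem jacobi_poisson_kernel_derivative_estimates
    (α β : ℝ) (hα : -1 < α) (hβ : -1 < β)
    (c : ℕ → ℝ) (hc : JacobiNormalized α β c) (j : ℕ) :
    (∃ C : ℝ, ∀ t θ φ : ℝ, 0 < t → t ≤ 1 →
      θ ∈ Set.Ioo 0 π → φ ∈ Set.Ioo 0 π →
      |iteratedDeriv j (fun θ' => poissonKer α β c t θ' φ) θ| ≤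
        C * (t^2 + θ^2 + φ^2) ^ (-α - 1/2) *
          (t^2 + (π - θ)^2 + (π - φ)^2) ^ (-β - 1/2) *
          (t / (t^2 + (θ - φ)^2) ^ ((1:ℝ) + (j:ℝ)/2))) ∧
    (¬ (j = 0 ∧ jacobiTau α β = 0) →
      ∃ C cc : ℝ, 0 < cc ∧ ∀ t θ φ : ℝ, 1 ≤ t →
        θ ∈ Set.Ioo 0 π → φ ∈ Set.Ioo 0 π →
        |iteratedDeriv j (fun θ' => poissonKer α β c t θ' φ) θ| ≤
          C * Real.exp (-cc * t)) := by
  refine ⟨?_, fun hj => large_part2 hα hβ hc j hj⟩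
  obtain ⟨C, hC⟩ := small_part hα hβ hc j
  refine ⟨C, fun t θ φ ht ht1 hθ hφ => ?_⟩
  refine (hC t θ φ ht ht1 hθ hφ).trans (le_of_eq ?_)
  unfold RHS; ring

end
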